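/- arXiv:0906.2631 — 2 statements merged into one kernel-verified Lean document; each statement's English description precedes it below -/
import Mathlib

section
/- Let G be a normal operator with compact resolvent on a separable complex Hilbert space H whose spectrum lies on a finite number of rays from the origin (i.e., σ(G) ⊆ ⋃_{j=1}^{n} e^{iθ_j}ℝ_{≥0} for some angles θ_j). Let S be p-subordinate to G with 0 ≤ p < 1, and suppose liminf_{r→∞} N(r,G)/r^{1−p} < ∞. Then T = G + S (with D(T) = D(G)) admits a Riesz basis of finite-dimensional T-invariant subspaces: there is a sequence (V_k)_{k∈ℕ} of finite-dimensional subspaces with V_k ⊆ D(T) and T(V_k) ⊆ V_k that forms a Riesz basis of subspaces of H. -/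
open scoped InnerProductSpace ComplexInnerProductSpace
open Filter Metric Complex

noncomputable section

structure Op (H : Type*) [NormedAddCommGroup H] [InnerProductSpace ℂ H] : Type _ where
  dom : Submodule ℂ H
  app : H →ₗ[ℂ] H

namespace Op

variable {H : Type*} [NormedAddCommGroup H] [InnerProductSpace ℂ H]

/-- `R` is the (bounded, everywhere defined) inverse of `T - z`. -/
def IsResolventAt (T : Op H) (z : ℂ) (R : H →L[ℂ] H) : Prop :=
  (∀ x, R x ∈ T.dom) ∧ (∀ x, T.app (R x) - z • R x = x) ∧
    ∀ x ∈ T.dom, R (T.app x - z • x) = x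

def resolventSet (T : Op H) : Set ℂ := {z | ∃ R, T.IsResolventAt z R}

def spec (T : Op H) : Set ℂ := (T.resolventSet)ᶜ

def HasCompactResolvent (T : Op H) : Prop :=
  ∃ z R, T.IsResolventAt z R ∧ IsCompactOperator R

def shift (T : Op H) (lam : ℂ) : H →ₗ[ℂ] H := T.app - lam • LinearMap.id

def IsRootVector (T : Op H) (lam : ℂ) (x : H) : Prop :=
  x ≠ 0 ∧ ∃ k : ℕ, 0 < k ∧ (∀ j < k, ((T.shift lam) ^ j) x ∈ T.dom) ∧
    ((T.shift lam) ^ k) x = 0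

def rootSubspace (T : Op H) (lam : ℂ) : Submodule ℂ H :=
  Submodule.span ℂ {x | T.IsRootVector lam x}

def IsEigenvalue (T : Op H) (lam : ℂ) : Prop :=
  ∃ x, x ≠ 0 ∧ x ∈ T.dom ∧ T.app x = lam • x

def rootSystem (T : Op H) : Submodule ℂ H :=
  Submodule.span ℂ {x | ∃ lam, T.IsRootVector lam x}

def CompleteRootSystem (T : Op H) : Prop := Dense (T.rootSystem : Set H)

def IsAdjointOf (T Tstar : Op H) : Prop :=
  (Tstar.dom : Set H) = {y | ∃ w, ∀ x ∈ T.dom, ⟪T.app x, y⟫_ℂ = ⟪x, w⟫_ℂ} ∧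
    ∀ y ∈ Tstar.dom, ∀ x ∈ T.dom, ⟪T.app x, y⟫_ℂ = ⟪x, Tstar.app y⟫_ℂ

def IsClosedOp (T : Op H) : Prop :=
  IsClosed {p : H × H | p.1 ∈ T.dom ∧ p.2 = T.app p.1}

def IsNormalOp (T : Op H) : Prop :=
  Dense (T.dom : Set H) ∧ T.IsClosedOp ∧
    ∃ Tstar : Op H, T.IsAdjointOf Tstar ∧ T.dom = Tstar.dom ∧
      ∀ u ∈ T.dom, ‖T.app u‖ = ‖Tstar.app u‖

/-- `S` is `p`-subordinate to `G` with bound `b`. -/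
def Subordinate (S G : Op H) (p b : ℝ) : Prop :=
  (G.dom : Set H) ⊆ (S.dom : Set H) ∧
    ∀ u ∈ G.dom, ‖S.app u‖ ≤ b * ‖u‖ ^ (1 - p) * ‖G.app u‖ ^ p

def addOp (G S : Op H) : Op H := ⟨G.dom, G.app + S.app⟩

/-- The sum of the root subspaces for eigenvalues in `K`. -/
def specSubspace (T : Op H) (K : Set ℂ) : Submodule ℂ H :=
  ⨆ lam ∈ K, T.rootSubspace lam

/-- `N(K,T)`: total multiplicity of the eigenvalues in `K`. -/
def dimIn (T : Op H) (K : Set ℂ) : ℕ :=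
  Module.finrank ℂ (T.specSubspace K)

/-- `N_+(r₁,r₂,G)`. -/
def dimPlus (T : Op H) (r1 r2 : ℝ) : ℕ :=
  T.dimIn {z | z.im = 0 ∧ r1 < z.re ∧ z.re < r2}

end Op

def IsRieszBasisOfSubspacesWith {H : Type*} [NormedAddCommGroup H]
    [InnerProductSpace ℂ H] {Λ : Type*} (V : Λ → Submodule ℂ H) (c : ℝ) : Prop :=
  Dense (↑(⨆ k, V k) : Set H) ∧
    ∀ (F : Finset Λ) (x : Λ → H), (∀ k ∈ F, x k ∈ V k) →
      c⁻¹ * ∑ k ∈ F, ‖x k‖ ^ 2 ≤ ‖∑ k ∈ F, x k‖ ^ 2 ∧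
        ‖∑ k ∈ F, x k‖ ^ 2 ≤ c * ∑ k ∈ F, ‖x k‖ ^ 2

def IsRieszBasisOfSubspaces {H : Type*} [NormedAddCommGroup H]
    [InnerProductSpace ℂ H] {Λ : Type*} (V : Λ → Submodule ℂ H) : Prop :=
  ∃ c : ℝ, 1 ≤ c ∧ IsRieszBasisOfSubspacesWith V c

end
/-- The closed ray `e^{iθ} ℝ≥0`. -/
def rayFrom (θ : ℝ) : Set ℂ :=
  {z | ∃ x : ℝ, 0 ≤ x ∧ z = (x : ℂ) * Complex.exp (θ * Complex.I)}

noncomputable section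

namespace HilbertBasis

variable {ι H : Type*} [NormedAddCommGroup H] [InnerProductSpace ℂ H]

lemma hasSum_norm_inner_sq (e : HilbertBasis ι ℂ H) (x : H) :
    HasSum (fun i => ‖⟪e i, x⟫_ℂ‖ ^ 2) (‖x‖ ^ 2) := by
  have h := e.hasSum_inner_mul_inner x x
  have h2 : (fun i => ⟪x, e i⟫_ℂ * ⟪e i, x⟫_ℂ) = fun i => ((‖⟪e i, x⟫_ℂ‖ ^ 2 : ℝ) : ℂ) := by
    funext i
    rw [← inner_conj_symm x (e i), ← Complex.normSq_eq_conj_mul_self, Complex.normSq_eq_norm_sq]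
  rw [h2, inner_self_eq_norm_sq_to_K] at h
  have h3 : HasSum (fun i => ((‖⟪e i, x⟫_ℂ‖ ^ 2 : ℝ) : ℂ)) ((‖x‖ ^ 2 : ℝ) : ℂ) := by
    simpa using h
  exact Complex.hasSum_ofReal.mp h3

lemma ext_inner (e : HilbertBasis ι ℂ H) {x y : H} (h : ∀ i, ⟪e i, x⟫_ℂ = ⟪e i, y⟫_ℂ) :
    x = y := by
  have := e.hasSum_norm_inner_sq (x - y)
  simp only [inner_sub_right, h, sub_self, norm_zero, ne_eq, OfNat.ofNat_ne_zero,
    not_false_eq_true, zero_pow] at this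
  have h0 := this.unique hasSum_zero
  simpa [sub_eq_zero] using h0

lemma exists_coord (e : HilbertBasis ι ℂ H) {a : ι → ℂ} (ha : Summable fun i => ‖a i‖ ^ 2) :
    ∃ x : H, ∀ i, ⟪e i, x⟫_ℂ = a i := by
  have hm : Memℓp a 2 := by
    apply memℓp_gen
    simpa using ha
  refine ⟨e.repr.symm ⟨a, hm⟩, fun i => ?_⟩
  rw [← e.repr_apply_apply]
  simp

lemma inner_self_apply (e : HilbertBasis ι ℂ H) [DecidableEq ι] (i j : ι) :
    ⟪e i, e j⟫_ℂ = if i = j then 1 else 0 :=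
  orthonormal_iff_ite.mp e.orthonormal i j

lemma norm_apply (e : HilbertBasis ι ℂ H) (i : ι) : ‖e i‖ = 1 := e.orthonormal.1 i

lemma exists_diag (e : HilbertBasis ι ℂ H) (m : ι → ℂ) (C : ℝ) (hC : ∀ i, ‖m i‖ ≤ C) :
    ∃ D : H →L[ℂ] H, ∀ i x, ⟪e i, D x⟫_ℂ = m i * ⟪e i, x⟫_ℂ := by
  have hbd : ∀ (x : H) (i : ι), ‖m i * ⟪e i, x⟫_ℂ‖ ^ 2 ≤ C ^ 2 * ‖⟪e i, x⟫_ℂ‖ ^ 2 := by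
    intro x i
    rw [norm_mul, mul_pow]
    gcongr
    exact hC i
  have hs : ∀ x : H, Summable fun i => ‖m i * ⟪e i, x⟫_ℂ‖ ^ 2 := fun x =>
    Summable.of_nonneg_of_le (fun _ => by positivity) (hbd x)
      ((e.hasSum_norm_inner_sq x).summable.mul_left _)
  choose D hD using fun x => e.exists_coord (hs x)
  let L : H →ₗ[ℂ] H :=
    { toFun := D
      map_add' := fun x y => e.ext_inner fun i => by
        simp only [hD, inner_add_right, mul_add]
      map_smul' := fun c x => e.ext_inner fun i => by
        simp only [hD, inner_smul_right, RingHom.id_apply]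
        ring }
  refine ⟨L.mkContinuous |C| fun x => ?_, fun i x => hD x i⟩
  refine abs_le_of_sq_le_sq' ?_ (by positivity) |>.2
  rw [mul_pow, sq_abs]
  refine hasSum_le (fun i => ?_) (e.hasSum_norm_inner_sq (L x))
    ((e.hasSum_norm_inner_sq x).mul_left (C ^ 2))
  have := hbd x i
  rwa [← hD] at this

open Classical in
/-- The diagonal operator `e i ↦ m i • e i`; zero if `m` is unbounded. -/
def diag (e : HilbertBasis ι ℂ H) (m : ι → ℂ) : H →L[ℂ] H :=
  if h : ∃ C : ℝ, ∀ i, ‖m i‖ ≤ C then (e.exists_diag m h.choose h.choose_spec).choose else 0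

lemma inner_diag (e : HilbertBasis ι ℂ H) {m : ι → ℂ} {C : ℝ} (hC : ∀ i, ‖m i‖ ≤ C)
    (i : ι) (x : H) : ⟪e i, e.diag m x⟫_ℂ = m i * ⟪e i, x⟫_ℂ := by
  have h : ∃ C : ℝ, ∀ i, ‖m i‖ ≤ C := ⟨C, hC⟩
  rw [diag, dif_pos h]
  exact (e.exists_diag m h.choose h.choose_spec).choose_spec i x

lemma norm_diag_apply_le (e : HilbertBasis ι ℂ H) {m : ι → ℂ} {C : ℝ} (hC0 : 0 ≤ C)
    (hC : ∀ i, ‖m i‖ ≤ C) (x : H) : ‖e.diag m x‖ ≤ C * ‖x‖ := by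
  refine abs_le_of_sq_le_sq' ?_ (by positivity) |>.2
  rw [mul_pow]
  refine hasSum_le (fun i => ?_) (e.hasSum_norm_inner_sq (e.diag m x))
    ((e.hasSum_norm_inner_sq x).mul_left (C ^ 2))
  rw [e.inner_diag hC, norm_mul, mul_pow]
  gcongr
  exact hC i

lemma norm_diag_le (e : HilbertBasis ι ℂ H) {m : ι → ℂ} {C : ℝ} (hC0 : 0 ≤ C)
    (hC : ∀ i, ‖m i‖ ≤ C) : ‖e.diag m‖ ≤ C :=
  ContinuousLinearMap.opNorm_le_bound _ hC0 (e.norm_diag_apply_le hC0 hC)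

lemma diag_apply_basis (e : HilbertBasis ι ℂ H) {m : ι → ℂ} {C : ℝ} (hC : ∀ i, ‖m i‖ ≤ C)
    (i : ι) : e.diag m (e i) = m i • e i := by
  classical
  refine e.ext_inner fun j => ?_
  rw [e.inner_diag hC, inner_smul_right, e.inner_self_apply]
  split_ifs with h <;> simp [h]

lemma inner_diag_left (e : HilbertBasis ι ℂ H) {m : ι → ℂ} {C : ℝ} (hC : ∀ i, ‖m i‖ ≤ C)
    (x y : H) : ⟪e.diag m x, y⟫_ℂ = ⟪x, e.diag (fun i => star (m i)) y⟫_ℂ := by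
  have hC' : ∀ i, ‖star (m i)‖ ≤ C := fun i => by simpa using hC i
  rw [← (e.hasSum_inner_mul_inner _ _).tsum_eq, ← (e.hasSum_inner_mul_inner _ _).tsum_eq]
  congr 1
  funext i
  rw [e.inner_diag hC', ← inner_conj_symm, e.inner_diag hC, ← inner_conj_symm x]
  simp only [map_mul, star_def]
  ring

lemma sum_norm_diag_sq_le (e : HilbertBasis ι ℂ H) {κ : Type*} (F : Finset κ) (m : κ → ι → ℂ)
    (h : ∀ i, ∑ k ∈ F, ‖m k i‖ ^ 2 ≤ 1) (x : H) :
    ∑ k ∈ F, ‖e.diag (m k) x‖ ^ 2 ≤ ‖x‖ ^ 2 := by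
  have hb : ∀ k ∈ F, ∀ i, ‖m k i‖ ≤ 1 := by
    intro k hk i
    have := (Finset.single_le_sum (f := fun k => ‖m k i‖ ^ 2) (fun _ _ => by positivity) hk).trans
      (h i)
    exact (sq_le_one_iff₀ (norm_nonneg _)).mp this
  refine hasSum_le (fun i => ?_)
    (hasSum_sum fun k _ => e.hasSum_norm_inner_sq (e.diag (m k) x)) (e.hasSum_norm_inner_sq x)
  rw [Finset.sum_congr rfl fun k hk => by rw [e.inner_diag (hb k hk), norm_mul, mul_pow],
    ← Finset.sum_mul]
  exact mul_le_of_le_one_left (by positivity) (h i)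

end HilbertBasis

lemma finite_setOf_le_norm_of_compact {ι H : Type*} [NormedAddCommGroup H]
    [InnerProductSpace ℂ H] (e : HilbertBasis ι ℂ H) {R : H →L[ℂ] H}
    (hc : IsCompactOperator R) {ν : ι → ℂ} (hν : ∀ i, R (e i) = ν i • e i) {ε : ℝ} (hε : 0 < ε) :
    {i | ε ≤ ‖ν i‖}.Finite := by
  classical
  by_contra hinf
  have hinf : {i | ε ≤ ‖ν i‖}.Infinite := hinf
  have hcpt := hc.isCompact_closure_image_closedBall 1
  have hsub : ((fun i => R (e i)) '' {i | ε ≤ ‖ν i‖}) ⊆ closure (R '' closedBall 0 1) := by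
    rintro _ ⟨i, _, rfl⟩
    exact subset_closure ⟨e i, by simp [e.norm_apply], rfl⟩
  have hdist : ∀ i ∈ {i | ε ≤ ‖ν i‖}, ∀ j ∈ {i | ε ≤ ‖ν i‖}, i ≠ j →
      ε ≤ dist (R (e i)) (R (e j)) := by
    intro i hi j _ hij
    have h1 : ⟪e i, R (e i) - R (e j)⟫_ℂ = ν i := by
      rw [hν, hν, inner_sub_right, inner_smul_right, inner_smul_right, e.inner_self_apply,
        e.inner_self_apply, if_pos rfl, if_neg hij]
      ring
    calc ε ≤ ‖ν i‖ := hi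
      _ = ‖⟪e i, R (e i) - R (e j)⟫_ℂ‖ := by rw [h1]
      _ ≤ ‖e i‖ * ‖R (e i) - R (e j)‖ := norm_inner_le_norm _ _
      _ = _ := by rw [e.norm_apply, one_mul, dist_eq_norm]
  have hinj : Set.InjOn (fun i => R (e i)) {i | ε ≤ ‖ν i‖} := by
    intro i hi j hj hij
    by_contra hne
    have := hdist i hi j hj hne
    simp only at hij
    rw [hij, dist_self] at this
    linarith
  obtain ⟨x, -, hx⟩ := (hinf.image hinj).exists_accPt_of_subset_isCompact hcpt hsub
  rw [accPt_iff_frequently] at hx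
  have hx1 := (hx.and_eventually (ball_mem_nhds x (half_pos hε))).exists
  obtain ⟨y, ⟨hyx, i, hi, rfl⟩, hy⟩ := hx1
  have hpos : 0 < dist (R (e i)) x := dist_pos.mpr hyx
  have hx2 := (hx.and_eventually (ball_mem_nhds x (lt_min (half_pos hε) hpos))).exists
  obtain ⟨y, ⟨_, j, hj, rfl⟩, hy'⟩ := hx2
  simp only [lt_min_iff] at hy hy'
  have hij : i ≠ j := by
    rintro rfl
    exact lt_irrefl _ hy'.2
  have := hdist i hi j hj hij
  have := dist_triangle_right (R (e i)) (R (e j)) x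
  linarith [hy'.1]

section CompactNormal

open Module.End ContinuousLinearMap

variable {H : Type*} [NormedAddCommGroup H] [InnerProductSpace ℂ H] [CompleteSpace H]

lemma adjoint_apply_eq_of_isStarNormal {R : H →L[ℂ] H} (hR : IsStarNormal R) {ν : ℂ} {y : H}
    (hy : R y = ν • y) : adjoint R y = star ν • y := by
  have hN : IsStarNormal (R - ν • (1 : H →L[ℂ] H)) := by
    have h := hR.star_comm_self.eq
    refine ⟨?_⟩
    rw [Commute, SemiconjBy, star_sub, star_smul, star_one]
    simp only [sub_mul, mul_sub, h, smul_mul_assoc, one_mul, mul_smul_comm, mul_one]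
    rw [smul_sub, smul_sub, smul_comm ν (star ν)]
    abel
  have h2 := (IsStarNormal.adjoint_apply_eq_zero_iff hN y).mpr (by simp [hy])
  rw [← star_eq_adjoint, star_sub, star_smul, star_one] at h2
  simpa [sub_eq_zero, star_eq_adjoint] using h2

lemma orthogonal_iSup_eigenspace_eq_bot_of_normal {R : H →L[ℂ] H} (hR : IsStarNormal R)
    (hc : IsCompactOperator R) (hinj : ∀ x, R x = 0 → x = 0) :
    (⨆ ν, eigenspace (R : Module.End ℂ H) ν)ᗮ = ⊥ := by
  set N := (⨆ ν, eigenspace (R : Module.End ℂ H) ν)ᗮ with hN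
  have hmem : ∀ x, x ∈ N ↔ ∀ (ν : ℂ) (y : H), R y = ν • y → ⟪y, x⟫_ℂ = 0 := by
    intro x
    rw [hN, ← Submodule.iInf_orthogonal, Submodule.mem_iInf]
    refine forall_congr' fun ν => ?_
    rw [Submodule.mem_orthogonal]
    simp
  have hRN : ∀ x ∈ N, R x ∈ N := by
    intro x hx
    rw [hmem] at hx ⊢
    intro ν y hy
    rw [← adjoint_inner_left, adjoint_apply_eq_of_isStarNormal hR hy, inner_smul_left, hx ν y hy,
      mul_zero]
  have hRN' : ∀ x ∈ N, adjoint R x ∈ N := by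
    intro x hx
    rw [hmem] at hx ⊢
    intro ν y hy
    rw [adjoint_inner_right, hy, inner_smul_left, hx ν y hy, mul_zero]
  set A : H →L[ℂ] H := adjoint R ∘L R with hA
  have hAN : ∀ x ∈ N, A x ∈ N := fun x hx => hRN' _ (hRN x hx)
  have hAc : IsCompactOperator A := hc.clm_comp (adjoint R)
  have hAs : (A : H →ₗ[ℂ] H).IsSymmetric := by
    intro x y
    simp [hA, adjoint_inner_left, adjoint_inner_right]
  have hAinj : ∀ x, A x = 0 → x = 0 := by
    intro x hx
    refine hinj x ?_
    have : ⟪A x, x⟫_ℂ = ⟪R x, R x⟫_ℂ := by simp [hA, adjoint_inner_left]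
    rw [hx, inner_zero_left] at this
    exact inner_self_eq_zero.mp this.symm
  have hRA : ∀ x, R (A x) = A (R x) := by
    intro x
    have h := congrArg (fun B : H →L[ℂ] H => B (R x)) hR.star_comm_self.eq
    simpa [hA, star_eq_adjoint] using h.symm
  have hEN : ∀ (μ : ℂ) (x : H), x ∈ N → A x = μ • x → x = 0 := by
    intro μ x hxN hx
    by_contra hx0
    have hμ : μ ≠ 0 := by
      rintro rfl
      exact hx0 (hAinj x (by simpa using hx))
    let F : Submodule ℂ H := eigenspace (A : Module.End ℂ H) μ ⊓ N
    have hfin : FiniteDimensional ℂ (eigenspace (A : Module.End ℂ H) μ) :=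
      finite_dimensional_eigenspace hAc μ hμ
    have hF : FiniteDimensional ℂ F := Submodule.finiteDimensional_inf_left _ _
    have hRF : ∀ y ∈ F, (R : Module.End ℂ H) y ∈ F := by
      rintro y ⟨hy, hyN⟩
      refine ⟨?_, hRN y hyN⟩
      rw [SetLike.mem_coe, mem_eigenspace_iff] at hy ⊢
      change A y = μ • y at hy
      change A (R y) = μ • R y
      rw [← hRA, hy, map_smul]
    have hnt : Nontrivial F := by
      refine ⟨⟨⟨x, ?_, hxN⟩, 0, fun h => hx0 (congrArg Subtype.val h)⟩⟩
      rw [SetLike.mem_coe, mem_eigenspace_iff]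
      exact hx
    obtain ⟨ν, hν⟩ := exists_eigenvalue ((R : Module.End ℂ H).restrict hRF)
    obtain ⟨v, hv, hv0⟩ := hν.exists_hasEigenvector
    rw [mem_eigenspace_iff] at hv
    have hv' : R v = ν • (v : H) := congrArg Subtype.val hv
    have := (hmem v).mp v.2.2 ν v hv'
    exact hv0 (Subtype.ext (inner_self_eq_zero.mp this))
  let S : N →L[ℂ] N := A.restrict hAN
  have hSc : IsCompactOperator S := hAc.restrict' hAN
  have hSs : (S : N →ₗ[ℂ] N).IsSymmetric := hAs.restrict_invariant hAN
  have h := orthogonalComplement_iSup_eigenspaces_eq_bot hSc hSs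
  have h0 : (⨆ μ, eigenspace (S : Module.End ℂ N) μ) = ⊥ := by
    rw [iSup_eq_bot]
    intro μ
    rw [eq_bot_iff]
    intro x hx
    rw [mem_eigenspace_iff] at hx
    have hx' : A x = μ • (x : H) := congrArg Subtype.val hx
    exact (Submodule.mem_bot _).mpr (Subtype.ext (hEN μ x x.2 hx'))
  rw [h0, Submodule.bot_orthogonal_eq_top] at h
  rw [eq_bot_iff]
  intro x hx
  have : (⟨x, hx⟩ : N) ∈ (⊤ : Submodule ℂ N) := trivial
  rw [h, Submodule.mem_bot] at this
  exact (Submodule.mem_bot _).mpr (congrArg Subtype.val this)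

theorem exists_hilbertBasis_of_compact_normal {R : H →L[ℂ] H} (hR : IsStarNormal R)
    (hc : IsCompactOperator R) (hinj : ∀ x, R x = 0 → x = 0) :
    ∃ (ι : Type) (e : HilbertBasis ι ℂ H) (ν : ι → ℂ), ∀ i, R (e i) = ν i • e i := by
  classical
  let E : ℂ → Submodule ℂ H := fun ν => eigenspace (R : Module.End ℂ H) ν
  have hE : ∀ ν x, x ∈ E ν ↔ R x = ν • x := fun ν x => mem_eigenspace_iff
  have hfin : ∀ ν, FiniteDimensional ℂ (E ν) := by
    intro ν
    by_cases hν : ν = 0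
    · have : E ν = ⊥ := by
        rw [eq_bot_iff]
        intro x hx
        rw [hE, hν, zero_smul] at hx
        exact (Submodule.mem_bot _).mpr (hinj x hx)
      rw [this]
      infer_instance
    · exact finite_dimensional_eigenspace hc ν hν
  have hort : OrthogonalFamily ℂ (fun ν => E ν) fun ν => (E ν).subtypeₗᵢ := by
    intro ν ν' hne x y
    have hx := (hE _ _).mp x.2
    have hy := (hE _ _).mp y.2
    have h1 : ⟪(x : H), R y⟫_ℂ = ν' * ⟪(x : H), (y : H)⟫_ℂ := by rw [hy, inner_smul_right]
    rw [← adjoint_inner_left, adjoint_apply_eq_of_isStarNormal hR hx, inner_smul_left] at h1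
    simp only [star_def, Complex.conj_conj] at h1
    have h2 : (ν - ν') * ⟪(x : H), (y : H)⟫_ℂ = 0 := by rw [sub_mul, h1, sub_self]
    exact (mul_eq_zero.mp h2).resolve_left (sub_ne_zero.mpr hne)
  let v : ∀ ν, OrthonormalBasis (Fin (Module.finrank ℂ (E ν))) ℂ (E ν) :=
    fun ν => stdOrthonormalBasis ℂ (E ν)
  have hon := hort.orthonormal_sigma_orthonormal (fun ν => (v ν).orthonormal)
  have hsp : (Submodule.span ℂ (Set.range fun a : Σ ν : ℂ, Fin (Module.finrank ℂ (E ν)) =>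
      (E a.1).subtypeₗᵢ (v a.1 a.2)))ᗮ = ⊥ := by
    rw [eq_bot_iff, ← orthogonal_iSup_eigenspace_eq_bot_of_normal hR hc hinj]
    refine Submodule.orthogonal_le (iSup_le fun ν => ?_)
    have h1 := (v ν).toBasis.span_eq
    intro x hx
    have h2 : (⟨x, hx⟩ : E ν) ∈ Submodule.span ℂ (Set.range (v ν)) := by
      have : (⟨x, hx⟩ : E ν) ∈ (⊤ : Submodule ℂ (E ν)) := trivial
      rwa [← h1, OrthonormalBasis.coe_toBasis] at this
    have h3 := Submodule.mem_map_of_mem (f := (E ν).subtype) h2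
    rw [Submodule.map_span] at h3
    refine Submodule.span_mono ?_ h3
    rintro _ ⟨_, ⟨k, rfl⟩, rfl⟩
    exact ⟨⟨ν, k⟩, rfl⟩
  refine ⟨_, HilbertBasis.mkOfOrthogonalEqBot hon hsp, fun a => a.1, fun a => ?_⟩
  rw [HilbertBasis.coe_mkOfOrthogonalEqBot]
  exact (hE _ _).mp (v a.1 a.2).2

end CompactNormal

section NormalOperators

open ContinuousLinearMap

variable {H : Type*} [NormedAddCommGroup H] [InnerProductSpace ℂ H]

/-- `G` acts diagonally, with eigenvalues `lam`, in the Hilbert basis `e`. -/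
def Op.IsDiagonalIn {ι : Type*} (G : Op H) (e : HilbertBasis ι ℂ H) (lam : ι → ℂ) : Prop :=
  (∀ (m : ι → ℂ) (C C' : ℝ), (∀ i, ‖m i‖ ≤ C) → (∀ i, ‖lam i * m i‖ ≤ C') →
    ∀ x, e.diag m x ∈ G.dom) ∧
  ∀ x ∈ G.dom, ∀ i, ⟪e i, G.app x⟫_ℂ = lam i * ⟪e i, x⟫_ℂ

namespace Op

lemma IsNormalOp.isStarNormal_resolvent [CompleteSpace H] {G : Op H} (hG : G.IsNormalOp)
    {z : ℂ} {R : H →L[ℂ] H} (hR : G.IsResolventAt z R) : IsStarNormal R := by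
  obtain ⟨hdense, -, Gs, ⟨hdom, hadj⟩, heq, hnorm⟩ := hG
  obtain ⟨hR1, hR2, hR3⟩ := hR
  set N : H →ₗ[ℂ] H := G.app - z • LinearMap.id with hN
  set N' : H →ₗ[ℂ] H := Gs.app - star z • LinearMap.id with hN'
  have hNa : ∀ x, N x = G.app x - z • x := fun x => rfl
  have hNa' : ∀ x, N' x = Gs.app x - star z • x := fun x => rfl
  have h1 : ∀ x ∈ G.dom, ∀ y ∈ G.dom, ⟪N x, y⟫_ℂ = ⟪x, N' y⟫_ℂ := by
    intro x hx y hy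
    rw [hNa, hNa', inner_sub_left, inner_sub_right, hadj y (heq ▸ hy) x hx, inner_smul_left,
      inner_smul_right, star_def]
  have h2 : ∀ u ∈ G.dom, ‖N u‖ ^ 2 = ‖N' u‖ ^ 2 := by
    intro u hu
    rw [hNa, hNa', @norm_sub_sq ℂ, @norm_sub_sq ℂ, hnorm u hu, norm_smul, norm_smul, norm_star,
      inner_smul_right, inner_smul_right, hadj u (heq ▸ hu) u hu, ← inner_conj_symm u (Gs.app u),
      star_def]
    have : z * (starRingEnd ℂ) ⟪Gs.app u, u⟫_ℂ
        = (starRingEnd ℂ) ((starRingEnd ℂ) z * ⟪Gs.app u, u⟫_ℂ) := by simp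
    rw [this, RCLike.conj_re]
  have h4 : ∀ u ∈ G.dom, ∀ v ∈ G.dom, ⟪N u, N v⟫_ℂ = ⟪N' u, N' v⟫_ℂ := by
    intro u hu v hv
    have key : ∀ c : ℂ, ‖N u + c • N v‖ ^ 2 = ‖N' u + c • N' v‖ ^ 2 := by
      intro c
      have := h2 (u + c • v) (add_mem hu (G.dom.smul_mem c hv))
      simpa only [map_add, map_smul] using this
    have k1 := key 1
    have k2 := key (-1)
    have k3 := key I
    have k4 := key (-I)
    simp only [one_smul, neg_smul, ← sub_eq_add_neg] at k1 k2 k3 k4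
    rw [inner_eq_sum_norm_sq_div_four, inner_eq_sum_norm_sq_div_four]
    simp only [RCLike.I_to_complex]
    have c1 := congrArg (fun t : ℝ => (t : ℂ)) k1
    have c2 := congrArg (fun t : ℝ => (t : ℂ)) k2
    have c3 := congrArg (fun t : ℝ => (t : ℂ)) k3
    have c4 := congrArg (fun t : ℝ => (t : ℂ)) k4
    push_cast at c1 c2 c3 c4
    simp only [RCLike.ofReal_eq_complex_ofReal, c1, c2, c3, c4]
  have h3 : ∀ y, adjoint R y ∈ G.dom ∧ N' (adjoint R y) = y := by
    intro y
    have hw : ∀ x ∈ G.dom, ⟪G.app x, adjoint R y⟫_ℂ = ⟪x, y + star z • adjoint R y⟫_ℂ := by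
      intro x hx
      have hx' := hR3 x hx
      rw [map_sub, map_smul, sub_eq_iff_eq_add] at hx'
      rw [adjoint_inner_right, hx', inner_add_left, inner_smul_left, inner_add_right,
        inner_smul_right, adjoint_inner_right, star_def]
    have hmem : adjoint R y ∈ G.dom := by
      rw [heq, ← SetLike.mem_coe, hdom]
      exact ⟨_, hw⟩
    refine ⟨hmem, ?_⟩
    have : Gs.app (adjoint R y) = y + star z • adjoint R y := by
      refine hdense.eq_of_inner_right ℂ fun x hx => ?_
      rw [← hadj _ (heq ▸ hmem) x hx, hw x hx]
    rw [hNa', this, add_sub_cancel_right]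
  have h5 : ∀ x ∈ G.dom, adjoint R (N' x) = x := by
    intro x hx
    refine ext_inner_left ℂ fun y => ?_
    rw [adjoint_inner_right, ← h1 _ (hR1 y) x hx, hNa, hR2]
  have h6 : ∀ y, N' (R (adjoint R y)) = R y := by
    intro y
    refine ext_inner_right ℂ fun x => ?_
    conv_lhs => rw [← (h3 x).2]
    rw [← h4 _ (hR1 _) _ (h3 x).1, hNa (R (adjoint R y)), hR2, adjoint_inner_left, hNa,
      hR3 _ (h3 x).1, adjoint_inner_right]
  refine ⟨?_⟩
  refine ContinuousLinearMap.ext fun y => ?_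
  have := h5 _ (hR1 (adjoint R y))
  rw [h6] at this
  simpa [star_eq_adjoint] using this

theorem IsNormalOp.exists_isDiagonalIn [CompleteSpace H] {G : Op H} (hG : G.IsNormalOp)
    (hc : G.HasCompactResolvent) :
    ∃ (ι : Type) (e : HilbertBasis ι ℂ H) (lam : ι → ℂ), G.IsDiagonalIn e lam ∧
      ∀ r : ℝ, {i | ‖lam i‖ ≤ r}.Finite := by
  obtain ⟨z, R, hR, hRc⟩ := hc
  have hinj : ∀ x, R x = 0 → x = 0 := by
    intro x hx
    have := hR.2.1 x
    rw [hx] at this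
    simpa using this.symm
  have hn := hG.isStarNormal_resolvent hR
  obtain ⟨ι, e, ν, hν⟩ := exists_hilbertBasis_of_compact_normal hn hRc hinj
  have hν0 : ∀ i, ν i ≠ 0 := by
    intro i h0
    have := hinj (e i) (by rw [hν, h0, zero_smul])
    have h1 := e.norm_apply i
    rw [this, norm_zero] at h1
    exact zero_ne_one h1
  have hRi : ∀ i y, ⟪e i, R y⟫_ℂ = ν i * ⟪e i, y⟫_ℂ := by
    intro i y
    rw [← adjoint_inner_left, adjoint_apply_eq_of_isStarNormal hn (hν i), inner_smul_left,
      star_def, Complex.conj_conj]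
  refine ⟨ι, e, fun i => z + (ν i)⁻¹, ⟨?_, ?_⟩, ?_⟩
  · intro m C C' hC hC' x
    have hb : ∀ i, ‖(ν i)⁻¹ * m i‖ ≤ C' + ‖z‖ * C := by
      intro i
      have : (ν i)⁻¹ * m i = (z + (ν i)⁻¹) * m i - z * m i := by ring
      rw [this]
      refine (norm_sub_le _ _).trans (add_le_add (hC' i) ?_)
      rw [norm_mul]
      exact mul_le_mul_of_nonneg_left (hC i) (norm_nonneg _)
    have : e.diag m x = R (e.diag (fun i => (ν i)⁻¹ * m i) x) := by
      refine e.ext_inner fun i => ?_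
      rw [hRi, e.inner_diag hC, e.inner_diag hb]
      field_simp [hν0 i]
    rw [this]
    exact hR.1 _
  · intro x hx i
    have h1 : ⟪e i, x⟫_ℂ = ν i * ⟪e i, G.app x - z • x⟫_ℂ := by
      rw [← hRi, hR.2.2 x hx]
    rw [inner_sub_right, inner_smul_right] at h1
    have h2 := hν0 i
    field_simp
    linear_combination -h1
  · intro r
    have hpos : 0 < (|r| + ‖z‖ + 1)⁻¹ := by positivity
    refine (finite_setOf_le_norm_of_compact e hRc hν hpos).subset fun i hi => ?_
    have h1 : ‖(ν i)⁻¹‖ ≤ |r| + ‖z‖ + 1 := by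
      have : (ν i)⁻¹ = (z + (ν i)⁻¹) - z := by ring
      rw [this]
      refine (norm_sub_le _ _).trans ?_
      have hi' : ‖z + (ν i)⁻¹‖ ≤ r := hi
      linarith [le_abs_self r]
    rw [norm_inv] at h1
    exact inv_le_of_inv_le₀ (norm_pos_iff.mpr (hν0 i)) h1

namespace IsDiagonalIn

variable {ι : Type*} {G : Op H} {e : HilbertBasis ι ℂ H} {lam : ι → ℂ}

lemma basis_mem_dom (h : G.IsDiagonalIn e lam) (i : ι) : e i ∈ G.dom := by
  classical
  have h1 : ∀ j, ‖(if j = i then (1 : ℂ) else 0)‖ ≤ 1 := by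
    intro j
    split_ifs <;> simp
  have h2 := h.1 (fun j => if j = i then 1 else 0) 1 ‖lam i‖ h1 (by
    intro j
    split_ifs with hj <;> simp [hj]) (e i)
  rw [e.diag_apply_basis h1] at h2
  simpa using h2

lemma app_basis (h : G.IsDiagonalIn e lam) (i : ι) : G.app (e i) = lam i • e i := by
  classical
  refine e.ext_inner fun j => ?_
  rw [h.2 _ (h.basis_mem_dom i), inner_smul_right, e.inner_self_apply]
  split_ifs with hj <;> simp [hj]

lemma app_diag (h : G.IsDiagonalIn e lam) {m : ι → ℂ} {C C' : ℝ} (hC : ∀ i, ‖m i‖ ≤ C)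
    (hC' : ∀ i, ‖lam i * m i‖ ≤ C') (x : H) :
    G.app (e.diag m x) = e.diag (fun i => lam i * m i) x := by
  refine e.ext_inner fun i => ?_
  rw [h.2 _ (h.1 m C C' hC hC' x), e.inner_diag hC, e.inner_diag hC', mul_assoc]

lemma mem_spec (h : G.IsDiagonalIn e lam) (i : ι) : lam i ∈ G.spec := by
  rintro ⟨R, -, -, hR⟩
  have := hR _ (h.basis_mem_dom i)
  rw [h.app_basis, sub_self, map_zero] at this
  have h1 := e.norm_apply i
  rw [← this, norm_zero] at h1
  exact zero_ne_one h1

lemma inner_shift_pow (h : G.IsDiagonalIn e lam) {μ : ℂ} {x : H} {k : ℕ}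
    (hx : ∀ j < k, ((G.shift μ) ^ j) x ∈ G.dom) (i : ι) :
    ∀ j ≤ k, ⟪e i, ((G.shift μ) ^ j) x⟫_ℂ = (lam i - μ) ^ j * ⟪e i, x⟫_ℂ := by
  intro j
  induction j with
  | zero => simp
  | succ j ih =>
    intro hj
    have h1 := ih (by omega)
    rw [pow_succ', Module.End.mul_apply]
    have h2 : G.shift μ ((G.shift μ ^ j) x)
        = G.app ((G.shift μ ^ j) x) - μ • (G.shift μ ^ j) x := rfl
    rw [h2, inner_sub_right, inner_smul_right, h.2 _ (hx j (by omega)), h1]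
    ring

lemma specSubspace_eq_span (h : G.IsDiagonalIn e lam) {K : Set ℂ}
    (hK : {i | lam i ∈ K}.Finite) :
    G.specSubspace K = Submodule.span ℂ (e '' {i | lam i ∈ K}) := by
  classical
  apply le_antisymm
  · refine iSup₂_le fun μ hμ => Submodule.span_le.mpr ?_
    rintro x ⟨-, k, hk, hdom, h0⟩
    have hx0 : ∀ i, lam i ∉ K → ⟪e i, x⟫_ℂ = 0 := by
      intro i hi
      have := h.inner_shift_pow hdom i k le_rfl
      rw [h0, inner_zero_right] at this
      refine (mul_eq_zero.mp this.symm).resolve_left (pow_ne_zero _ (sub_ne_zero.mpr ?_))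
      rintro rfl
      exact hi hμ
    have hsum : x = ∑ i ∈ hK.toFinset, ⟪e i, x⟫_ℂ • e i := by
      refine e.ext_inner fun j => ?_
      rw [inner_sum]
      simp only [inner_smul_right, e.inner_self_apply, mul_ite, mul_one, mul_zero,
        Finset.sum_ite_eq, Set.Finite.mem_toFinset, Set.mem_ofPred_eq]
      split_ifs with hj
      · rfl
      · exact hx0 j hj
    rw [SetLike.mem_coe, hsum]
    refine Submodule.sum_mem _ fun i hi => Submodule.smul_mem _ _ (Submodule.subset_span ?_)
    exact ⟨i, by simpa using hi, rfl⟩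
  · refine Submodule.span_le.mpr ?_
    rintro _ ⟨i, hi, rfl⟩
    refine Submodule.mem_iSup_of_mem (lam i) (Submodule.mem_iSup_of_mem hi ?_)
    refine Submodule.subset_span ⟨e.orthonormal.ne_zero i, 1, one_pos, ?_, ?_⟩
    · intro j hj
      obtain rfl : j = 0 := by omega
      simpa using h.basis_mem_dom i
    · rw [pow_one]
      change G.app (e i) - lam i • e i = 0
      rw [h.app_basis, sub_self]

lemma dimIn_eq_card (h : G.IsDiagonalIn e lam) {K : Set ℂ} (hK : {i | lam i ∈ K}.Finite) :
    G.dimIn K = hK.toFinset.card := by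
  classical
  rw [dimIn, h.specSubspace_eq_span hK]
  have hli := e.orthonormal.linearIndependent
  have : (e '' {i | lam i ∈ K}) = ((hK.toFinset.image e : Finset H) : Set H) := by simp
  rw [this, finrank_span_finset_eq_card, Finset.card_image_of_injective _ hli.injective]
  have h2 := hli.linearIndepOn_id
  refine LinearIndepOn.mono h2 ?_
  intro x hx
  simp only [Finset.coe_image, Set.Finite.coe_toFinset] at hx
  obtain ⟨i, -, rfl⟩ := hx
  exact ⟨i, rfl⟩

end IsDiagonalIn

end Op

end NormalOperators

namespace Op

section FarFromSpectrum

variable {H : Type*} [NormedAddCommGroup H] [InnerProductSpace ℂ H]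
  {ι : Type*} {G S : Op H} {e : HilbertBasis ι ℂ H} {lam : ι → ℂ} {p b : ℝ}

/-- If `(T - z) A` is an invertible bounded operator `u` and `A` maps onto the domain of `T`, then
`A u⁻¹` is the resolvent of `T` at `z`. -/
lemma isResolventAt_of_factor {T : Op H} {z : ℂ} {A : H →L[ℂ] H} {u : (H →L[ℂ] H)ˣ}
    (h1 : ∀ y, A y ∈ T.dom) (h2 : ∀ y, T.app (A y) - z • A y = (u : H →L[ℂ] H) y)
    (h3 : ∀ x ∈ T.dom, ∃ y, A y = x) :
    T.IsResolventAt z (A * (↑u⁻¹ : H →L[ℂ] H)) := by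
  refine ⟨fun x => h1 _, fun x => ?_, fun x hx => ?_⟩
  · have := congrArg (fun B : H →L[ℂ] H => B x) u.mul_inv
    exact (h2 _).trans this
  · obtain ⟨y, rfl⟩ := h3 x hx
    have := congrArg (fun B : H →L[ℂ] H => B y) u.inv_mul
    rw [h2]
    exact congrArg A this

lemma addOp_app (G S : Op H) (x : H) : (G.addOp S).app x = G.app x + S.app x := rfl

lemma Subordinate.norm_app_diag_le (hS : S.Subordinate G p b) (h : G.IsDiagonalIn e lam)
    (hp0 : 0 ≤ p) (hp1 : p < 1) (hb : 0 ≤ b) {m : ι → ℂ} {M1 M2 : ℝ} (hM1 : 0 ≤ M1)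
    (hM2 : 0 ≤ M2) (h1 : ∀ i, ‖m i‖ ≤ M1) (h2 : ∀ i, ‖lam i * m i‖ ≤ M2) (x : H) :
    ‖S.app (e.diag m x)‖ ≤ b * M1 ^ (1 - p) * M2 ^ p * ‖x‖ := by
  have hx := norm_nonneg x
  calc ‖S.app (e.diag m x)‖
      ≤ b * ‖e.diag m x‖ ^ (1 - p) * ‖G.app (e.diag m x)‖ ^ p := hS.2 _ (h.1 m M1 M2 h1 h2 x)
    _ ≤ b * (M1 * ‖x‖) ^ (1 - p) * (M2 * ‖x‖) ^ p := by
        rw [h.app_diag h1 h2]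
        gcongr
        · exact e.norm_diag_apply_le hM1 h1 x
        · exact e.norm_diag_apply_le hM2 h2 x
    _ = b * M1 ^ (1 - p) * M2 ^ p * (‖x‖ ^ (1 - p) * ‖x‖ ^ p) := by
        rw [Real.mul_rpow hM1 hx, Real.mul_rpow hM2 hx]
        ring
    _ = b * M1 ^ (1 - p) * M2 ^ p * ‖x‖ := by
        rw [← Real.rpow_add_of_nonneg hx (by linarith) hp0, sub_add_cancel, Real.rpow_one]

/-- The bounded operator `S ∘ e.diag m`. -/
lemma Subordinate.exists_comp_diag (hS : S.Subordinate G p b) (h : G.IsDiagonalIn e lam)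
    (hp0 : 0 ≤ p) (hp1 : p < 1) (hb : 0 ≤ b) {m : ι → ℂ} {M1 M2 : ℝ} (hM1 : 0 ≤ M1)
    (hM2 : 0 ≤ M2) (h1 : ∀ i, ‖m i‖ ≤ M1) (h2 : ∀ i, ‖lam i * m i‖ ≤ M2) :
    ∃ B : H →L[ℂ] H, (∀ x, B x = S.app (e.diag m x)) ∧ ‖B‖ ≤ b * M1 ^ (1 - p) * M2 ^ p := by
  have hle := hS.norm_app_diag_le h hp0 hp1 hb hM1 hM2 h1 h2
  exact ⟨LinearMap.mkContinuous (S.app ∘ₗ (e.diag m).toLinearMap) _ hle, fun _ => rfl,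
    LinearMap.mkContinuous_norm_le _ (by positivity) _⟩

theorem exists_resolvent_of_far [CompleteSpace H] (hS : S.Subordinate G p b)
    (h : G.IsDiagonalIn e lam) (hp0 : 0 ≤ p) (hp1 : p < 1) (hb : 0 ≤ b) {d : ℝ} {z : ℂ}
    (hd : 0 < d) (hdz : d ≤ ‖z‖) (hbd : 4 * b * ‖z‖ ^ p ≤ d) (hfar : ∀ i, d ≤ ‖lam i - z‖) :
    ∃ R, (G.addOp S).IsResolventAt z R ∧ ‖R‖ ≤ 2 / d := by
  have hne : ∀ i, lam i - z ≠ 0 := fun i => norm_pos_iff.mp (hd.trans_le (hfar i))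
  set m : ι → ℂ := fun i => (lam i - z)⁻¹ with hm
  have h1 : ∀ i, ‖m i‖ ≤ d⁻¹ := fun i => by
    rw [hm, norm_inv]
    exact inv_anti₀ hd (hfar i)
  have h2 : ∀ i, ‖lam i * m i‖ ≤ 2 * ‖z‖ * d⁻¹ := fun i => by
    have : lam i * m i = 1 + z * m i := by
      have := hne i
      simp only [hm]
      field_simp
      ring
    rw [this]
    have h3 : 1 ≤ ‖z‖ * d⁻¹ := by
      rw [← div_eq_mul_inv, le_div_iff₀ hd]
      linarith
    calc ‖1 + z * m i‖ ≤ 1 + ‖z‖ * d⁻¹ := by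
          refine (norm_add_le _ _).trans ?_
          rw [norm_one, norm_mul]
          gcongr
          exact h1 i
      _ ≤ _ := by linarith
  obtain ⟨B, hB, hBn⟩ := hS.exists_comp_diag h hp0 hp1 hb (by positivity) (by positivity) h1 h2
  have hBn' : ‖B‖ ≤ 1 / 2 := by
    refine hBn.trans ?_
    rw [Real.mul_rpow (by positivity) (by positivity), Real.mul_rpow (by positivity) (by positivity)]
    have e1 : d⁻¹ ^ (1 - p) * d⁻¹ ^ p = d⁻¹ := by
      rw [← Real.rpow_add (by positivity), sub_add_cancel, Real.rpow_one]
    have e2 : (2 : ℝ) ^ p ≤ 2 := by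
      calc (2 : ℝ) ^ p ≤ 2 ^ (1 : ℝ) := Real.rpow_le_rpow_of_exponent_le (by norm_num) hp1.le
        _ = 2 := Real.rpow_one _
    calc b * d⁻¹ ^ (1 - p) * (2 ^ p * ‖z‖ ^ p * d⁻¹ ^ p)
        = b * 2 ^ p * ‖z‖ ^ p * (d⁻¹ ^ (1 - p) * d⁻¹ ^ p) := by ring
      _ ≤ b * 2 * ‖z‖ ^ p * d⁻¹ := by
          rw [e1]
          gcongr
      _ ≤ 1 / 2 := by
          rw [← div_eq_mul_inv, div_le_iff₀ hd]
          linarith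
  have hlt : ‖-B‖ < 1 := by
    rw [norm_neg]
    linarith
  set u := Units.oneSub (-B) hlt with hu
  set U : H →L[ℂ] H := ↑u⁻¹ with hU
  have huv : (u : H →L[ℂ] H) = 1 + B := by rw [hu, Units.val_oneSub, sub_neg_eq_add]
  have hU1 : ∀ x, U x + B (U x) = x := fun x => by
    have := congrArg (fun A : H →L[ℂ] H => A x) u.mul_inv
    rw [huv] at this
    simpa using this
  have hmi : ∀ i, (lam i - z) * m i = 1 := fun i => mul_inv_cancel₀ (hne i)
  have hR1 : ∀ x, e.diag m x ∈ G.dom := h.1 m _ _ h1 h2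
  have hR2 : ∀ x, G.app (e.diag m x) - z • e.diag m x = x := fun x => e.ext_inner fun i => by
    rw [inner_sub_right, h.2 _ (hR1 x), inner_smul_right, ← sub_mul, e.inner_diag h1, ← mul_assoc,
      hmi, one_mul]
  have hR3 : ∀ x ∈ G.dom, e.diag m (G.app x - z • x) = x := fun x hx => e.ext_inner fun i => by
    rw [e.inner_diag h1, inner_sub_right, h.2 _ hx, inner_smul_right, ← sub_mul, ← mul_assoc,
      mul_comm (m i), hmi, one_mul]
  refine ⟨e.diag m * U, isResolventAt_of_factor hR1 (fun y => ?_) fun x hx => ⟨_, hR3 x hx⟩, ?_⟩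
  · rw [addOp_app, add_sub_right_comm, hR2, ← hB, huv]
    rfl
  · have hUn : ‖U‖ ≤ 2 := by
      refine ContinuousLinearMap.opNorm_le_bound _ zero_le_two fun x => ?_
      have h3 : ‖U x‖ ≤ ‖x‖ + ‖B (U x)‖ := by
        conv_lhs => rw [← add_sub_cancel_right (U x) (B (U x)), hU1]
        exact norm_sub_le _ _
      have h4 := B.le_of_opNorm_le hBn' (U x)
      linarith
    calc ‖e.diag m * U‖ ≤ ‖e.diag m‖ * ‖U‖ := norm_mul_le _ _
      _ ≤ d⁻¹ * 2 := by
          gcongr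
          exact e.norm_diag_le (by positivity) h1
      _ = 2 / d := by ring

end FarFromSpectrum

end Op

namespace Op

section Resolvent

variable {H : Type*} [NormedAddCommGroup H] [InnerProductSpace ℂ H] {T : Op H} {z w : ℂ}
  {R R' : H →L[ℂ] H}

lemma IsResolventAt.sub_eq (hR : T.IsResolventAt z R) (hR' : T.IsResolventAt w R') :
    R - R' = (z - w) • (R' * R) := by
  refine ContinuousLinearMap.ext fun x => ?_
  have h1 := hR'.2.2 _ (hR.1 x)
  have h2 : T.app (R x) - w • R x = x + (z - w) • R x := by
    rw [sub_smul, ← add_sub_assoc, ← eq_sub_iff_add_eq.mp (hR.2.1 x).symm]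
  rw [h2, map_add, map_smul] at h1
  change R x - R' x = (z - w) • R' (R x)
  rw [sub_eq_iff_eq_add', h1]

lemma IsResolventAt.unique (hR : T.IsResolventAt z R) (hR' : T.IsResolventAt z R') : R = R' := by
  have := hR.sub_eq hR'
  rwa [sub_self, zero_smul, sub_eq_zero] at this

lemma IsResolventAt.injective (hR : T.IsResolventAt z R) : Function.Injective R := by
  intro x y hxy
  rw [← hR.2.1 x, ← hR.2.1 y, hxy]

open Classical in
/-- The resolvent of `T` at `z`, zero outside of the resolvent set. -/
def res (T : Op H) (z : ℂ) : H →L[ℂ] H :=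
  if h : z ∈ T.resolventSet then h.choose else 0

lemma isResolventAt_res (h : z ∈ T.resolventSet) : T.IsResolventAt z (T.res z) := by
  rw [res, dif_pos h]
  exact h.choose_spec

lemma IsResolventAt.res_eq (hR : T.IsResolventAt z R) : T.res z = R :=
  (isResolventAt_res ⟨R, hR⟩).unique hR

lemma eventually_isResolventAt [CompleteSpace H] (hR : T.IsResolventAt z R) :
    ∀ᶠ w in nhds z, T.IsResolventAt w (R * Ring.inverse (1 - (w - z) • R)) := by
  have hc : Continuous fun w : ℂ => 1 - (w - z) • R := by fun_prop
  have h1 : ∀ᶠ w in nhds z, IsUnit (1 - (w - z) • R) :=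
    hc.continuousAt.eventually (by
      simp only [sub_self, zero_smul, sub_zero]
      exact Units.nhds 1)
  filter_upwards [h1] with w ⟨u, hu⟩
  rw [← hu, Ring.inverse_unit]
  refine isResolventAt_of_factor hR.1 (fun y => ?_) fun x hx => ⟨_, hR.2.2 x hx⟩
  rw [hu, ← sub_eq_zero]
  have := hR.2.1 y
  change T.app (R y) - w • R y - (y - (w - z) • R y) = 0
  conv_lhs => enter [2, 1]; rw [← this]
  module

lemma isOpen_resolventSet [CompleteSpace H] (T : Op H) : IsOpen T.resolventSet := by
  rw [isOpen_iff_mem_nhds]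
  rintro z ⟨R, hR⟩
  filter_upwards [eventually_isResolventAt hR] with w hw using ⟨_, hw⟩

lemma differentiableAt_res [CompleteSpace H] (h : z ∈ T.resolventSet) :
    DifferentiableAt ℂ T.res z := by
  obtain ⟨R, hR⟩ := h
  have h1 : T.res =ᶠ[nhds z] fun w => R * Ring.inverse (1 - (w - z) • R) := by
    filter_upwards [eventually_isResolventAt hR] with w hw using hw.res_eq
  refine DifferentiableAt.congr_of_eventuallyEq ?_ h1
  refine (differentiableAt_const R).mul ?_
  have h2 : DifferentiableAt ℂ (Ring.inverse : (H →L[ℂ] H) → H →L[ℂ] H) (1 - (z - z) • R) := by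
    have := differentiableAt_inverse (𝕜 := ℂ) (1 : (H →L[ℂ] H)ˣ).isUnit
    simpa using this
  exact h2.comp z (f := fun w : ℂ => 1 - (w - z) • R) (by fun_prop)

end Resolvent

section FiniteRank

variable {H : Type*} [NormedAddCommGroup H] [InnerProductSpace ℂ H] {W : Type*} [Fintype W]
  [DecidableEq W]

/-- The matrix governing the invertibility of `1 - ∑ l, φ l (·) • f l`. -/
def frMatrix (φ : W → H →L[ℂ] ℂ) (f : W → H) : Matrix W W ℂ :=
  1 - Matrix.of fun k l => φ k (f l)

lemma exists_units_one_sub_finiteRank (φ : W → H →L[ℂ] ℂ) (f : W → H)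
    (hdet : (frMatrix φ f).det ≠ 0) {K : H →L[ℂ] H} (hK : ∀ x, K x = ∑ l, φ l x • f l) :
    ∃ u : (H →L[ℂ] H)ˣ, (u : H →L[ℂ] H) = 1 - K ∧
      ‖(↑u⁻¹ : H →L[ℂ] H)‖ ≤ 1 + ∑ l, ∑ k, ‖(frMatrix φ f)⁻¹ l k‖ * ‖φ k‖ * ‖f l‖ := by
  set F := frMatrix φ f with hF
  have hunit : IsUnit F.det := isUnit_iff_ne_zero.mpr hdet
  set c : W → H →L[ℂ] ℂ := fun l => ∑ k, F⁻¹ l k • φ k with hc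
  set Y : H →L[ℂ] H := 1 + ∑ l, (c l).smulRight (f l) with hY
  have hYx : ∀ x, Y x = x + ∑ l, c l x • f l := fun x => by simp [hY]
  have hcx : ∀ x l, c l x = (F⁻¹.mulVec fun k => φ k x) l := fun x l => by
    simp [hc, Matrix.mulVec, dotProduct]
  have hFx : ∀ (v : W → ℂ) k, F.mulVec v k = v k - ∑ l, φ k (f l) * v l := fun v k => by
    rw [hF, frMatrix, Matrix.sub_mulVec, Matrix.one_mulVec]
    simp [Matrix.mulVec, dotProduct]
  have hl : Y * (1 - K) = 1 := by
    refine ContinuousLinearMap.ext fun x => ?_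
    change Y (x - K x) = x
    have h1 : (fun k => φ k (x - K x)) = F.mulVec fun k => φ k x := by
      funext k
      rw [hFx, map_sub, hK, map_sum]
      congr 1
      refine Finset.sum_congr rfl fun l _ => ?_
      rw [map_smul, smul_eq_mul, mul_comm]
    have h2 : ∀ l, c l (x - K x) = φ l x := fun l => by
      rw [hcx, h1, Matrix.mulVec_mulVec, Matrix.nonsing_inv_mul _ hunit, Matrix.one_mulVec]
    rw [hYx, Finset.sum_congr rfl fun l _ => by rw [h2], ← hK, sub_add_cancel]
  have hr : (1 - K) * Y = 1 := by
    refine ContinuousLinearMap.ext fun x => ?_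
    change Y x - K (Y x) = x
    have h2 : ∀ l, φ l (Y x) = c l x := fun l => by
      have h3 : F.mulVec (fun l => c l x) l = φ l x := by
        have : (fun l => c l x) = F⁻¹.mulVec fun k => φ k x := funext fun l => hcx x l
        rw [this, Matrix.mulVec_mulVec, Matrix.mul_nonsing_inv _ hunit, Matrix.one_mulVec]
      rw [hFx] at h3
      rw [hYx, map_add, map_sum, ← h3]
      simp only [map_smul, smul_eq_mul]
      rw [← sub_eq_zero]
      have : ∑ x_1, c x_1 x * φ l (f x_1) = ∑ x_1, φ l (f x_1) * c x_1 x :=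
        Finset.sum_congr rfl fun _ _ => mul_comm _ _
      rw [this]
      ring
    rw [hK, Finset.sum_congr rfl fun l _ => by rw [h2], hYx, add_sub_cancel_right]
  refine ⟨⟨1 - K, Y, hr, hl⟩, rfl, ?_⟩
  change ‖Y‖ ≤ _
  refine (norm_add_le _ _).trans (add_le_add ContinuousLinearMap.norm_id_le
    ((norm_sum_le _ _).trans (Finset.sum_le_sum fun l _ => ?_)))
  rw [ContinuousLinearMap.norm_smulRight_apply, ← Finset.sum_mul]
  gcongr
  refine (norm_sum_le _ _).trans (Finset.sum_le_sum fun k _ => ?_)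
  rw [norm_smul]

lemma norm_det_le {A : Matrix W W ℂ} {x : ℝ} (hA : ∀ i j, ‖A i j‖ ≤ x) :
    ‖A.det‖ ≤ (Fintype.card W).factorial * x ^ Fintype.card W := by
  have := Matrix.det_le (R := ℂ) (A := A) (abv := IsAbsoluteValue.toAbsoluteValue norm) (x := x) hA
  simpa using this

lemma norm_inv_apply_le {A : Matrix W W ℂ} {x : ℝ} (hx : 1 ≤ x) (hA : ∀ i j, ‖A i j‖ ≤ x)
    (i j : W) :
    ‖A⁻¹ i j‖ ≤ (Fintype.card W).factorial * x ^ Fintype.card W / ‖A.det‖ := by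
  rw [Matrix.inv_def, Matrix.smul_apply, Matrix.adjugate_apply, Ring.inverse_eq_inv', norm_smul,
    norm_inv, inv_mul_eq_div]
  gcongr
  refine norm_det_le fun k l => ?_
  rw [Matrix.updateRow_apply]
  split_ifs
  · rw [Pi.single_apply]
    split_ifs
    · simpa using hx
    · simp; linarith
  · exact hA k l

end FiniteRank

end Op

namespace Op

section Perturbation

variable {H : Type*} [NormedAddCommGroup H] [InnerProductSpace ℂ H]

/-- The operator `G + K` with bounded `K`. -/
def addCLM (G : Op H) (K : H →L[ℂ] H) : Op H := ⟨G.dom, G.app + K.toLinearMap⟩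

lemma addCLM_app (G : Op H) (K : H →L[ℂ] H) (x : H) : (G.addCLM K).app x = G.app x + K x := rfl

variable {ι : Type*} {G S : Op H} {e : HilbertBasis ι ℂ H} {lam κ : ι → ℂ} {p b C : ℝ}

lemma IsDiagonalIn.addCLM (h : G.IsDiagonalIn e lam) (hκ : ∀ i, ‖κ i‖ ≤ C) :
    (G.addCLM (e.diag κ)).IsDiagonalIn e (fun i => lam i + κ i) := by
  refine ⟨fun m M M' hM hM' x => h.1 m M (M' + C * M) hM (fun i => ?_) x, fun x hx i => ?_⟩
  · have hC : 0 ≤ C := (norm_nonneg _).trans (hκ i)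
    have : lam i * m i = (lam i + κ i) * m i - κ i * m i := by ring
    rw [this]
    refine (norm_sub_le _ _).trans (add_le_add (hM' i) ?_)
    rw [norm_mul]
    exact mul_le_mul (hκ i) (hM i) (norm_nonneg _) hC
  · rw [addCLM_app, inner_add_right, h.2 x hx, e.inner_diag hκ, add_mul]

lemma Subordinate.addCLM (hS : S.Subordinate G p b) (h : G.IsDiagonalIn e lam) (hp0 : 0 ≤ p)
    (hb : 0 ≤ b) (hκ : ∀ i, ‖κ i‖ ≤ C) (hle : ∀ i, ‖lam i‖ ≤ ‖lam i + κ i‖) :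
    S.Subordinate (G.addCLM (e.diag κ)) p b := by
  refine ⟨hS.1, fun u hu => (hS.2 u hu).trans ?_⟩
  have : ‖G.app u‖ ≤ ‖(G.addCLM (e.diag κ)).app u‖ := by
    refine abs_le_of_sq_le_sq' ?_ (norm_nonneg _) |>.2
    refine hasSum_le (fun i => ?_) (e.hasSum_norm_inner_sq _) (e.hasSum_norm_inner_sq _)
    rw [h.2 u hu, (h.addCLM hκ).2 u hu, norm_mul, norm_mul]
    gcongr
    exact hle i
  gcongr

/-- If `T' = T + K` has a resolvent at `z`, where `K x = ∑ l, ⟪e l, x⟫ • f l`, then so has `T`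
as soon as the corresponding determinant does not vanish. -/
lemma exists_resolvent_of_det_ne_zero {T T' : Op H} {K R' : H →L[ℂ] H} {z : ℂ} {W : Type*}
    [Fintype W] [DecidableEq W] {v f : W → H} {x : ℝ} (hdom : T.dom = T'.dom)
    (happ : ∀ x ∈ T.dom, T'.app x = T.app x + K x) (hK : ∀ x, K x = ∑ l, ⟪v l, x⟫_ℂ • f l)
    (hv : ∀ l, ‖v l‖ ≤ 1) (hx : 1 ≤ x) (hf : ∀ l, ‖R'‖ * ‖f l‖ ≤ x) (hR' : T'.IsResolventAt z R')
    (hdet : (frMatrix (fun l => (innerSL ℂ (v l)).comp R') f).det ≠ 0) :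
    ∃ R, T.IsResolventAt z R ∧
      ‖R‖ ≤ ‖R'‖ * (1 + (Fintype.card W) ^ 2 * ((Fintype.card W).factorial *
        (1 + x) ^ Fintype.card W / ‖(frMatrix (fun l => (innerSL ℂ (v l)).comp R') f).det‖) * x) := by
  set φ : W → H →L[ℂ] ℂ := fun l => (innerSL ℂ (v l)).comp R' with hφ
  have hφn : ∀ l, ‖φ l‖ ≤ ‖R'‖ := fun l => by
    refine (ContinuousLinearMap.opNorm_comp_le _ _).trans ?_
    rw [innerSL_apply_norm]
    exact mul_le_of_le_one_left (norm_nonneg _) (hv l)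
  have hφf : ∀ k l, ‖φ k (f l)‖ ≤ x := fun k l =>
    ((φ k).le_of_opNorm_le (hφn k) _).trans (hf l)
  have hentry : ∀ k l, ‖frMatrix φ f k l‖ ≤ 1 + x := fun k l => by
    rw [frMatrix, Matrix.sub_apply, Matrix.of_apply]
    refine (norm_sub_le _ _).trans (add_le_add ?_ (hφf k l))
    rw [Matrix.one_apply]
    split_ifs <;> simp
  obtain ⟨u, hu, hun⟩ := exists_units_one_sub_finiteRank φ f hdet (K := K * R') fun y => hK (R' y)
  refine ⟨_, isResolventAt_of_factor (A := R') (u := u) (fun y => hdom ▸ hR'.1 y) (fun y => ?_)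
    fun y hy => ⟨_, hR'.2.2 y (hdom ▸ hy)⟩, ?_⟩
  · have h1 := hR'.2.1 y
    rw [happ _ (hdom ▸ hR'.1 y), add_sub_right_comm, ← eq_sub_iff_add_eq] at h1
    rw [h1, hu]
    rfl
  · refine (norm_mul_le _ _).trans ?_
    gcongr
    refine hun.trans ?_
    gcongr
    set B := (Fintype.card W).factorial * (1 + x) ^ Fintype.card W / ‖(frMatrix φ f).det‖ with hB
    calc ∑ l, ∑ k, ‖(frMatrix φ f)⁻¹ l k‖ * ‖φ k‖ * ‖f l‖
        ≤ ∑ l : W, ∑ k : W, B * x := by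
          refine Finset.sum_le_sum fun l _ => Finset.sum_le_sum fun k _ => ?_
          have h2 := norm_inv_apply_le (by linarith) hentry l k
          have h3 : ‖φ k‖ * ‖f l‖ ≤ x := le_trans (by gcongr; exact hφn k) (hf l)
          rw [mul_assoc]
          exact mul_le_mul h2 h3 (by positivity) (by positivity)
      _ = (Fintype.card W) ^ 2 * B * x := by
          simp only [Finset.sum_const, Finset.card_univ, nsmul_eq_mul]
          ring

/-- The lower bound for the determinant at a point of the resolvent set of both operators. -/
lemma one_le_norm_det_mul {T T' : Op H} {K R R' : H →L[ℂ] H} {z : ℂ} {W : Type*}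
    [Fintype W] [DecidableEq W] {v f : W → H} {y : ℝ} (hdom : T.dom = T'.dom)
    (happ : ∀ x ∈ T.dom, T'.app x = T.app x + K x) (hK : ∀ x, K x = ∑ l, ⟪v l, x⟫_ℂ • f l)
    (hv : ∀ l, ‖v l‖ ≤ 1) (hf : ∀ l, ‖R‖ * ‖f l‖ ≤ y) (hR : T.IsResolventAt z R)
    (hR' : T'.IsResolventAt z R') :
    1 ≤ ‖(frMatrix (fun l => (innerSL ℂ (v l)).comp R') f).det‖ *
      ((Fintype.card W).factorial * (1 + y) ^ Fintype.card W) := by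
  set N : Matrix W W ℂ := 1 + Matrix.of fun k l => ⟪v k, R (f l)⟫_ℂ with hN
  have hres : ∀ a, R a = R' a + R' (K (R a)) := fun a => by
    have h1 := hR'.2.2 _ (hdom ▸ hR.1 a)
    rw [happ _ (hR.1 a), add_sub_right_comm, hR.2.1, map_add] at h1
    exact h1.symm
  have hmul : frMatrix (fun l => (innerSL ℂ (v l)).comp R') f * N = 1 := by
    ext k j
    have h2 : ⟪v k, R (f j)⟫_ℂ = ⟪v k, R' (f j)⟫_ℂ
        + ∑ l, ⟪v k, R' (f l)⟫_ℂ * ⟪v l, R (f j)⟫_ℂ := by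
      conv_lhs => rw [hres, hK, inner_add_right, map_sum, inner_sum]
      simp only [map_smul, inner_smul_right, mul_comm]
    have h3 : (Matrix.of (fun k l => ⟪v k, R' (f l)⟫_ℂ)
        * Matrix.of (fun k l => ⟪v k, R (f l)⟫_ℂ)) k j
        = ∑ l, ⟪v k, R' (f l)⟫_ℂ * ⟪v l, R (f j)⟫_ℂ := rfl
    have h4 : frMatrix (fun l => (innerSL ℂ (v l)).comp R') f
        = 1 - Matrix.of (fun k l => ⟪v k, R' (f l)⟫_ℂ) := rfl
    rw [h4, hN, sub_mul, one_mul, mul_add, mul_one]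
    simp only [Matrix.sub_apply, Matrix.add_apply, h3, Matrix.of_apply, h2]
    ring
  have hdet := congrArg (fun A : Matrix W W ℂ => ‖A.det‖) hmul
  simp only [Matrix.det_mul, norm_mul, Matrix.det_one, norm_one] at hdet
  refine hdet.symm.le.trans ?_
  gcongr
  refine norm_det_le fun k l => ?_
  rw [hN, Matrix.add_apply, Matrix.of_apply]
  refine (norm_add_le _ _).trans (add_le_add ?_ ?_)
  · rw [Matrix.one_apply]
    split_ifs <;> simp
  · refine (norm_inner_le_norm _ _).trans ((mul_le_of_le_one_left (norm_nonneg _) (hv k)).trans ?_)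
    exact (R.le_opNorm _).trans (hf l)

end Perturbation

end Op

section ZeroFreeSegments

lemma exists_re_forall_ne_zero {g : ℂ → ℂ} {h R : ℝ} (hh : 0 < h) (hR : 3 * h < R)
    (hg : DifferentiableOn ℂ g (ball 0 R)) (h0 : g 0 ≠ 0) :
    ∃ s ∈ Set.Icc 0 h, ∀ t ∈ Set.Icc (-2 * h) 0, g (s + t * I) ≠ 0 := by
  by_contra! hcon
  choose! t ht hgt using hcon
  have hmem : ∀ s ∈ Set.Icc 0 h, (s + t s * I : ℂ) ∈ closedBall (0 : ℂ) (3 * h) := by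
    intro s hs
    rw [mem_closedBall_zero_iff]
    refine (norm_add_le _ _).trans ?_
    rw [norm_mul, norm_I, mul_one, norm_real, norm_real, Real.norm_eq_abs, Real.norm_eq_abs,
      abs_of_nonneg hs.1, abs_of_nonpos (ht s hs).2]
    linarith [hs.2, (ht s hs).1]
  have hinf : ((fun s : ℝ => (s + t s * I : ℂ)) '' Set.Icc 0 h).Infinite := by
    refine (Set.Icc_infinite hh).image fun s _ s' _ hss => ?_
    simpa using congrArg re hss
  obtain ⟨z, hz, hacc⟩ := hinf.exists_accPt_of_subset_isCompact (isCompact_closedBall 0 (3 * h))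
    (by rintro _ ⟨s, hs, rfl⟩; exact hmem s hs)
  have hzR : z ∈ ball (0 : ℂ) R := closedBall_subset_ball hR hz
  have hfreq : ∃ᶠ w in nhdsWithin z {z}ᶜ, g w = 0 := by
    rw [accPt_iff_frequently_nhdsNE] at hacc
    refine hacc.mono ?_
    rintro _ ⟨s, hs, rfl⟩
    exact hgt s hs
  have := (hg.analyticOnNhd isOpen_ball).eqOn_zero_of_preconnected_of_frequently_eq_zero
    (convex_ball 0 R).isPreconnected hzR hfreq
  exact h0 (this (mem_ball_self (by linarith)))

lemma exists_lower_bound_on_segment {h R B : ℝ} (hh : 0 < h) (hR : 3 * h < R) (hB : 0 < B) :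
    ∃ δ > 0, ∀ f : ℂ → ℂ, DifferentiableOn ℂ f (ball 0 R) → (∀ z ∈ ball 0 R, ‖f z‖ ≤ B) →
      B⁻¹ ≤ ‖f 0‖ → ∃ s ∈ Set.Icc 0 h, ∀ t ∈ Set.Icc (-2 * h) 0, δ ≤ ‖f (s + t * I)‖ := by
  obtain ⟨R1, hR1, hR1R⟩ := exists_between hR
  obtain ⟨R2, hR2, hR21⟩ := exists_between hR1
  have hR10 : 0 < R1 := by linarith
  have hR20 : 0 < R2 := by linarith
  set K : Set (ℕ → ℂ) := {a | a ∈ Set.univ.pi (fun n => closedBall (0 : ℂ) (B / R1 ^ n)) ∧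
    B⁻¹ ≤ ‖a 0‖} with hK
  have hKc : IsCompact K := by
    refine (isCompact_univ_pi fun n => isCompact_closedBall 0 (B / R1 ^ n)).inter_right
      (t := {a : ℕ → ℂ | B⁻¹ ≤ ‖a 0‖}) ?_
    exact isClosed_le continuous_const (by fun_prop)
  have hterm : ∀ a ∈ K, ∀ z ∈ closedBall (0 : ℂ) R2, ∀ n, ‖a n * z ^ n‖ ≤ B * (R2 / R1) ^ n := by
    intro a ha z hz n
    rw [mem_closedBall_zero_iff] at hz
    have := ha.1 n trivial
    rw [mem_closedBall_zero_iff] at this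
    rw [norm_mul, norm_pow, div_pow]
    calc ‖a n‖ * ‖z‖ ^ n ≤ B / R1 ^ n * R2 ^ n := by gcongr
      _ = _ := by ring
  have hsum : Summable fun n : ℕ => B * (R2 / R1) ^ n :=
    (summable_geometric_of_lt_one (by positivity) ((div_lt_one hR10).mpr hR21)).mul_left B
  set Φ : (ℕ → ℂ) → ℂ → ℂ := fun a z => ∑' n, a n * z ^ n with hΦ
  have hseg : ∀ s ∈ Set.Icc 0 h, ∀ t ∈ Set.Icc (-2 * h) 0,
      (s + t * I : ℂ) ∈ closedBall (0 : ℂ) R2 := by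
    intro s hs t ht
    rw [mem_closedBall_zero_iff]
    refine (norm_add_le _ _).trans ?_
    rw [norm_mul, norm_I, mul_one, norm_real, norm_real, Real.norm_eq_abs, Real.norm_eq_abs,
      abs_of_nonneg hs.1, abs_of_nonpos ht.2]
    linarith [hs.2, ht.1]
  have key : ∃ δ > 0, ∀ a ∈ (Set.univ : Set K), ∃ s ∈ Set.Icc 0 h, ∀ t ∈ Set.Icc (-2 * h) 0,
      δ ≤ ‖Φ a (s + t * I)‖ := by
    have hcomp : IsCompact (Set.univ : Set K) := isCompact_iff_isCompact_univ.mp hKc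
    refine hcomp.induction_on (p := fun A : Set K => ∃ δ > 0, ∀ a ∈ A, ∃ s ∈ Set.Icc 0 h,
      ∀ t ∈ Set.Icc (-2 * h) 0, δ ≤ ‖Φ a (s + t * I)‖) ⟨1, one_pos, fun a ha => ha.elim⟩ ?_ ?_ ?_
    · rintro A A' hAA ⟨δ, hδ, h1⟩
      exact ⟨δ, hδ, fun a ha => h1 a (hAA ha)⟩
    · rintro A A' ⟨δ, hδ, h1⟩ ⟨δ', hδ', h1'⟩
      refine ⟨min δ δ', lt_min hδ hδ', ?_⟩
      rintro a (ha | ha)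
      · obtain ⟨s, hs, h2⟩ := h1 a ha
        exact ⟨s, hs, fun t ht => (min_le_left _ _).trans (h2 t ht)⟩
      · obtain ⟨s, hs, h2⟩ := h1' a ha
        exact ⟨s, hs, fun t ht => (min_le_right _ _).trans (h2 t ht)⟩
    · rintro a -
      have hdiff : DifferentiableOn ℂ (Φ a) (ball 0 R2) :=
        differentiableOn_tsum_of_summable_norm hsum (fun n => by fun_prop) isOpen_ball
          fun n z hz => hterm a a.2 z (ball_subset_closedBall hz) n
      have ha0 : Φ a 0 = (a : ℕ → ℂ) 0 := by
        rw [hΦ]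
        refine (tsum_eq_single 0 fun n hn => by simp [hn]).trans (by simp)
      obtain ⟨s, hs, hne⟩ := exists_re_forall_ne_zero hh hR2 hdiff (by
        rw [ha0, ← norm_pos_iff]
        exact (inv_pos.mpr hB).trans_le a.2.2)
      have hcont : Continuous fun q : K × Set.Icc (-2 * h) 0 => ‖Φ q.1 (s + (q.2 : ℝ) * I)‖ := by
        refine Continuous.norm (continuous_tsum (fun n => ?_) hsum fun n q =>
          hterm q.1 q.1.2 _ (hseg s hs q.2 q.2.2) n)
        exact ((continuous_apply n).comp (continuous_subtype_val.comp continuous_fst)).mul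
          (by fun_prop)
      have hne' : (Set.Icc (-2 * h) 0).Nonempty := ⟨0, by constructor <;> linarith⟩
      obtain ⟨t0, -, ht0⟩ := isCompact_univ.exists_isMinOn (s := (Set.univ : Set (Set.Icc (-2 * h) 0)))
        (f := fun t => ‖Φ a (s + (t : ℝ) * I)‖) ⟨⟨_, hne'.some_mem⟩, trivial⟩
        (hcont.comp (by fun_prop : Continuous fun t : Set.Icc (-2 * h) 0 => (a, t))).continuousOn
      set δ := ‖Φ a (s + (t0 : ℝ) * I)‖ with hδ
      have hδ0 : 0 < δ := norm_pos_iff.mpr (hne _ t0.2)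
      have hev := (isCompact_univ (X := Set.Icc (-2 * h) 0)).eventually_forall_of_forall_eventually
        (x₀ := a) (P := fun a t => δ / 2 < ‖Φ a (s + (t : ℝ) * I)‖) fun t _ =>
          hcont.continuousAt.eventually (lt_mem_nhds (by
            have := isMinOn_univ_iff.mp ht0 t
            exact (half_lt_self hδ0).trans_le this))
      refine ⟨_, mem_nhdsWithin_of_mem_nhds hev, δ / 2, half_pos hδ0, fun a' ha' => ⟨s, hs, ?_⟩⟩
      exact fun t ht => (ha' ⟨t, ht⟩ trivial).le
  obtain ⟨δ, hδ, h1⟩ := key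
  refine ⟨δ, hδ, fun f hf hfB hf0 => ?_⟩
  set a : ℕ → ℂ := fun n => (n.factorial : ℂ)⁻¹ * iteratedDeriv n f 0 with ha
  have hfact : ∀ n : ℕ, (n.factorial : ℝ) ≠ 0 := fun n => by positivity
  have haK : a ∈ K := by
    constructor
    · intro n _
      rw [mem_closedBall_zero_iff, ha, norm_mul, norm_inv, Complex.norm_natCast]
      have := norm_iteratedDeriv_le_of_forall_mem_sphere_norm_le n hR10
        ((hf.mono (closedBall_subset_ball hR1R)).diffContOnCl_ball subset_rfl)
        fun z hz => hfB z (closedBall_subset_ball hR1R (sphere_subset_closedBall hz))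
      calc (n.factorial : ℝ)⁻¹ * ‖iteratedDeriv n f 0‖
          ≤ (n.factorial : ℝ)⁻¹ * (n.factorial * B / R1 ^ n) := by gcongr
        _ = B / R1 ^ n := by
          have := hfact n
          field_simp
    · simpa [ha] using hf0
  obtain ⟨s, hs, h2⟩ := h1 ⟨a, haK⟩ trivial
  refine ⟨s, hs, fun t ht => ?_⟩
  have hz : (s + t * I : ℂ) ∈ ball (0 : ℂ) R :=
    closedBall_subset_ball (hR21.trans hR1R) (hseg s hs t ht)
  have h3 : Φ a (s + t * I) = f (s + t * I) := by
    rw [← taylorSeries_eq_on_ball' hz hf]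
    simp [hΦ, ha]
  rw [← h3]
  exact h2 t ht

lemma exists_lower_bound_on_segment_of_fintype (J : Type*) [Fintype J] {h R B : ℝ} (hh : 0 < h)
    (hR : 3 * h < R) (hB : 1 ≤ B) :
    ∃ δ > 0, ∀ f : J → ℂ → ℂ, (∀ j, DifferentiableOn ℂ (f j) (ball 0 R)) →
      (∀ j, ∀ z ∈ ball 0 R, ‖f j z‖ ≤ B) → (∀ j, B⁻¹ ≤ ‖f j 0‖) →
      ∃ s ∈ Set.Icc 0 h, ∀ t ∈ Set.Icc (-2 * h) 0, ∀ j, δ ≤ ‖f j (s + t * I)‖ := by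
  classical
  have hB0 : 0 < B := by linarith
  set N := Fintype.card J with hN
  obtain ⟨δ, hδ, h1⟩ := exists_lower_bound_on_segment hh hR (B := B ^ N) (by positivity)
  refine ⟨δ / B ^ N, by positivity, fun f hf hfB hf0 => ?_⟩
  obtain ⟨s, hs, h2⟩ := h1 (fun z => ∏ j, f j z) (DifferentiableOn.fun_finsetProd fun j _ => hf j)
    (fun z hz => by
      rw [norm_prod]
      refine (Finset.prod_le_prod (fun _ _ => norm_nonneg _) fun j _ => hfB j z hz).trans ?_
      simp [hN]) (by
      rw [norm_prod, ← inv_pow]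
      refine le_trans ?_ (Finset.prod_le_prod (fun _ _ => by positivity) fun j _ => hf0 j)
      simp [hN])
  refine ⟨s, hs, fun t ht j => ?_⟩
  have hz : (s + t * I : ℂ) ∈ ball (0 : ℂ) R := by
    rw [mem_ball_zero_iff]
    refine (norm_add_le _ _).trans_lt ?_
    rw [norm_mul, norm_I, mul_one, norm_real, norm_real, Real.norm_eq_abs, Real.norm_eq_abs,
      abs_of_nonneg hs.1, abs_of_nonpos ht.2]
    linarith [hs.2, ht.1]
  have h3 := h2 t ht
  rw [norm_prod, ← Finset.mul_prod_erase _ _ (Finset.mem_univ j)] at h3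
  rw [div_le_iff₀ (by positivity)]
  refine h3.trans ?_
  gcongr
  calc ∏ i ∈ Finset.univ.erase j, ‖f i (s + t * I)‖
      ≤ ∏ i ∈ Finset.univ.erase j, B :=
        Finset.prod_le_prod (fun _ _ => norm_nonneg _) fun i _ => hfB i _ hz
    _ = B ^ (Finset.univ.erase j).card := by simp
    _ ≤ B ^ N := pow_le_pow_right₀ hB (Finset.card_le_univ _)

end ZeroFreeSegments

section Pigeonhole

/-- If the counting function of `a` is at most `c r ^ (1 - p)` for arbitrarily large `r`, then there
are arbitrarily large `ρ` such that a window of width `M ρ ^ p` around `ρ` contains a bounded number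
of the `a i`. -/
lemma exists_sparse_window {ι : Type*} {a : ι → ℝ} (hfin : ∀ r, {i | a i ≤ r}.Finite) {p c : ℝ}
    (hp0 : 0 ≤ p) (hp1 : p < 1)
    (hc : ∃ᶠ r : ℝ in atTop, ((hfin r).toFinset.card : ℝ) ≤ c * r ^ (1 - p)) {M : ℝ} (hM : 0 < M) :
    ∃ N : ℕ, ∀ R0 : ℝ, ∃ ρ > R0, ∃ W : Finset ι, W.card ≤ N ∧
      ∀ i, i ∈ W ↔ |a i - ρ| ≤ M * ρ ^ p := by
  classical
  obtain ⟨N, hN⟩ := exists_nat_ge (16 * M * c)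
  refine ⟨N, fun R0 => ?_⟩
  have h1p : 0 < 1 - p := by linarith
  obtain ⟨r, hcr, hr1, hrR, hrM⟩ := (hc.and_eventually ((eventually_ge_atTop (1 : ℝ)).and
    ((eventually_gt_atTop (2 * R0)).and
      ((tendsto_rpow_atTop h1p).eventually_ge_atTop (16 * M))))).exists
  have hr0 : 0 < r := by linarith
  set q := M * r ^ p with hq
  have hq0 : 0 < q := by positivity
  set K := ⌊r ^ (1 - p) / (8 * M)⌋₊ with hK
  have hrr : r ^ p * r ^ (1 - p) = r := by
    rw [← Real.rpow_add hr0, add_sub_cancel, Real.rpow_one]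
  have hKle : (K : ℝ) * (8 * q) ≤ r := by
    have h1 : (K : ℝ) ≤ r ^ (1 - p) / (8 * M) := Nat.floor_le (by positivity)
    rw [le_div_iff₀ (by positivity)] at h1
    calc (K : ℝ) * (8 * q) = r ^ p * (K * (8 * M)) := by rw [hq]; ring
      _ ≤ r ^ p * r ^ (1 - p) := by gcongr
      _ = r := hrr
  have hKge : r ^ (1 - p) ≤ 16 * M * K := by
    have h1 : r ^ (1 - p) / (8 * M) < K + 1 := Nat.lt_floor_add_one _
    rw [div_lt_iff₀ (by positivity)] at h1
    have h2 : (1 : ℝ) ≤ K := by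
      have : 1 ≤ K := Nat.le_floor (by
        rw [Nat.cast_one, le_div_iff₀ (by positivity)]
        linarith)
      exact_mod_cast this
    nlinarith
  have hK1 : (0 : ℝ) < K := by
    have : 0 < 16 * M * (K : ℝ) := lt_of_lt_of_le (by positivity) hKge
    by_contra! hneg
    nlinarith
  set ρ : ℕ → ℝ := fun k => r / 2 + 4 * q * k + 2 * q with hρ
  have hρge : ∀ k, r / 2 ≤ ρ k := fun k => by
    have : 0 ≤ 4 * q * (k : ℝ) := by positivity
    simp only [hρ]
    linarith
  have hρle : ∀ k < K, ρ k + q ≤ r := fun k hk => by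
    have h1 : (k : ℝ) + 1 ≤ K := by exact_mod_cast hk
    have h2 : 4 * q * ((k : ℝ) + 1) ≤ 4 * q * K := by gcongr
    simp only [hρ]
    linarith
  have hwin : ∀ k < K, M * ρ k ^ p ≤ q := fun k hk => by
    have h1 := hρle k hk
    have h2 := hρge k
    rw [hq]
    gcongr
    linarith
  have hsub : ∀ k < K, ∀ i, |a i - ρ k| ≤ M * ρ k ^ p → i ∈ (hfin r).toFinset := by
    intro k hk i hi
    rw [Set.Finite.mem_toFinset]
    have := (abs_le.mp (hi.trans (hwin k hk))).2
    have := hρle k hk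
    change a i ≤ r
    linarith
  set W : ℕ → Finset ι := fun k => (hfin r).toFinset.filter fun i => |a i - ρ k| ≤ M * ρ k ^ p
  have hW : ∀ k < K, ∀ i, i ∈ W k ↔ |a i - ρ k| ≤ M * ρ k ^ p := fun k hk i => by
    rw [Finset.mem_filter]
    exact ⟨fun h => h.2, fun h => ⟨hsub k hk i h, h⟩⟩
  suffices ∃ k < K, (W k).card ≤ N by
    obtain ⟨k, hk, hcard⟩ := this
    exact ⟨ρ k, by linarith [hρge k], W k, hcard, hW k hk⟩
  by_contra! hcon
  have hdisj : Set.PairwiseDisjoint (Finset.range K : Set ℕ) W := by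
    intro k hk l hl hkl
    rw [Finset.mem_coe, Finset.mem_range] at hk hl
    rw [Function.onFun, Finset.disjoint_left]
    intro i hik hil
    have h1 := abs_le.mp (((hW k hk i).mp hik).trans (hwin k hk))
    have h2 := abs_le.mp (((hW l hl i).mp hil).trans (hwin l hl))
    simp only [hρ] at h1 h2
    rcases lt_or_gt_of_ne hkl with h | h
    · have h3 : (k : ℝ) + 1 ≤ l := by exact_mod_cast h
      nlinarith
    · have h3 : (l : ℝ) + 1 ≤ k := by exact_mod_cast h
      nlinarith
  have hcard : K * (N + 1) ≤ (hfin r).toFinset.card := by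
    calc K * (N + 1) = ∑ k ∈ Finset.range K, (N + 1) := by simp
      _ ≤ ∑ k ∈ Finset.range K, (W k).card :=
        Finset.sum_le_sum fun k hk => hcon k (Finset.mem_range.mp hk)
      _ = ((Finset.range K).biUnion W).card := (Finset.card_biUnion hdisj).symm
      _ ≤ _ := Finset.card_le_card (Finset.biUnion_subset.mpr fun k _ => Finset.filter_subset _ _)
  have h1 : (K : ℝ) * (N + 1) ≤ c * r ^ (1 - p) := le_trans (by exact_mod_cast hcard) hcr
  have hc0 : 0 < c := by
    by_contra! hneg
    have : 0 < (K : ℝ) * (N + 1) := by positivity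
    nlinarith [Real.rpow_nonneg hr0.le (1 - p)]
  have h2 : c * r ^ (1 - p) ≤ c * (16 * M * K) := by gcongr
  nlinarith

end Pigeonhole

lemma differentiableAt_det {W : Type*} [Fintype W] [DecidableEq W] {A : ℂ → Matrix W W ℂ} {z : ℂ}
    (hA : ∀ i j, DifferentiableAt ℂ (fun z => A z i j) z) :
    DifferentiableAt ℂ (fun z => (A z).det) z := by
  simp only [Matrix.det_apply]
  refine DifferentiableAt.fun_sum fun σ _ => DifferentiableAt.const_smul ?_ _
  exact DifferentiableAt.fun_finsetProd fun i _ => hA _ _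

namespace Op

section Window

variable {H : Type*} [NormedAddCommGroup H] [InnerProductSpace ℂ H] {ι : Type*}

/-- Eigenvalues with modulus close to `ρ` can be moved radially away from the circle. -/
lemma exists_radial_shift {lam : ι → ℂ} {ρ w : ℝ} (hw : 0 < w) (hwρ : w < ρ) {W : Finset ι}
    (hW : ∀ i, i ∈ W ↔ |‖lam i‖ - ρ| ≤ w) :
    ∃ κ : ι → ℂ, (∀ i, ‖κ i‖ ≤ 2 * w) ∧ (∀ i, i ∉ W → κ i = 0) ∧
      (∀ i, ‖lam i‖ ≤ ‖lam i + κ i‖) ∧ ∀ i, w ≤ |‖lam i + κ i‖ - ρ| := by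
  classical
  have h0 : ∀ i ∈ W, 0 < ‖lam i‖ := fun i hi => by
    linarith [(abs_le.mp ((hW i).mp hi)).1]
  have h1 : ∀ i ∈ W, ‖lam i + ((2 * w / ‖lam i‖ : ℝ) : ℂ) * lam i‖ = ‖lam i‖ + 2 * w := fun i hi => by
    have h2 := h0 i hi
    have : lam i + ((2 * w / ‖lam i‖ : ℝ) : ℂ) * lam i = ((1 + 2 * w / ‖lam i‖ : ℝ) : ℂ) * lam i := by
      push_cast
      ring
    rw [this, norm_mul, norm_real, Real.norm_of_nonneg (by positivity)]
    field_simp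
  refine ⟨fun i => if i ∈ W then ((2 * w / ‖lam i‖ : ℝ) : ℂ) * lam i else 0, fun i => ?_,
    fun i hi => if_neg hi, fun i => ?_, fun i => ?_⟩
  · beta_reduce
    split_ifs with hi
    · have h2 := h0 i hi
      rw [norm_mul, norm_real, Real.norm_of_nonneg (by positivity)]
      field_simp
      exact le_rfl
    · rw [norm_zero]
      positivity
  · beta_reduce
    split_ifs with hi
    · rw [h1 i hi]
      linarith
    · simp
  · beta_reduce
    split_ifs with hi
    · rw [h1 i hi]
      refine le_trans ?_ (le_abs_self _)
      linarith [(abs_le.mp ((hW i).mp hi)).1]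
    · rw [add_zero]
      exact (not_le.mp (mt (hW i).mpr hi)).le

/-- The determinant which detects the spectrum of `G + S` in the annulus `|‖z‖ - ρ| ≤ w / 2`. -/
theorem exists_annulus_det [CompleteSpace H] {G S : Op H} {e : HilbertBasis ι ℂ H} {lam : ι → ℂ}
    {p b ρ w : ℝ} (hS : S.Subordinate G p b) (h : G.IsDiagonalIn e lam) (hp0 : 0 ≤ p) (hp1 : p < 1)
    (hb : 0 ≤ b) (hw : 0 < w) (hwρ : w < ρ) (hbw : 16 * b * ρ ^ p ≤ w) {W : Finset ι}
    (hW : ∀ i, i ∈ W ↔ |‖lam i‖ - ρ| ≤ w) :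
    ∃ g : ℂ → ℂ, ∀ z, |‖z‖ - ρ| ≤ w / 2 → DifferentiableAt ℂ g z ∧
      ‖g z‖ ≤ W.card.factorial * 9 ^ W.card ∧
      (g z ≠ 0 → ∃ R, (G.addOp S).IsResolventAt z R ∧
        ‖R‖ ≤ 4 / w * (1 + W.card ^ 2 * (W.card.factorial * 9 ^ W.card / ‖g z‖) * 8)) ∧
      ∀ R, (G.addOp S).IsResolventAt z R → ‖R‖ * (2 * w) ≤ 256 →
        1 ≤ ‖g z‖ * (W.card.factorial * 257 ^ W.card) := by
  classical
  obtain ⟨κ, hκ, hκ0, hκle, hκfar⟩ := exists_radial_shift hw hwρ hW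
  have h' := h.addCLM hκ
  have hS' := hS.addCLM h hp0 hb hκ hκle
  set G' := G.addCLM (e.diag κ) with hG'
  set T := G.addOp S with hT
  set T' := G'.addOp S with hT'
  have hρ : 0 < ρ := hw.trans hwρ
  have hres : ∀ z, |‖z‖ - ρ| ≤ w / 2 → ∃ R, T'.IsResolventAt z R ∧ ‖R‖ ≤ 4 / w := by
    intro z hz
    have hz' := abs_le.mp hz
    have hzp : ‖z‖ ^ p ≤ 2 * ρ ^ p := by
      calc ‖z‖ ^ p ≤ (2 * ρ) ^ p := by
            gcongr
            linarith
        _ = 2 ^ p * ρ ^ p := Real.mul_rpow (by norm_num) hρ.le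
        _ ≤ 2 * ρ ^ p := by
            gcongr
            calc (2 : ℝ) ^ p ≤ 2 ^ (1 : ℝ) :=
                  Real.rpow_le_rpow_of_exponent_le (by norm_num) hp1.le
              _ = 2 := Real.rpow_one _
    obtain ⟨R, hR, hRn⟩ := exists_resolvent_of_far (d := w / 2) (z := z) hS' h' hp0 hp1 hb
      (by positivity) (by linarith) (by
        have : 4 * b * ‖z‖ ^ p ≤ 4 * b * (2 * ρ ^ p) := by gcongr
        linarith) fun i => by
        have h1 := hκfar i
        have h2 := abs_norm_sub_norm_le (lam i + κ i) z
        have h3 := abs_sub_le ‖lam i + κ i‖ ‖z‖ ρ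
        linarith
    refine ⟨R, hR, hRn.trans (le_of_eq ?_)⟩
    field_simp
    norm_num
  have hres' : ∀ z, |‖z‖ - ρ| ≤ w / 2 → T'.IsResolventAt z (T'.res z) ∧ ‖T'.res z‖ ≤ 4 / w := by
    intro z hz
    obtain ⟨R, hR, hRn⟩ := hres z hz
    rw [hR.res_eq]
    exact ⟨hR, hRn⟩
  set v : W → H := fun l => e l with hv
  set f : W → H := fun l => κ l • e l with hf
  have hv1 : ∀ l, ‖v l‖ ≤ 1 := fun l => (e.norm_apply l).le
  have hfn : ∀ l, ‖f l‖ ≤ 2 * w := fun l => by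
    rw [hf, norm_smul, e.norm_apply, mul_one]
    exact hκ l
  have hK : ∀ x, e.diag κ x = ∑ l, ⟪v l, x⟫_ℂ • f l := fun x => e.ext_inner fun i => by
    rw [e.inner_diag hκ, inner_sum]
    simp only [hv, hf, inner_smul_right, e.inner_self_apply, mul_ite, mul_one, mul_zero]
    by_cases hi : i ∈ W
    · rw [Finset.sum_eq_single ⟨i, hi⟩ (fun l _ hl => if_neg fun hil => hl (Subtype.ext hil.symm))
        (fun hl => (hl (Finset.mem_univ _)).elim)]
      simp [mul_comm]
    · rw [hκ0 i hi, zero_mul, Finset.sum_eq_zero]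
      rintro ⟨l, hl⟩ -
      refine if_neg ?_
      rintro rfl
      exact hi hl
  have happ : ∀ x ∈ T.dom, T'.app x = T.app x + e.diag κ x := fun x _ => by
    change G.app x + e.diag κ x + S.app x = G.app x + S.app x + e.diag κ x
    abel
  have hRf : ∀ z, |‖z‖ - ρ| ≤ w / 2 → ∀ l, ‖T'.res z‖ * ‖f l‖ ≤ 8 := fun z hz l => by
    calc ‖T'.res z‖ * ‖f l‖ ≤ 4 / w * (2 * w) := by
          gcongr
          · exact (hres' z hz).2
          · exact hfn l
      _ = 8 := by
          field_simp
          norm_num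
  refine ⟨fun z => (frMatrix (fun l => (innerSL ℂ (v l)).comp (T'.res z)) f).det,
    fun z hz => ⟨?_, ?_, ?_, ?_⟩⟩
  · have hd := differentiableAt_res (T := T') ⟨_, (hres' z hz).1⟩
    refine differentiableAt_det fun k l => ?_
    have : (fun z => frMatrix (fun l => (innerSL ℂ (v l)).comp (T'.res z)) f k l)
        = fun z => (1 : Matrix W W ℂ) k l - innerSL ℂ (v k) (T'.res z (f l)) := rfl
    rw [this]
    exact (differentiableAt_const _).sub
      ((innerSL ℂ (v k)).differentiableAt.comp z (hd.clm_apply (differentiableAt_const _)))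
  · rw [← Fintype.card_coe]
    refine norm_det_le fun k l => ?_
    rw [frMatrix, Matrix.sub_apply, Matrix.of_apply]
    have h1 : ‖(1 : Matrix W W ℂ) k l‖ ≤ 1 := by
      rw [Matrix.one_apply]
      split_ifs <;> simp
    have h2 : ‖⟪v k, T'.res z (f l)⟫_ℂ‖ ≤ 8 :=
      (norm_inner_le_norm _ _).trans ((mul_le_of_le_one_left (norm_nonneg _) (hv1 k)).trans
        (((T'.res z).le_opNorm _).trans (hRf z hz l)))
    refine (norm_sub_le _ _).trans ?_
    change _ + ‖⟪v k, T'.res z (f l)⟫_ℂ‖ ≤ 9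
    linarith
  · intro hne
    obtain ⟨R, hR, hRn⟩ := exists_resolvent_of_det_ne_zero (T := T) (T' := T') rfl happ hK hv1
      (by norm_num : (1 : ℝ) ≤ 8) (hRf z hz) (hres' z hz).1 hne
    refine ⟨R, hR, hRn.trans ?_⟩
    rw [Fintype.card_coe]
    norm_num only
    gcongr
    exact (hres' z hz).2
  · intro R hR hRn
    have := one_le_norm_det_mul (T := T) (T' := T') (y := 256) rfl happ hK hv1 (fun l =>
      (mul_le_mul_of_nonneg_left (hfn l) (norm_nonneg _)).trans hRn) hR (hres' z hz).1
    rw [Fintype.card_coe] at this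
    norm_num only at this ⊢
    exact this

end Window

end Op

lemma half_abs_le_norm_exp_mul_I_sub_one {φ : ℝ} (hφ : |φ| ≤ Real.pi) :
    |φ| / 2 ≤ ‖exp (φ * I) - 1‖ := by
  rw [mul_comm, norm_exp_I_mul_ofReal_sub_one, norm_mul, Real.norm_two, Real.norm_eq_abs]
  have h1 := Real.mul_abs_le_abs_sin (x := φ / 2) (by
    rw [abs_div, abs_two]
    linarith)
  rw [abs_div, abs_two] at h1
  have h2 : (1 : ℝ) / 2 ≤ 2 / Real.pi := by
    rw [div_le_div_iff₀ (by norm_num) Real.pi_pos]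
    linarith [Real.pi_le_four]
  have h3 : 1 / 2 * (|φ| / 2) ≤ 2 / Real.pi * (|φ| / 2) := by gcongr
  linarith

lemma norm_sub_norm_mul_le {z ω : ℂ} (hω : ‖ω‖ = 1) {x : ℝ} (hx : 0 ≤ x) :
    ‖z - ‖z‖ * ω‖ ≤ 2 * ‖x * ω - z‖ := by
  have h1 : ‖(x * ω - ‖z‖ * ω : ℂ)‖ = |x - ‖z‖| := by
    rw [← sub_mul, norm_mul, hω, mul_one, ← ofReal_sub, norm_real, Real.norm_eq_abs]
  have h2 : |x - ‖z‖| ≤ ‖x * ω - z‖ := by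
    have := abs_norm_sub_norm_le (x * ω) z
    rwa [norm_mul, hω, mul_one, norm_real, Real.norm_of_nonneg hx] at this
  have h3 : z - ‖z‖ * ω = (x * ω - ‖z‖ * ω) - (x * ω - z) := by ring
  rw [h3]
  refine (norm_sub_le _ _).trans ?_
  rw [h1]
  linarith

lemma exists_eq_mul_exp {z ω : ℂ} (hω : ‖ω‖ = 1) :
    ∃ φ : ℝ, |φ| ≤ Real.pi ∧ z = ‖z‖ * ω * exp (φ * I) := by
  have hω0 : ω ≠ 0 := by
    rintro rfl
    simp at hω
  refine ⟨arg (z / ω), abs_arg_le_pi _, ?_⟩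
  have h1 := norm_mul_exp_arg_mul_I (z / ω)
  rw [norm_div, hω, div_one] at h1
  rw [mul_right_comm, h1]
  field_simp

namespace Op

section GoodCircles

variable {H : Type*} [NormedAddCommGroup H] [InnerProductSpace ℂ H] [CompleteSpace H]
  {ι J : Type*} {G : Op H} {e : HilbertBasis ι ℂ H} {lam : ι → ℂ} {p b : ℝ} {ω : J → ℂ}

lemma exists_resolvent_of_ray [Nonempty J] {S : Op H} (hS : S.Subordinate G p b)
    (h : G.IsDiagonalIn e lam) (hp0 : 0 ≤ p) (hp1 : p < 1) (hb : 0 ≤ b) (hω : ∀ j, ‖ω j‖ = 1)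
    (hray : ∀ i, ∃ j, lam i = ‖lam i‖ * ω j) {m : ℝ} {z : ℂ} (hm : 0 < m)
    (hbm : 8 * b * ‖z‖ ^ p ≤ m) (hz : ∀ j, m ≤ ‖z - ‖z‖ * ω j‖) :
    ∃ R, (G.addOp S).IsResolventAt z R ∧ ‖R‖ ≤ 4 / m := by
  obtain ⟨R, hR, hRn⟩ := exists_resolvent_of_far (d := m / 2) (z := z) hS h hp0 hp1 hb
    (by positivity) (by
      obtain ⟨j⟩ := ‹Nonempty J›
      have h1 := (hz j).trans (norm_sub_le _ _)
      rw [norm_mul, hω, mul_one, norm_real, norm_norm] at h1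
      linarith) (by linarith) fun i => by
      obtain ⟨j, hj⟩ := hray i
      have h1 := norm_sub_norm_mul_le (z := z) (hω j) (norm_nonneg (lam i))
      rw [← hj] at h1
      linarith [hz j]
  refine ⟨R, hR, hRn.trans (le_of_eq ?_)⟩
  field_simp
  norm_num

lemma rpow_two_mul_le {x y : ℝ} (hp0 : 0 ≤ p) (hp1 : p < 1) (hx : 0 ≤ x) (hxy : x ≤ 2 * y) :
    x ^ p ≤ 2 * y ^ p := by
  have hy : 0 ≤ y := by linarith
  calc x ^ p ≤ (2 * y) ^ p := by gcongr
    _ = 2 ^ p * y ^ p := Real.mul_rpow (by norm_num) hy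
    _ ≤ 2 * y ^ p := by
        gcongr
        calc (2 : ℝ) ^ p ≤ 2 ^ (1 : ℝ) :=
              Real.rpow_le_rpow_of_exponent_le (by norm_num) hp1.le
          _ = 2 := Real.rpow_one _

set_option maxHeartbeats 1000000 in
/-- There are arbitrarily large circles on which the resolvents of all `G + S k` are controlled by
the distance to the rays. -/
theorem exists_good_circles [Fintype J] [Nonempty J] {β : Type*} [Fintype β] {S : β → Op H}
    (hS : ∀ k, (S k).Subordinate G p b) (h : G.IsDiagonalIn e lam) (hp0 : 0 ≤ p) (hp1 : p < 1)
    (hb : 0 ≤ b) (hω : ∀ j, ‖ω j‖ = 1) (hray : ∀ i, ∃ j, lam i = ‖lam i‖ * ω j)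
    (hfin : ∀ r : ℝ, {i | ‖lam i‖ ≤ r}.Finite) {c : ℝ}
    (hc : ∃ᶠ r : ℝ in atTop, ((hfin r).toFinset.card : ℝ) ≤ c * r ^ (1 - p)) :
    ∃ C > 0, ∀ R0 : ℝ, ∃ r > R0, ∀ k z, ‖z‖ = r → ∃ R, (G.addOp (S k)).IsResolventAt z R ∧
      ‖R‖ ≤ C * ∑ j, (r ^ p + ‖z - r * ω j‖)⁻¹ := by
  set h0 : ℝ := 32 * b + 1 with hh0
  have hh1 : 1 ≤ h0 := by linarith
  have hhb : 32 * b ≤ h0 := by linarith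
  have hhpos : 0 < h0 := by linarith
  obtain ⟨N, hN⟩ := exists_sparse_window hfin hp0 hp1 hc (M := 16 * h0) (by positivity)
  set B : ℝ := N.factorial * 257 ^ N with hB
  have hB1 : 1 ≤ B := by
    have h1 : (1 : ℝ) ≤ N.factorial := by exact_mod_cast Nat.one_le_iff_ne_zero.mpr (by positivity)
    have h2 : (1 : ℝ) ≤ 257 ^ N := one_le_pow₀ (by norm_num)
    nlinarith
  obtain ⟨δ, hδ, hseg⟩ := exists_lower_bound_on_segment_of_fintype (J × β) (h := h0) (R := 4 * h0)
    hhpos (by linarith) hB1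
  obtain ⟨η, hη, hηω⟩ : ∃ η > 0, ∀ j k, ω j ≠ ω k → η ≤ ‖ω j - ω k‖ := by
    classical
    obtain ⟨q, hq⟩ := Finite.exists_min fun q : J × J =>
      if ω q.1 = ω q.2 then (1 : ℝ) else ‖ω q.1 - ω q.2‖
    refine ⟨_, ?_, fun j k hjk => (hq (j, k)).trans (le_of_eq (if_neg hjk))⟩
    split_ifs with hq0
    · exact one_pos
    · exact norm_pos_iff.mpr (sub_ne_zero.mpr hq0)
  set C1 : ℝ := 1 / (4 * h0) * (1 + N ^ 2 * (B / δ) * 8) with hC1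
  have hC10 : 0 ≤ C1 := by positivity
  refine ⟨C1 * (2 + h0) + 20, by positivity, fun R0 => ?_⟩
  have ht0 : Tendsto (fun ρ : ℝ => ρ ^ (p - 1)) atTop (nhds 0) := by
    have := tendsto_rpow_neg_atTop (y := 1 - p) (by linarith)
    simpa using this
  obtain ⟨R1, hR1⟩ := eventually_atTop.mp ((ht0.eventually_lt_const
    (show (0 : ℝ) < min (1 / (16 * h0)) (η / (2 * h0)) by positivity)).and
    ((eventually_gt_atTop R0).and (eventually_gt_atTop 0)))
  obtain ⟨ρ, hρR1, W, hWN, hW⟩ := hN R1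
  obtain ⟨ht, hρR0, hρ⟩ := hR1 ρ hρR1.le
  set t := ρ ^ (p - 1) with htdef
  have htpos : 0 < t := by positivity
  have ht16 : 16 * h0 * t < 1 := by
    have := ht.trans_le (min_le_left _ _)
    rw [lt_div_iff₀ (by positivity)] at this
    linarith
  have htη : 2 * h0 * t ≤ η := by
    have := ht.trans_le (min_le_right _ _)
    rw [lt_div_iff₀ (by positivity)] at this
    linarith
  have hq : ρ ^ p = t * ρ := by
    rw [htdef, Real.rpow_sub_one hρ.ne']
    field_simp
  set q := ρ ^ p with hqdef
  have hq0 : 0 < q := by positivity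
  have hbq : b * q ≤ h0 * q / 32 := by nlinarith
  have hw : 0 < 16 * h0 * q := by positivity
  have hwρ : 16 * h0 * q < ρ := by
    rw [hq]
    nlinarith
  have hdet := fun k => exists_annulus_det (hS k) h hp0 hp1 hb hw hwρ
    (by change 16 * b * q ≤ _; nlinarith) hW
  choose g hg using hdet
  set pt : J → ℂ → ℂ := fun j v => ρ * ω j * exp (t * (h0 * I + v)) with hpt
  have hptn : ∀ j v, ‖pt j v‖ = ρ * Real.exp (t * v.re) := fun j v => by
    rw [hpt, norm_mul, norm_mul, hω, norm_real, Real.norm_of_nonneg hρ.le, norm_exp, mul_one]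
    congr 2
    simp
  have hptw : ∀ j, ∀ v ∈ ball (0 : ℂ) (4 * h0), |‖pt j v‖ - ρ| ≤ 16 * h0 * q / 2 := by
    intro j v hv
    rw [mem_ball_zero_iff] at hv
    have h1 : |t * v.re| ≤ t * (4 * h0) := by
      rw [abs_mul, abs_of_pos htpos]
      have := abs_re_le_norm v
      gcongr
      linarith
    have h2 := Real.abs_exp_sub_one_le (x := t * v.re) (by linarith)
    have h3 : ‖pt j v‖ - ρ = ρ * (Real.exp (t * v.re) - 1) := by
      rw [hptn]
      ring
    rw [h3, abs_mul, abs_of_pos hρ, hq]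
    nlinarith
  have hfac : ∀ a : ℝ, 1 ≤ a → (W.card.factorial : ℝ) * a ^ W.card ≤ N.factorial * a ^ N := by
    intro a ha
    have : (W.card.factorial : ℝ) ≤ N.factorial := by exact_mod_cast Nat.factorial_le hWN
    gcongr
  have hfac9 : (W.card.factorial : ℝ) * 9 ^ W.card ≤ B := by
    refine (hfac 9 (by norm_num)).trans ?_
    rw [hB]
    gcongr
    norm_num
  -- the centre of the disc
  have hcentre : ∀ k j, ∃ R, (G.addOp (S k)).IsResolventAt (pt j 0) R ∧
      ‖R‖ * (2 * (16 * h0 * q)) ≤ 256 := by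
    intro k j
    have hn : ‖pt j 0‖ = ρ := by simp [hptn]
    have hth : |t * h0| = t * h0 := abs_of_pos (by positivity)
    have hpt0 : pt j 0 = ρ * ω j * exp ((t * h0 : ℝ) * I) := by
      rw [hpt]
      push_cast
      ring_nf
    have hthpi : |t * h0| ≤ Real.pi := by
      rw [hth]
      linarith [Real.pi_gt_three]
    have hlow := half_abs_le_norm_exp_mul_I_sub_one hthpi
    have hup : ‖exp ((t * h0 : ℝ) * I) - 1‖ ≤ t * h0 := by
      have := Real.norm_exp_I_mul_ofReal_sub_one_le (x := t * h0)
      rwa [mul_comm I, Real.norm_eq_abs, hth] at this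
    rw [hth] at hlow
    obtain ⟨R, hR, hRn⟩ := exists_resolvent_of_ray (m := h0 * q / 2) (z := pt j 0) (hS k) h hp0 hp1
      hb hω hray (by positivity) (by
        rw [hn]
        change 8 * b * q ≤ _
        nlinarith) fun i => by
        rw [hn, hpt0]
        have e1 : (ρ * ω j * exp ((t * h0 : ℝ) * I) - ρ * ω i : ℂ)
            = ρ * (ω j * (exp ((t * h0 : ℝ) * I) - 1) + (ω j - ω i)) := by ring
        rw [e1, norm_mul, norm_real, Real.norm_of_nonneg hρ.le]
        have e2 : t * h0 / 2 ≤ ‖ω j * (exp ((t * h0 : ℝ) * I) - 1) + (ω j - ω i)‖ := by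
          by_cases hij : ω j = ω i
          · rw [hij, sub_self, add_zero, norm_mul, hω, one_mul]
            exact hlow
          · have e3 := hηω j i hij
            have e4 := norm_sub_le (ω j * (exp ((t * h0 : ℝ) * I) - 1) + (ω j - ω i))
              (ω j * (exp ((t * h0 : ℝ) * I) - 1))
            rw [add_sub_cancel_left, norm_mul, hω, one_mul] at e4
            linarith
        calc h0 * q / 2 = ρ * (t * h0 / 2) := by rw [hq]; ring
          _ ≤ _ := by gcongr
    refine ⟨R, hR, ?_⟩
    calc ‖R‖ * (2 * (16 * h0 * q)) ≤ 4 / (h0 * q / 2) * (2 * (16 * h0 * q)) := by gcongr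
      _ = 256 := by
          field_simp
          norm_num
  obtain ⟨s, hs, hsδ⟩ := hseg (fun x v => g x.2 (pt x.1 v))
    (fun x v hv => by
      have h1 := (hg x.2 _ (hptw x.1 v hv)).1
      have h2 : DifferentiableAt ℂ (pt x.1) v := by
        simp only [hpt]
        fun_prop
      exact (h1.comp v h2).differentiableWithinAt)
    (fun x v hv => ((hg x.2 _ (hptw x.1 v hv)).2.1.trans hfac9))
    (fun x => by
      obtain ⟨R, hR, hRn⟩ := hcentre x.2 x.1
      have h1 := (hg x.2 _ (hptw x.1 0 (mem_ball_self (by positivity)))).2.2.2 R hR hRn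
      rw [inv_le_iff_one_le_mul₀ (by positivity)]
      refine h1.trans ?_
      gcongr
      exact hfac 257 (by norm_num))
  have hts : 0 ≤ t * s := mul_nonneg htpos.le hs.1
  have hts2 : t * s ≤ 1 / 16 := by
    have : t * s ≤ t * h0 := by
      gcongr
      exact hs.2
    linarith
  set r := ρ * Real.exp (t * s) with hr
  have hρr : ρ ≤ r := by
    have := Real.one_le_exp hts
    nlinarith
  have hr2 : r ≤ 2 * ρ := by
    have := Real.abs_exp_sub_one_le (x := t * s) (by rw [abs_of_nonneg hts]; linarith)
    have h2 := (abs_le.mp this).2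
    rw [abs_of_nonneg hts] at h2
    nlinarith
  have hr0 : 0 < r := hρ.trans_le hρr
  have hrp : r ^ p ≤ 2 * q := rpow_two_mul_le hp0 hp1 hr0.le hr2
  have hrp0 : 0 < r ^ p := by positivity
  refine ⟨r, hρR0.trans_le hρr, fun k z hz => ?_⟩
  have hσ : ∀ j, (r ^ p + ‖z - r * ω j‖)⁻¹ ≤ ∑ j, (r ^ p + ‖z - r * ω j‖)⁻¹ := fun j =>
    Finset.single_le_sum (f := fun j => (r ^ p + ‖z - r * ω j‖)⁻¹)
      (fun j _ => by positivity) (Finset.mem_univ j)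
  by_cases hnear : ∃ j, ‖z - r * ω j‖ < h0 * q / 2
  · obtain ⟨j, hj⟩ := hnear
    obtain ⟨φ, hφ, hzφ⟩ := exists_eq_mul_exp (z := z) (hω j)
    rw [hz] at hzφ
    have h1 := half_abs_le_norm_exp_mul_I_sub_one hφ
    have h2 : ‖z - r * ω j‖ = r * ‖exp (φ * I) - 1‖ := by
      have : z - r * ω j = r * ω j * (exp (φ * I) - 1) := by
        rw [mul_sub, ← hzφ, mul_one]
      rw [this, norm_mul, norm_mul, hω, mul_one, norm_real, Real.norm_of_nonneg hr0.le]
    have h3 : |φ| ≤ t * h0 := by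
      have h4 : ρ * (|φ| / 2) ≤ r * ‖exp (φ * I) - 1‖ := by gcongr
      rw [← h2] at h4
      have h5 : ρ * (|φ| / 2) < ρ * (t * h0 / 2) := by
        calc _ < h0 * q / 2 := h4.trans_lt hj
          _ = _ := by rw [hq]; ring
      have := lt_of_mul_lt_mul_left h5 hρ.le
      linarith
    have h4 : |φ / t| ≤ h0 := by
      rw [abs_div, abs_of_pos htpos, div_le_iff₀ htpos]
      linarith
    have h5 := abs_le.mp h4
    have h6 := hsδ (φ / t - h0) ⟨by linarith, by linarith⟩ (j, k)
    have hzpt : pt j (s + (φ / t - h0 : ℝ) * I) = z := by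
      rw [hzφ, hpt, hr]
      push_cast
      have ht0 : (t : ℂ) ≠ 0 := ofReal_ne_zero.mpr htpos.ne'
      have hexp : (t * (h0 * I + (s + (φ / t - h0) * I)) : ℂ) = t * s + φ * I := by
        field_simp
        ring
      rw [hexp, Complex.exp_add]
      ring
    have hv : (s + (φ / t - h0 : ℝ) * I : ℂ) ∈ ball (0 : ℂ) (4 * h0) := by
      rw [mem_ball_zero_iff]
      refine (norm_add_le _ _).trans_lt ?_
      rw [norm_mul, norm_I, mul_one, norm_real, norm_real, Real.norm_eq_abs, Real.norm_eq_abs,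
        abs_of_nonneg hs.1, abs_of_nonpos (by linarith)]
      linarith [hs.2]
    have h7 := hg k _ (hptw j _ hv)
    change δ ≤ ‖g k (pt j _)‖ at h6
    rw [hzpt] at h6 h7
    obtain ⟨R, hR, hRn⟩ := h7.2.2.1 (norm_pos_iff.mp (hδ.trans_le h6))
    refine ⟨R, hR, ?_⟩
    have h8 : ‖R‖ ≤ C1 / q := by
      have h9 : (W.card : ℝ) ≤ N := by exact_mod_cast hWN
      calc ‖R‖ ≤ 4 / (16 * h0 * q) * (1 + N ^ 2 * (B / δ) * 8) := by
            refine hRn.trans ?_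
            gcongr
        _ = C1 / q := by
            rw [hC1]
            field_simp
            norm_num
    calc ‖R‖ ≤ C1 / q := h8
      _ = C1 * (2 + h0) * ((2 + h0) * q)⁻¹ := by
          field_simp
      _ ≤ C1 * (2 + h0) * (r ^ p + ‖z - r * ω j‖)⁻¹ := by
          gcongr
          nlinarith
      _ ≤ (C1 * (2 + h0) + 20) * ∑ j, (r ^ p + ‖z - r * ω j‖)⁻¹ := by
          gcongr
          · linarith
          · exact hσ j
  · push Not at hnear
    obtain ⟨j, hj⟩ := Finite.exists_min fun j => ‖z - r * ω j‖
    have hmj := hnear j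
    obtain ⟨R, hR, hRn⟩ := exists_resolvent_of_ray (m := ‖z - r * ω j‖) (z := z) (hS k) h hp0 hp1
      hb hω hray (lt_of_lt_of_le (by positivity) hmj) (by
        rw [hz]
        have : 8 * b * r ^ p ≤ 8 * b * (2 * q) := by gcongr
        linarith) fun i => by
        rw [hz]
        exact hj i
    refine ⟨R, hR, ?_⟩
    set m := ‖z - r * ω j‖ with hm
    have hm0 : 0 < m := lt_of_lt_of_le (by positivity) hmj
    calc ‖R‖ ≤ 4 / m := hRn
      _ = 20 * (5 * m)⁻¹ := by
          field_simp
          norm_num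
      _ ≤ 20 * (r ^ p + m)⁻¹ := by
          gcongr
          nlinarith
      _ ≤ (C1 * (2 + h0) + 20) * ∑ j, (r ^ p + ‖z - r * ω j‖)⁻¹ := by
          gcongr
          · have : 0 ≤ C1 * (2 + h0) := by positivity
            linarith
          · exact hσ j

end GoodCircles

end Op

section CircleKernel

lemma integral_inv_sq_linear_le {a k : ℝ} (ha : 0 < a) (hk : 0 < k) {x : ℝ} (hx : 0 ≤ x) :
    ∫ t in (0 : ℝ)..x, ((a + k * t)⁻¹) ^ 2 ≤ (k * a)⁻¹ := by
  have hpos : ∀ t ∈ Set.uIcc 0 x, 0 < a + k * t := by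
    intro t ht
    rw [Set.uIcc_of_le hx] at ht
    have := mul_nonneg hk.le ht.1
    linarith
  have hinteg : ∫ t in (0 : ℝ)..x, ((a + k * t)⁻¹) ^ 2
      = -(k⁻¹ * (a + k * x)⁻¹) - -(k⁻¹ * (a + k * 0)⁻¹) := by
    refine intervalIntegral.integral_eq_sub_of_hasDerivAt
      (f := fun t => -(k⁻¹ * (a + k * t)⁻¹)) (fun t ht => ?_) ?_
    · have h1 : HasDerivAt (fun t => a + k * t) k t := by
        simpa using ((hasDerivAt_id t).const_mul k).const_add a
      refine ((h1.fun_inv (hpos t ht).ne').const_mul k⁻¹).fun_neg.congr_deriv ?_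
      have := (hpos t ht).ne'
      field_simp
    · refine ContinuousOn.intervalIntegrable ?_
      exact ((by fun_prop : ContinuousOn (fun t => a + k * t) (Set.uIcc 0 x)).inv₀
        fun t ht => (hpos t ht).ne').pow 2
  have h2 : 0 < a + k * x := hpos x (by simp)
  rw [hinteg, mul_zero, add_zero, mul_inv]
  have : 0 ≤ k⁻¹ * (a + k * x)⁻¹ := by positivity
  linarith

/-- The square integral over the circle of radius `ρ` of the inverse distance to a boundary point,
regularised at the scale `a`. -/
lemma integral_inv_sq_dist_le {a ρ : ℝ} (ha : 0 < a) (hρ : 0 < ρ) {ω : ℂ} (hω : ‖ω‖ = 1) :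
    ∫ φ in (0 : ℝ)..2 * Real.pi, ((a + ‖circleMap 0 ρ φ - ρ * ω‖)⁻¹) ^ 2 ≤ 4 / (ρ * a) := by
  set f : ℝ → ℝ := fun φ => ((a + ‖circleMap 0 ρ φ - ρ * ω‖)⁻¹) ^ 2 with hf
  have hper : Function.Periodic f (2 * Real.pi) := fun φ => by
    simp only [hf]
    rw [periodic_circleMap]
  have hfc : Continuous f := by
    refine (Continuous.inv₀ (by fun_prop) fun φ => ?_).pow 2
    positivity
  set α := arg ω with hα
  have hωα : ω = exp (α * I) := by
    conv_lhs => rw [← norm_mul_exp_arg_mul_I ω, hω, ofReal_one, one_mul]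
  set g : ℝ → ℝ := fun φ => ((a + ρ / 2 * |φ|)⁻¹) ^ 2 with hg
  have hgc : Continuous g := by
    refine (Continuous.inv₀ (by fun_prop) fun φ => ?_).pow 2
    positivity
  have hle : ∀ φ ∈ Set.Icc (-Real.pi) Real.pi, f (φ + α) ≤ g φ := by
    intro φ hφ
    have h1 : circleMap 0 ρ (φ + α) - ρ * ω = ρ * ω * (exp (φ * I) - 1) := by
      rw [circleMap, hωα]
      push_cast
      rw [add_mul, Complex.exp_add]
      ring
    have h2 := half_abs_le_norm_exp_mul_I_sub_one (abs_le.mpr hφ)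
    simp only [hf, hg]
    rw [h1, norm_mul, norm_mul, hω, mul_one, norm_real, Real.norm_of_nonneg hρ.le]
    have h3 := mul_le_mul_of_nonneg_left h2 hρ.le
    have h4 : 0 < a + ρ / 2 * |φ| := by positivity
    refine pow_le_pow_left₀ (by positivity) (inv_anti₀ h4 ?_) 2
    linarith
  have hpi := Real.pi_pos
  have e1 : ∫ φ in (0 : ℝ)..2 * Real.pi, f φ = ∫ φ in (-Real.pi)..Real.pi, f (φ + α) := by
    rw [intervalIntegral.integral_comp_add_right]
    have := hper.intervalIntegral_add_eq 0 (-Real.pi + α)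
    rw [zero_add] at this
    rw [this]
    congr 1
    ring
  have e2 : ∫ φ in (-Real.pi)..Real.pi, f (φ + α) ≤ ∫ φ in (-Real.pi)..Real.pi, g φ :=
    intervalIntegral.integral_mono_on (by linarith)
      ((hfc.comp (by fun_prop)).intervalIntegrable _ _) (hgc.intervalIntegrable _ _) hle
  have e3 : ∫ φ in (0 : ℝ)..Real.pi, g φ ≤ (ρ / 2 * a)⁻¹ := by
    refine le_trans (le_of_eq ?_) (integral_inv_sq_linear_le ha (by positivity) hpi.le)
    refine intervalIntegral.integral_congr fun φ hφ => ?_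
    rw [Set.uIcc_of_le hpi.le] at hφ
    simp only [hg]
    rw [abs_of_nonneg hφ.1]
  have e4 : ∫ φ in (-Real.pi)..0, g φ = ∫ φ in (0 : ℝ)..Real.pi, g φ := by
    have := intervalIntegral.integral_comp_neg (a := 0) (b := Real.pi) g
    rw [neg_zero] at this
    rw [← this]
    simp only [hg, abs_neg]
  have e5 := intervalIntegral.integral_add_adjacent_intervals
    (hgc.intervalIntegrable (-Real.pi) 0) (hgc.intervalIntegrable 0 Real.pi) (μ := MeasureTheory.volume)
  rw [e1]
  refine e2.trans ?_
  rw [← e5, e4]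
  have : 4 / (ρ * a) = (ρ / 2 * a)⁻¹ + (ρ / 2 * a)⁻¹ := by
    field_simp
    norm_num
  linarith

/-- The weight which controls the resolvents at points of large circles. -/
def rayWeight {J : Type*} [Fintype J] (ω : J → ℂ) (p ρ : ℝ) (z : ℂ) : ℝ :=
  ∑ j, (ρ ^ p + ‖z - ρ * ω j‖)⁻¹

variable {J : Type*} [Fintype J] {ω : J → ℂ} {p ρ : ℝ}

lemma rayWeight_nonneg (hρ : 0 < ρ) (z : ℂ) : 0 ≤ rayWeight ω p ρ z :=
  Finset.sum_nonneg fun j _ => by positivity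

lemma continuous_rayWeight (hρ : 0 < ρ) : Continuous (rayWeight ω p ρ) := by
  refine continuous_finsetSum _ fun j _ => Continuous.inv₀ (by fun_prop) fun φ => ?_
  positivity

lemma one_le_mul_rayWeight [Nonempty J] (hω : ∀ j, ‖ω j‖ = 1) (hp1 : p < 1) (hρ : 1 ≤ ρ) {z : ℂ}
    (hz : ‖z‖ = ρ) : 1 ≤ 3 * ρ * rayWeight ω p ρ z := by
  obtain ⟨j⟩ := ‹Nonempty J›
  have hρ0 : 0 < ρ := by linarith
  have h1 : (ρ ^ p + ‖z - ρ * ω j‖)⁻¹ ≤ rayWeight ω p ρ z :=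
    Finset.single_le_sum (f := fun j => (ρ ^ p + ‖z - ρ * ω j‖)⁻¹)
      (fun j _ => by positivity) (Finset.mem_univ j)
  have h2 : ρ ^ p + ‖z - ρ * ω j‖ ≤ 3 * ρ := by
    have h3 : ρ ^ p ≤ ρ := by
      calc ρ ^ p ≤ ρ ^ (1 : ℝ) := Real.rpow_le_rpow_of_exponent_le hρ hp1.le
        _ = ρ := Real.rpow_one _
    have h4 := norm_sub_le z (ρ * ω j)
    rw [norm_mul, hω, mul_one, norm_real, Real.norm_of_nonneg hρ0.le, hz] at h4
    linarith
  calc 1 = 3 * ρ * (3 * ρ)⁻¹ := (mul_inv_cancel₀ (by positivity)).symm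
    _ ≤ 3 * ρ * rayWeight ω p ρ z := by
        gcongr
        refine le_trans ?_ h1
        gcongr

lemma integral_rayWeight_sq_le (hω : ∀ j, ‖ω j‖ = 1) (hρ : 0 < ρ) :
    ∫ φ in (0 : ℝ)..2 * Real.pi, rayWeight ω p ρ (circleMap 0 ρ φ) ^ 2
      ≤ 4 * Fintype.card J ^ 2 * (ρ ^ (1 + p))⁻¹ := by
  have hc : ∀ j, Continuous fun φ : ℝ => ((ρ ^ p + ‖circleMap 0 ρ φ - ρ * ω j‖)⁻¹) ^ 2 := by
    intro j
    refine (Continuous.inv₀ (by fun_prop) fun φ => ?_).pow 2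
    positivity
  calc ∫ φ in (0 : ℝ)..2 * Real.pi, rayWeight ω p ρ (circleMap 0 ρ φ) ^ 2
      ≤ ∫ φ in (0 : ℝ)..2 * Real.pi,
          (Fintype.card J : ℝ) * ∑ j, ((ρ ^ p + ‖circleMap 0 ρ φ - ρ * ω j‖)⁻¹) ^ 2 := by
        refine intervalIntegral.integral_mono_on (by positivity) ?_ ?_ fun φ _ => ?_
        · exact (((continuous_rayWeight hρ).comp (continuous_circleMap 0 ρ)).pow
            2).intervalIntegrable _ _
        · exact (continuous_const.mul
            (continuous_finsetSum _ fun j _ => hc j)).intervalIntegrable _ _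
        · exact sq_sum_le_card_mul_sum_sq
    _ = Fintype.card J * ∑ j, ∫ φ in (0 : ℝ)..2 * Real.pi,
          ((ρ ^ p + ‖circleMap 0 ρ φ - ρ * ω j‖)⁻¹) ^ 2 := by
        rw [intervalIntegral.integral_const_mul, intervalIntegral.integral_finsetSum]
        exact fun j _ => (hc j).intervalIntegrable _ _
    _ ≤ Fintype.card J * ∑ j : J, 4 / (ρ * ρ ^ p) := by
        gcongr with j
        exact integral_inv_sq_dist_le (by positivity) hρ (hω j)
    _ = 4 * Fintype.card J ^ 2 * (ρ ^ (1 + p))⁻¹ := by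
        rw [Real.rpow_add hρ, Real.rpow_one, Finset.sum_const, Finset.card_univ, nsmul_eq_mul]
        ring

lemma integral_rayWeight_le (hω : ∀ j, ‖ω j‖ = 1) (hρ : 0 < ρ) :
    ∫ φ in (0 : ℝ)..2 * Real.pi, rayWeight ω p ρ (circleMap 0 ρ φ)
      ≤ (Real.pi + 2 * Fintype.card J ^ 2) * ρ ^ (-(1 + p) / 2) := by
  set τ := ρ ^ (-(1 + p) / 2) with hτ
  have hτ0 : 0 < τ := by positivity
  have hττ : (ρ ^ (1 + p))⁻¹ = τ * τ := by
    rw [hτ, ← Real.rpow_add hρ, ← Real.rpow_neg hρ.le]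
    congr 1
    ring
  have hc := (continuous_rayWeight (ω := ω) (p := p) hρ).comp (continuous_circleMap 0 ρ)
  have h1 := integral_rayWeight_sq_le (p := p) hω hρ
  rw [hττ] at h1
  calc ∫ φ in (0 : ℝ)..2 * Real.pi, rayWeight ω p ρ (circleMap 0 ρ φ)
      ≤ ∫ φ in (0 : ℝ)..2 * Real.pi,
          (τ / 2 + (2 * τ)⁻¹ * rayWeight ω p ρ (circleMap 0 ρ φ) ^ 2) := by
        refine intervalIntegral.integral_mono_on (by positivity) (hc.intervalIntegrable _ _)
          ((continuous_const.add (continuous_const.mul (hc.pow 2))).intervalIntegrable _ _)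
          fun φ _ => ?_
        set x := rayWeight ω p ρ (circleMap 0 ρ φ)
        have h2 : τ / 2 + (2 * τ)⁻¹ * x ^ 2 - x = (2 * τ)⁻¹ * (τ - x) ^ 2 := by
          field_simp
          ring
        have h3 : 0 ≤ (2 * τ)⁻¹ * (τ - x) ^ 2 := by positivity
        linarith
    _ = Real.pi * τ + (2 * τ)⁻¹ * ∫ φ in (0 : ℝ)..2 * Real.pi,
          rayWeight ω p ρ (circleMap 0 ρ φ) ^ 2 := by
        have hi : IntervalIntegrable (fun φ => (2 * τ)⁻¹ * rayWeight ω p ρ (circleMap 0 ρ φ) ^ 2)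
            MeasureTheory.volume 0 (2 * Real.pi) :=
          (continuous_const.mul (hc.pow 2)).intervalIntegrable _ _
        rw [intervalIntegral.integral_add (by simp) hi, intervalIntegral.integral_const_mul, intervalIntegral.integral_const]
        rw [smul_eq_mul]
        ring
    _ ≤ Real.pi * τ + (2 * τ)⁻¹ * (4 * Fintype.card J ^ 2 * (τ * τ)) := by gcongr
    _ = _ := by
        field_simp
        ring

end CircleKernel

namespace HilbertBasis

variable {ι H : Type*} [NormedAddCommGroup H] [InnerProductSpace ℂ H]

/-- The orthogonal projection onto the closed span of the basis vectors with index in `s`. -/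
def coordProj (e : HilbertBasis ι ℂ H) (s : Set ι) : H →L[ℂ] H := e.diag (s.indicator 1)

lemma norm_indicator_one_le (s : Set ι) (i : ι) : ‖s.indicator (1 : ι → ℂ) i‖ ≤ 1 := by
  by_cases hi : i ∈ s <;> simp [hi]

lemma inner_coordProj (e : HilbertBasis ι ℂ H) (s : Set ι) (i : ι) (x : H) :
    ⟪e i, e.coordProj s x⟫_ℂ = s.indicator 1 i * ⟪e i, x⟫_ℂ :=
  e.inner_diag (norm_indicator_one_le s) i x

lemma coordProj_compl (e : HilbertBasis ι ℂ H) (s : Set ι) :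
    e.coordProj sᶜ = 1 - e.coordProj s := by
  refine ContinuousLinearMap.ext fun x => e.ext_inner fun i => ?_
  rw [sub_apply, inner_sub_right, e.inner_coordProj, e.inner_coordProj]
  by_cases hi : i ∈ s <;> simp [hi]

lemma norm_coordProj_le (e : HilbertBasis ι ℂ H) (s : Set ι) : ‖e.coordProj s‖ ≤ 1 :=
  e.norm_diag_le zero_le_one (norm_indicator_one_le s)

end HilbertBasis

namespace Op

variable {ι H : Type*} [NormedAddCommGroup H] [InnerProductSpace ℂ H]
  {G S : Op H} {e : HilbertBasis ι ℂ H} {lam : ι → ℂ} {p b : ℝ} {z : ℂ} {R R₀ : H →L[ℂ] H}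

lemma IsDiagonalIn.ne_of_isResolventAt (h : G.IsDiagonalIn e lam) (hR : G.IsResolventAt z R)
    (i : ι) : lam i ≠ z := by
  rintro rfl
  exact h.mem_spec i ⟨R, hR⟩

lemma IsDiagonalIn.inner_resolvent (h : G.IsDiagonalIn e lam) (hR : G.IsResolventAt z R)
    (i : ι) (x : H) : ⟪e i, R x⟫_ℂ = (lam i - z)⁻¹ * ⟪e i, x⟫_ℂ := by
  have h1 := congrArg (fun y => ⟪e i, y⟫_ℂ) (hR.2.1 x)
  simp only [inner_sub_right, inner_smul_right, h.2 _ (hR.1 x)] at h1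
  have h2 := sub_ne_zero.mpr (h.ne_of_isResolventAt hR i)
  rw [← h1]
  field_simp

lemma sub_eq_resolvent_app (hR₀ : G.IsResolventAt z R₀) (hR : (G.addOp S).IsResolventAt z R)
    (x : H) : R₀ x - R x = R (S.app (R₀ x)) := by
  have h1 := hR.2.2 _ (hR₀.1 x)
  have h2 : (G.addOp S).app (R₀ x) - z • R₀ x = x + S.app (R₀ x) := by
    rw [addOp_app, add_sub_right_comm, hR₀.2.1]
  rw [h2, map_add] at h1
  rw [sub_eq_iff_eq_add', h1]

lemma sub_eq_resolvent_app' (hR₀ : G.IsResolventAt z R₀) (hR : (G.addOp S).IsResolventAt z R)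
    (x : H) : R₀ x - R x = R₀ (S.app (R x)) := by
  have h1 := hR₀.2.2 _ (hR.1 x)
  have h2 : G.app (R x) - z • R x = x - S.app (R x) := by
    have := hR.2.1 x
    rw [addOp_app] at this
    rw [eq_sub_iff_add_eq, ← add_sub_right_comm, this]
  rw [h2, map_sub] at h1
  exact sub_eq_iff_eq_add.mpr (sub_eq_iff_eq_add'.mp h1)

lemma Subordinate.norm_app_le (hS : S.Subordinate G p b) (hp0 : 0 ≤ p) (hp1 : p < 1) (hb : 0 ≤ b)
    {u : H} (hu : u ∈ G.dom) {k ρ : ℝ} (hk : 0 ≤ k) (hρ : 0 ≤ ρ) (h1 : ‖u‖ ≤ k)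
    (h2 : ‖G.app u‖ ≤ k * ρ) : ‖S.app u‖ ≤ b * k * ρ ^ p := by
  have : 0 ≤ 1 - p := by linarith
  calc ‖S.app u‖ ≤ b * ‖u‖ ^ (1 - p) * ‖G.app u‖ ^ p := hS.2 u hu
    _ ≤ b * k ^ (1 - p) * (k * ρ) ^ p := by gcongr
    _ = b * (k ^ (1 - p) * k ^ p) * ρ ^ p := by
        rw [Real.mul_rpow hk hρ]
        ring
    _ = b * k * ρ ^ p := by
        rw [← Real.rpow_add_of_nonneg hk this hp0, sub_add_cancel, Real.rpow_one]

/-- A subordinate perturbation does not spoil the graph norm. -/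
lemma Subordinate.norm_base_app_le (hS : S.Subordinate G p b) (hp0 : 0 ≤ p) (hp1 : p < 1)
    (hb : 0 ≤ b) {u : H} (hu : u ∈ G.dom) :
    ‖G.app u‖ ≤ (1 - p)⁻¹ * (‖(G.addOp S).app u‖ + b ^ (1 - p)⁻¹ * ‖u‖) := by
  have hq : 0 < 1 - p := by linarith
  have h1 : ‖G.app u‖ ≤ ‖(G.addOp S).app u‖ + ‖S.app u‖ := by
    have : G.app u = (G.addOp S).app u - S.app u := by rw [addOp_app, add_sub_cancel_right]
    rw [this]
    exact norm_sub_le _ _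
  have h2 : b * ‖u‖ ^ (1 - p) = (b ^ (1 - p)⁻¹ * ‖u‖) ^ (1 - p) := by
    rw [Real.mul_rpow (by positivity) (norm_nonneg u), ← Real.rpow_mul hb, inv_mul_cancel₀ hq.ne',
      Real.rpow_one]
  have h3 := Real.geom_mean_le_arith_mean2_weighted hq.le hp0
    (by positivity : 0 ≤ b ^ (1 - p)⁻¹ * ‖u‖) (norm_nonneg (G.app u)) (by ring)
  have h4 := hS.2 u hu
  rw [h2] at h4
  have h6 : (1 - p) * ‖G.app u‖ ≤ ‖(G.addOp S).app u‖ + b ^ (1 - p)⁻¹ * ‖u‖ := by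
    have : (1 - p) * (b ^ (1 - p)⁻¹ * ‖u‖) ≤ b ^ (1 - p)⁻¹ * ‖u‖ := by
      refine mul_le_of_le_one_left (by positivity) (by linarith)
    linarith
  calc ‖G.app u‖ = (1 - p)⁻¹ * ((1 - p) * ‖G.app u‖) := by field_simp
    _ ≤ _ := by gcongr

/-- The constant in the bound for the perturbation applied to a resolvent. -/
def graphConst (p b C : ℝ) : ℝ := (1 - p)⁻¹ * (3 + C + b ^ (1 - p)⁻¹ * C)

lemma graphConst_nonneg (hp1 : p < 1) (hb : 0 ≤ b) {C : ℝ} (hC : 0 ≤ C) :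
    0 ≤ graphConst p b C := by
  have hq : 0 < 1 - p := by linarith
  rw [graphConst]
  positivity

lemma le_graphConst (hp0 : 0 ≤ p) (hp1 : p < 1) (hb : 0 ≤ b) {C : ℝ} (hC : 0 ≤ C) :
    3 + C ≤ graphConst p b C := by
  have hq : 0 < 1 - p := by linarith
  have h1 : 1 ≤ (1 - p)⁻¹ := (one_le_inv₀ hq).mpr (by linarith)
  have h2 : 0 ≤ b ^ (1 - p)⁻¹ * C := by positivity
  calc 3 + C ≤ 1 * (3 + C + b ^ (1 - p)⁻¹ * C) := by linarith
    _ ≤ graphConst p b C := by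
        rw [graphConst]
        gcongr

lemma norm_app_perturbed_resolvent_le (hS : S.Subordinate G p b) (hp0 : 0 ≤ p) (hp1 : p < 1)
    (hb : 0 ≤ b) (hR : (G.addOp S).IsResolventAt z R) {C ρ σ : ℝ} (hC : 0 ≤ C) (hρ : 1 ≤ ρ)
    (hσ : 0 ≤ σ) (hz : ‖z‖ = ρ) (hσ1 : 1 ≤ 3 * ρ * σ) (hRle : ‖R‖ ≤ C * σ) (x : H) :
    ‖S.app (R x)‖ ≤ b * (graphConst p b C * σ * ‖x‖) * ρ ^ p := by
  have hK := graphConst_nonneg hp1 hb hC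
  have hKC := le_graphConst hp0 hp1 hb hC
  have hq : 0 < 1 - p := by linarith
  have hu : ‖R x‖ ≤ C * σ * ‖x‖ := (R.le_opNorm x).trans (by gcongr)
  refine hS.norm_app_le hp0 hp1 hb (hR.1 x) (by positivity) (by positivity) ?_ ?_
  · refine hu.trans ?_
    gcongr
    linarith
  · refine (hS.norm_base_app_le hp0 hp1 hb (hR.1 x)).trans ?_
    have h1 : (G.addOp S).app (R x) = x + z • R x := by
      rw [← sub_eq_iff_eq_add.mp (hR.2.1 x)]
    have h2 : ‖(G.addOp S).app (R x)‖ ≤ 3 * ρ * σ * ‖x‖ + ρ * (C * σ * ‖x‖) := by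
      rw [h1]
      refine (norm_add_le _ _).trans ?_
      rw [norm_smul, hz]
      gcongr
      exact le_mul_of_one_le_left (norm_nonneg x) hσ1
    have h3 : b ^ (1 - p)⁻¹ * ‖R x‖ ≤ b ^ (1 - p)⁻¹ * (ρ * (C * σ * ‖x‖)) := by
      gcongr
      exact hu.trans (le_mul_of_one_le_left (by positivity) hρ)
    calc (1 - p)⁻¹ * (‖(G.addOp S).app (R x)‖ + b ^ (1 - p)⁻¹ * ‖R x‖)
        ≤ (1 - p)⁻¹ * (3 * ρ * σ * ‖x‖ + ρ * (C * σ * ‖x‖)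
            + b ^ (1 - p)⁻¹ * (ρ * (C * σ * ‖x‖))) := by gcongr
      _ = _ := by
        rw [graphConst]
        ring

lemma norm_app_base_resolvent_le (hS : S.Subordinate G p b) (hp0 : 0 ≤ p) (hp1 : p < 1)
    (hb : 0 ≤ b) (hR : G.IsResolventAt z R) {C ρ σ : ℝ} (hC : 0 ≤ C) (hρ : 1 ≤ ρ)
    (hσ : 0 ≤ σ) (hz : ‖z‖ = ρ) (hσ1 : 1 ≤ 3 * ρ * σ) (hRle : ‖R‖ ≤ C * σ) (x : H) :
    ‖S.app (R x)‖ ≤ b * (graphConst p b C * σ * ‖x‖) * ρ ^ p := by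
  have hK := graphConst_nonneg hp1 hb hC
  have hKC := le_graphConst hp0 hp1 hb hC
  have hu : ‖R x‖ ≤ C * σ * ‖x‖ := (R.le_opNorm x).trans (by gcongr)
  refine hS.norm_app_le hp0 hp1 hb (hR.1 x) (by positivity) (by positivity) ?_ ?_
  · refine hu.trans ?_
    gcongr
    linarith
  · rw [sub_eq_iff_eq_add.mp (hR.2.1 x)]
    calc ‖x + z • R x‖ ≤ ‖x‖ + ρ * ‖R x‖ := by
          refine (norm_add_le _ _).trans ?_
          rw [norm_smul, hz]
      _ ≤ 3 * ρ * σ * ‖x‖ + ρ * (C * σ * ‖x‖) := by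
          gcongr
          exact le_mul_of_one_le_left (norm_nonneg x) hσ1
      _ = (3 + C) * σ * ‖x‖ * ρ := by ring
      _ ≤ _ := by gcongr

/-- The indices of the eigenvalues which are far from the circle of radius `ρ`. -/
def farFrom (lam : ι → ℂ) (ρ : ℝ) : Set ι := {i | ‖lam i‖ ≤ ρ / 2 ∨ 2 * ρ ≤ ‖lam i‖}

lemma norm_farFrom_inv_le {ρ : ℝ} (hρ : 0 < ρ) (hz : ‖z‖ = ρ) (i : ι) :
    ‖(farFrom lam ρ).indicator (fun i => (lam i - z)⁻¹) i‖ ≤ 2 / ρ ∧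
      ‖lam i * (farFrom lam ρ).indicator (fun i => (lam i - z)⁻¹) i‖ ≤ 2 := by
  by_cases hi : i ∈ farFrom lam ρ
  · rw [Set.indicator_of_mem hi, norm_mul, norm_inv]
    have h1 := norm_sub_norm_le (lam i) z
    have h2 := norm_sub_norm_le z (lam i)
    rw [norm_sub_rev] at h2
    have h0 := norm_nonneg (lam i)
    have h3 : ρ / 2 ≤ ‖lam i - z‖ := by rcases hi with hi | hi <;> linarith
    have h4 : ‖lam i‖ ≤ 2 * ‖lam i - z‖ := by rcases hi with hi | hi <;> linarith
    have h5 : 0 < ‖lam i - z‖ := by linarith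
    refine ⟨(inv_anti₀ (by positivity) h3).trans (by rw [inv_div]), ?_⟩
    rwa [← div_eq_mul_inv, div_le_iff₀ h5]
  · rw [Set.indicator_of_notMem hi]
    simp only [norm_zero, mul_zero, Nat.ofNat_nonneg, and_true]
    positivity

lemma IsDiagonalIn.resolvent_coordProj (h : G.IsDiagonalIn e lam) (hR : G.IsResolventAt z R)
    {ρ : ℝ} (hρ : 0 < ρ) (hz : ‖z‖ = ρ) (x : H) :
    R (e.coordProj (farFrom lam ρ) x)
      = e.diag ((farFrom lam ρ).indicator fun i => (lam i - z)⁻¹) x := by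
  refine e.ext_inner fun i => ?_
  rw [h.inner_resolvent hR, e.inner_coordProj, e.inner_diag fun i => (norm_farFrom_inv_le hρ hz i).1]
  by_cases hi : i ∈ farFrom lam ρ <;> simp [hi]

lemma IsDiagonalIn.coordProj_resolvent (h : G.IsDiagonalIn e lam) (hR : G.IsResolventAt z R)
    {ρ : ℝ} (hρ : 0 < ρ) (hz : ‖z‖ = ρ) (x : H) :
    e.coordProj (farFrom lam ρ) (R x)
      = e.diag ((farFrom lam ρ).indicator fun i => (lam i - z)⁻¹) x := by
  refine e.ext_inner fun i => ?_
  rw [e.inner_coordProj, h.inner_resolvent hR, e.inner_diag fun i => (norm_farFrom_inv_le hρ hz i).1]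
  by_cases hi : i ∈ farFrom lam ρ <;> simp [hi]

lemma norm_resolvent_sub_le (hS : S.Subordinate G p b) (hp0 : 0 ≤ p) (hp1 : p < 1) (hb : 0 ≤ b)
    (hR₀ : G.IsResolventAt z R₀) (hR : (G.addOp S).IsResolventAt z R) {C ρ σ : ℝ} (hC : 0 ≤ C)
    (hρ : 1 ≤ ρ) (hσ : 0 ≤ σ) (hz : ‖z‖ = ρ) (hσ1 : 1 ≤ 3 * ρ * σ) (hR₀le : ‖R₀‖ ≤ C * σ)
    (hRle : ‖R‖ ≤ C * σ) :
    ‖R₀ - R‖ ≤ b * graphConst p b C * C * ρ ^ p * σ ^ 2 := by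
  have hK := graphConst_nonneg hp1 hb hC
  refine ContinuousLinearMap.opNorm_le_bound _ (by positivity) fun x => ?_
  rw [sub_apply, sub_eq_resolvent_app hR₀ hR]
  calc ‖R (S.app (R₀ x))‖ ≤ ‖R‖ * ‖S.app (R₀ x)‖ := R.le_opNorm _
    _ ≤ C * σ * (b * (graphConst p b C * σ * ‖x‖) * ρ ^ p) := by
        gcongr
        exact norm_app_base_resolvent_le hS hp0 hp1 hb hR₀ hC hρ hσ hz hσ1 hR₀le x
    _ = _ := by ring

lemma norm_resolvent_sub_mul_coordProj_le (hS : S.Subordinate G p b) (h : G.IsDiagonalIn e lam)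
    (hp0 : 0 ≤ p) (hp1 : p < 1) (hb : 0 ≤ b) (hR₀ : G.IsResolventAt z R₀)
    (hR : (G.addOp S).IsResolventAt z R) {C ρ σ : ℝ} (hC : 0 ≤ C) (hρ : 1 ≤ ρ) (hσ : 0 ≤ σ)
    (hz : ‖z‖ = ρ) (hRle : ‖R‖ ≤ C * σ) :
    ‖(R₀ - R) * e.coordProj (farFrom lam ρ)‖ ≤ 2 * b * C * ρ ^ (p - 1) * σ := by
  have hρ0 : 0 < ρ := by linarith
  refine ContinuousLinearMap.opNorm_le_bound _ (by positivity) fun x => ?_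
  rw [mul_apply_eq_comp, sub_apply, sub_eq_resolvent_app hR₀ hR,
    h.resolvent_coordProj hR₀ hρ0 hz]
  have h1 : (2 / ρ) ^ (1 - p) * 2 ^ p = 2 * ρ ^ (p - 1) := by
    rw [Real.div_rpow zero_le_two hρ0.le, div_mul_eq_mul_div, ← Real.rpow_add two_pos,
      sub_add_cancel, Real.rpow_one, div_eq_mul_inv, ← Real.rpow_neg hρ0.le, neg_sub]
  calc _ ≤ ‖R‖ * ‖S.app (e.diag ((farFrom lam ρ).indicator fun i => (lam i - z)⁻¹) x)‖ :=
        R.le_opNorm _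
    _ ≤ C * σ * (b * (2 / ρ) ^ (1 - p) * 2 ^ p * ‖x‖) := by
        gcongr
        exact hS.norm_app_diag_le h hp0 hp1 hb (by positivity) zero_le_two
          (fun i => (norm_farFrom_inv_le hρ0 hz i).1) (fun i => (norm_farFrom_inv_le hρ0 hz i).2) x
    _ = _ := by
        rw [mul_assoc b, h1]
        ring

lemma norm_coordProj_mul_resolvent_sub_le (hS : S.Subordinate G p b) (h : G.IsDiagonalIn e lam)
    (hp0 : 0 ≤ p) (hp1 : p < 1) (hb : 0 ≤ b) (hR₀ : G.IsResolventAt z R₀)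
    (hR : (G.addOp S).IsResolventAt z R) {C ρ σ : ℝ} (hC : 0 ≤ C) (hρ : 1 ≤ ρ) (hσ : 0 ≤ σ)
    (hz : ‖z‖ = ρ) (hσ1 : 1 ≤ 3 * ρ * σ) (hRle : ‖R‖ ≤ C * σ) :
    ‖e.coordProj (farFrom lam ρ) * (R₀ - R)‖ ≤ 2 * b * graphConst p b C * ρ ^ (p - 1) * σ := by
  have hρ0 : 0 < ρ := by linarith
  have hK := graphConst_nonneg hp1 hb hC
  refine ContinuousLinearMap.opNorm_le_bound _ (by positivity) fun x => ?_
  rw [mul_apply_eq_comp, sub_apply, sub_eq_resolvent_app' hR₀ hR,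
    h.coordProj_resolvent hR₀ hρ0 hz]
  calc _ ≤ 2 / ρ * ‖S.app (R x)‖ :=
        e.norm_diag_apply_le (by positivity) (fun i => (norm_farFrom_inv_le hρ0 hz i).1) _
    _ ≤ 2 / ρ * (b * (graphConst p b C * σ * ‖x‖) * ρ ^ p) := by
        gcongr
        exact norm_app_perturbed_resolvent_le hS hp0 hp1 hb hR hC hρ hσ hz hσ1 hRle x
    _ = _ := by
        rw [Real.rpow_sub_one hρ0.ne']
        ring

end Op

lemma norm_circleIntegral_le_integral {E : Type*} [NormedAddCommGroup E] [NormedSpace ℂ E]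
    {f : ℂ → E} {w : ℂ → ℝ} {ρ : ℝ} (hρ : 0 ≤ ρ) (hw : Continuous w)
    (h : ∀ z, ‖z‖ = ρ → ‖f z‖ ≤ w z) :
    ‖∮ z in C(0, ρ), f z‖ ≤ ρ * ∫ φ in (0 : ℝ)..2 * Real.pi, w (circleMap 0 ρ φ) := by
  rw [← intervalIntegral.integral_const_mul]
  refine intervalIntegral.norm_integral_le_of_norm_le (by positivity) (MeasureTheory.ae_of_all _ fun φ _ => ?_)
    ((continuous_const.mul (hw.comp (continuous_circleMap 0 ρ))).intervalIntegrable _ _)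
  rw [norm_smul, deriv_circleMap, norm_mul, norm_I, mul_one, norm_circleMap_zero,
    abs_of_nonneg hρ]
  gcongr
  exact h _ (by rw [norm_circleMap_zero, abs_of_nonneg hρ])

lemma ContinuousLinearMap.circleIntegral_comp_comm {E F : Type*} [NormedAddCommGroup E]
    [NormedSpace ℂ E] [CompleteSpace E] [NormedAddCommGroup F] [NormedSpace ℂ F] [CompleteSpace F]
    (L : E →L[ℂ] F) {f : ℂ → E} {c : ℂ} {r : ℝ} (hf : CircleIntegrable f c r) :
    ∮ z in C(c, r), L (f z) = L (∮ z in C(c, r), f z) := by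
  simp only [circleIntegral]
  rw [← L.intervalIntegral_comp_comm hf.out]
  simp only [map_smul]

namespace Op

variable {ι H : Type*} [NormedAddCommGroup H] [InnerProductSpace ℂ H] [CompleteSpace H]
  {T G S : Op H} {e : HilbertBasis ι ℂ H} {lam : ι → ℂ} {p b ρ : ℝ}

/-- The Riesz projection of `T` for the disc of radius `ρ` around the origin. -/
def rieszProj (T : Op H) (ρ : ℝ) : H →L[ℂ] H :=
  -(2 * Real.pi * I : ℂ)⁻¹ • ∮ z in C(0, ρ), T.res z

lemma circleIntegrable_res (hρ : 0 ≤ ρ) (hT : ∀ z, ‖z‖ = ρ → z ∈ T.resolventSet) :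
    CircleIntegrable T.res 0 ρ :=
  ContinuousOn.circleIntegrable hρ fun z hz =>
    (differentiableAt_res (hT z (mem_sphere_zero_iff_norm.mp hz))).continuousAt.continuousWithinAt

lemma circleIntegral_inv_sub {l : ℂ} (hρ : 0 < ρ) (hl : ‖l‖ ≠ ρ) :
    ∮ z in C(0, ρ), (l - z)⁻¹ = if ‖l‖ < ρ then -(2 * Real.pi * I : ℂ) else 0 := by
  split_ifs with h
  · rw [← circleIntegral.integral_sub_inv_of_mem_ball (mem_ball_zero_iff.mpr h), ← neg_one_mul,
      ← circleIntegral.integral_const_mul]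
    congr 1
    funext z
    rw [neg_one_mul, ← inv_neg, neg_sub]
  · have hlt : ρ < ‖l‖ := lt_of_le_of_ne (not_lt.mp h) hl.symm
    have hne : ∀ z ∈ closedBall (0 : ℂ) ρ, l - z ≠ 0 := fun z hz h0 => by
      rw [mem_closedBall_zero_iff, ← sub_eq_zero.mp h0] at hz
      linarith
    refine circleIntegral_eq_zero_of_differentiable_on_off_countable hρ.le Set.countable_empty
      ((by fun_prop : ContinuousOn (fun z => l - z) _).inv₀ hne) fun z hz => ?_
    exact (by fun_prop : DifferentiableAt ℂ (fun z => l - z) z).fun_inv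
      (hne z (ball_subset_closedBall hz.1))

lemma IsDiagonalIn.rieszProj_eq (h : G.IsDiagonalIn e lam) (hρ : 0 < ρ)
    (hG : ∀ z, ‖z‖ = ρ → z ∈ G.resolventSet) :
    G.rieszProj ρ = e.coordProj {i | ‖lam i‖ < ρ} := by
  refine ContinuousLinearMap.ext fun x => e.ext_inner fun i => ?_
  rw [e.inner_coordProj]
  let L : (H →L[ℂ] H) →L[ℂ] ℂ := (innerSL ℂ (e i)) ∘L (ContinuousLinearMap.apply ℂ H x)
  have hL : ∀ B : H →L[ℂ] H, L B = ⟪e i, B x⟫_ℂ := fun B => rfl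
  have hl : ‖lam i‖ ≠ ρ := fun hl => h.mem_spec i (hG _ hl)
  have h1 : ∮ z in C(0, ρ), L (G.res z) = (∮ z in C(0, ρ), (lam i - z)⁻¹) * ⟪e i, x⟫_ℂ := by
    rw [← smul_eq_mul, ← circleIntegral.integral_smul_const]
    refine circleIntegral.integral_congr hρ.le fun z hz => ?_
    rw [hL, h.inner_resolvent (isResolventAt_res (hG z (mem_sphere_zero_iff_norm.mp hz))),
      smul_eq_mul]
  rw [← hL, rieszProj, map_smul, ← L.circleIntegral_comp_comm (circleIntegrable_res hρ.le hG), h1,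
    circleIntegral_inv_sub hρ hl, smul_eq_mul]
  have := two_pi_I_ne_zero
  by_cases hi : ‖lam i‖ < ρ
  · rw [if_pos hi, Set.indicator_of_mem (by exact hi), Pi.one_apply]
    field_simp
  · rw [if_neg hi, Set.indicator_of_notMem (by exact hi)]
    ring

/-- The resolvent bound which holds on suitable large circles. -/
def HasRayBound {J : Type*} [Fintype J] (T : Op H) (ω : J → ℂ) (p C ρ : ℝ) : Prop :=
  ∀ z, ‖z‖ = ρ → z ∈ T.resolventSet ∧ ‖T.res z‖ ≤ C * rayWeight ω p ρ z

lemma rieszProj_sub (hρ : 0 ≤ ρ) (hG : ∀ z, ‖z‖ = ρ → z ∈ G.resolventSet)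
    (hT : ∀ z, ‖z‖ = ρ → z ∈ T.resolventSet) :
    T.rieszProj ρ - G.rieszProj ρ
      = (2 * Real.pi * I : ℂ)⁻¹ • ∮ z in C(0, ρ), (G.res z - T.res z) := by
  rw [circleIntegral.integral_sub (circleIntegrable_res hρ hG) (circleIntegrable_res hρ hT),
    rieszProj, rieszProj, neg_smul, neg_smul, smul_sub]
  abel

lemma norm_two_pi_I_inv_smul_le {E : Type*} [NormedAddCommGroup E] [NormedSpace ℂ E] (x : E) :
    ‖(2 * Real.pi * I : ℂ)⁻¹ • x‖ ≤ ‖x‖ := by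
  rw [norm_smul, norm_inv]
  refine mul_le_of_le_one_left (norm_nonneg x) (inv_le_one_of_one_le₀ ?_)
  rw [norm_mul, norm_mul, norm_I, norm_real, mul_one, Real.norm_of_nonneg Real.pi_pos.le,
    Complex.norm_ofNat]
  linarith [Real.pi_gt_three]

/-- The Riesz projections for suitable large circles of the perturbed and of the diagonal operator
are uniformly close, and nearly agree far from the circle. -/
theorem exists_norm_rieszProj_sub_le {J : Type*} [Fintype J] [Nonempty J] {ω : J → ℂ}
    (hS : S.Subordinate G p b) (h : G.IsDiagonalIn e lam) (hp0 : 0 ≤ p) (hp1 : p < 1)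
    (hb : 0 ≤ b) (hω : ∀ j, ‖ω j‖ = 1) {C : ℝ} (hC : 0 ≤ C) :
    ∃ K : ℝ, 0 ≤ K ∧ ∀ ρ : ℝ, 1 ≤ ρ → G.HasRayBound ω p C ρ → (G.addOp S).HasRayBound ω p C ρ →
      ‖(G.addOp S).rieszProj ρ - G.rieszProj ρ‖ ≤ K ∧
      ‖((G.addOp S).rieszProj ρ - G.rieszProj ρ) * e.coordProj (farFrom lam ρ)‖
        ≤ K * ρ ^ (-(1 - p) / 2) ∧
      ‖e.coordProj (farFrom lam ρ) * ((G.addOp S).rieszProj ρ - G.rieszProj ρ)‖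
        ≤ K * ρ ^ (-(1 - p) / 2) := by
  set M := graphConst p b C with hM
  have hM0 : 0 ≤ M := graphConst_nonneg hp1 hb hC
  set N : ℝ := (Fintype.card J : ℝ) with hN
  have hpi := Real.pi_pos
  set K1 := b * M * C * (4 * N ^ 2) with hK1
  set K2 := 2 * b * C * (Real.pi + 2 * N ^ 2) with hK2
  set K3 := 2 * b * M * (Real.pi + 2 * N ^ 2) with hK3
  have hK10 : 0 ≤ K1 := by positivity
  have hK20 : 0 ≤ K2 := by positivity
  have hK30 : 0 ≤ K3 := by positivity
  refine ⟨K1 + K2 + K3, by positivity, fun ρ hρ hG hT => ?_⟩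
  have hρ0 : 0 < ρ := by linarith
  have hGm := fun z hz => (hG z hz).1
  have hTm := fun z hz => (hT z hz).1
  have hwc : Continuous (rayWeight ω p ρ) := continuous_rayWeight hρ0
  have hσ := fun z => rayWeight_nonneg (ω := ω) (p := p) hρ0 z
  have hσ1 := fun z hz => one_le_mul_rayWeight (z := z) hω hp1 hρ hz
  have hinteg : CircleIntegrable (fun z => G.res z - (G.addOp S).res z) 0 ρ :=
    (circleIntegrable_res hρ0.le hGm).sub (circleIntegrable_res hρ0.le hTm)
  have hexp : ρ * (ρ ^ (p - 1) * ρ ^ (-(1 + p) / 2)) = ρ ^ (-(1 - p) / 2) := by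
    rw [← Real.rpow_add hρ0, ← Real.rpow_one_add' hρ0.le]
    · congr 1
      ring
    · linarith
  rw [rieszProj_sub hρ0.le hGm hTm]
  set E := e.coordProj (farFrom lam ρ) with hE
  have key : ∀ k : ℝ, 0 ≤ k → k ≤ K1 + K2 + K3 → k * ρ ^ (-(1 - p) / 2)
      ≤ (K1 + K2 + K3) * ρ ^ (-(1 - p) / 2) := fun k _ hk => by gcongr
  refine ⟨?_, ?_, ?_⟩
  · refine (norm_two_pi_I_inv_smul_le _).trans ?_
    refine (norm_circleIntegral_le_integral hρ0.le
      (w := fun z => b * M * C * ρ ^ p * rayWeight ω p ρ z ^ 2) (by fun_prop) fun z hz => ?_).trans ?_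
    · exact norm_resolvent_sub_le hS hp0 hp1 hb (isResolventAt_res (hGm z hz))
        (isResolventAt_res (hTm z hz)) hC hρ (hσ z) hz (hσ1 z hz) (hG z hz).2 (hT z hz).2
    · rw [intervalIntegral.integral_const_mul]
      calc ρ * (b * M * C * ρ ^ p * ∫ φ in (0 : ℝ)..2 * Real.pi,
            rayWeight ω p ρ (circleMap 0 ρ φ) ^ 2)
          ≤ ρ * (b * M * C * ρ ^ p * (4 * N ^ 2 * (ρ ^ (1 + p))⁻¹)) := by
            gcongr
            exact integral_rayWeight_sq_le hω hρ0
        _ = K1 := by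
            rw [Real.rpow_add hρ0, Real.rpow_one, hK1]
            have : ρ ^ p ≠ 0 := by positivity
            field_simp
        _ ≤ K1 + K2 + K3 := by linarith
  · have h1 := ((ContinuousLinearMap.mul ℂ (H →L[ℂ] H)).flip E).circleIntegral_comp_comm hinteg
    simp only [ContinuousLinearMap.flip_apply, ContinuousLinearMap.mul_apply'] at h1
    rw [smul_mul_assoc, ← h1]
    refine (norm_two_pi_I_inv_smul_le _).trans ?_
    refine (norm_circleIntegral_le_integral hρ0.le
      (w := fun z => 2 * b * C * ρ ^ (p - 1) * rayWeight ω p ρ z) (by fun_prop) fun z hz => ?_).trans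
      (le_trans ?_ (key K2 hK20 (by linarith)))
    · exact norm_resolvent_sub_mul_coordProj_le hS h hp0 hp1 hb (isResolventAt_res (hGm z hz))
        (isResolventAt_res (hTm z hz)) hC hρ (hσ z) hz (hT z hz).2
    · rw [intervalIntegral.integral_const_mul, ← hexp]
      calc ρ * (2 * b * C * ρ ^ (p - 1) * ∫ φ in (0 : ℝ)..2 * Real.pi,
            rayWeight ω p ρ (circleMap 0 ρ φ))
          ≤ ρ * (2 * b * C * ρ ^ (p - 1) * ((Real.pi + 2 * N ^ 2) * ρ ^ (-(1 + p) / 2))) := by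
            gcongr
            exact integral_rayWeight_le hω hρ0
        _ = _ := by ring
  · have h1 := (ContinuousLinearMap.mul ℂ (H →L[ℂ] H) E).circleIntegral_comp_comm hinteg
    simp only [ContinuousLinearMap.mul_apply'] at h1
    rw [mul_smul_comm, ← h1]
    refine (norm_two_pi_I_inv_smul_le _).trans ?_
    refine (norm_circleIntegral_le_integral hρ0.le
      (w := fun z => 2 * b * M * ρ ^ (p - 1) * rayWeight ω p ρ z) (by fun_prop) fun z hz => ?_).trans
      (le_trans ?_ (key K3 hK30 (by linarith)))
    · exact norm_coordProj_mul_resolvent_sub_le hS h hp0 hp1 hb (isResolventAt_res (hGm z hz))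
        (isResolventAt_res (hTm z hz)) hC hρ (hσ z) hz (hσ1 z hz) (hT z hz).2
    · rw [intervalIntegral.integral_const_mul, ← hexp]
      calc ρ * (2 * b * M * ρ ^ (p - 1) * ∫ φ in (0 : ℝ)..2 * Real.pi,
            rayWeight ω p ρ (circleMap 0 ρ φ))
          ≤ ρ * (2 * b * M * ρ ^ (p - 1) * ((Real.pi + 2 * N ^ 2) * ρ ^ (-(1 + p) / 2))) := by
            gcongr
            exact integral_rayWeight_le hω hρ0
        _ = _ := by ring

end Op

namespace Op

variable {ι H : Type*} [NormedAddCommGroup H] [InnerProductSpace ℂ H]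
  {T : Op H} {z w : ℂ} {R R' : H →L[ℂ] H}

lemma IsResolventAt.commute (hR : T.IsResolventAt z R) (hR' : T.IsResolventAt w R') :
    Commute R R' := by
  by_cases hzw : z = w
  · subst hzw
    rw [hR.unique hR']
  · have h1 := hR.sub_eq hR'
    have h2 := hR'.sub_eq hR
    have h3 : (z - w) • (R * R') = (z - w) • (R' * R) := by
      rw [← h1, ← neg_sub R' R, h2, ← neg_smul, neg_sub]
    exact smul_right_injective _ (sub_ne_zero.mpr hzw) h3

/-- A finite-dimensional subspace which is invariant under a resolvent is invariant under the
operator. -/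
lemma IsResolventAt.invariant_of_finiteDimensional (hR : T.IsResolventAt z R) (V : Submodule ℂ H)
    [FiniteDimensional ℂ V] (hV : ∀ x ∈ V, R x ∈ V) :
    (V : Set H) ⊆ (T.dom : Set H) ∧ ∀ x ∈ V, T.app x ∈ V := by
  have hsurj : ∀ x ∈ V, ∃ y ∈ V, R y = x := by
    have hinj : Function.Injective ((R : H →ₗ[ℂ] H).restrict hV) := fun x y hxy =>
      Subtype.ext (hR.injective (congrArg Subtype.val hxy))
    intro x hx
    obtain ⟨y, hy⟩ := LinearMap.injective_iff_surjective.mp hinj ⟨x, hx⟩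
    exact ⟨y, y.2, congrArg Subtype.val hy⟩
  refine ⟨fun x hx => ?_, fun x hx => ?_⟩
  · obtain ⟨y, -, rfl⟩ := hsurj x hx
    exact hR.1 y
  · obtain ⟨y, hy, rfl⟩ := hsurj x hx
    rw [sub_eq_iff_eq_add.mp (hR.2.1 y)]
    exact V.add_mem hy (V.smul_mem z (hV y hy))

/-- An operator which is close to a coordinate projection of finite rank, outside of finitely many
coordinates, has finite-dimensional range if it is idempotent. -/
lemma finiteDimensional_range_of_close {e : HilbertBasis ι ℂ H} {lam : ι → ℂ} {ρ : ℝ}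
    (hfin : {i | ‖lam i‖ ≤ 2 * ρ}.Finite) (hρ : 0 < ρ) {P : H →L[ℂ] H} (hP : P * P = P)
    (hclose : ‖e.coordProj (farFrom lam ρ) * (P - e.coordProj {i | ‖lam i‖ < ρ})‖ < 1) :
    FiniteDimensional ℂ (LinearMap.range (P : H →ₗ[ℂ] H)) := by
  set A := P - e.coordProj {i | ‖lam i‖ < ρ} with hA
  have := hfin.to_subtype
  let L : LinearMap.range (P : H →ₗ[ℂ] H) →ₗ[ℂ] ({i | ‖lam i‖ ≤ 2 * ρ} → ℂ) :=
    (LinearMap.pi fun i => (innerSL ℂ (e i)).toLinearMap) ∘ₗ Submodule.subtype _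
  refine Module.Finite.of_injective L ((injective_iff_map_eq_zero L).mpr ?_)
  rintro ⟨-, x, rfl⟩ hL
  refine Subtype.ext ?_
  set y := P x with hy
  change y = 0
  have hPy : P y = y := congrArg (fun B : H →L[ℂ] H => B x) hP
  have hcoord : ∀ i, ‖lam i‖ ≤ 2 * ρ → ⟪e i, y⟫_ℂ = 0 := fun i hi => congrFun hL ⟨i, hi⟩
  have hyA : y = e.coordProj {i | 2 * ρ < ‖lam i‖} ((e.coordProj (farFrom lam ρ) * A) y) := by
    refine e.ext_inner fun i => ?_
    rw [e.inner_coordProj, mul_apply_eq_comp, e.inner_coordProj, hA, sub_apply, hPy,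
      inner_sub_right, e.inner_coordProj]
    by_cases hi : ‖lam i‖ ≤ 2 * ρ
    · rw [hcoord i hi, Set.indicator_of_notMem (by simpa using hi), zero_mul]
    · have h1 : i ∈ farFrom lam ρ := Or.inr (not_le.mp hi).le
      have h2 : ¬ ‖lam i‖ < ρ := by
        rw [not_le] at hi
        linarith
      simp [not_le.mp hi, h1, h2]
  by_contra hne
  have hpos : 0 < ‖y‖ := norm_pos_iff.mpr hne
  have h3 : ‖y‖ ≤ ‖e.coordProj (farFrom lam ρ) * A‖ * ‖y‖ := by
    calc ‖y‖ = ‖e.coordProj {i | 2 * ρ < ‖lam i‖} ((e.coordProj (farFrom lam ρ) * A) y)‖ := by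
          rw [← hyA]
      _ ≤ 1 * ‖(e.coordProj (farFrom lam ρ) * A) y‖ := by
          refine (ContinuousLinearMap.le_opNorm _ _).trans ?_
          gcongr
          exact e.norm_coordProj_le _
      _ ≤ _ := by
          rw [one_mul]
          exact ContinuousLinearMap.le_opNorm _ _
  have h4 := mul_lt_mul_of_pos_right hclose hpos
  linarith

variable [CompleteSpace H]

lemma mul_rieszProj {ρ : ℝ} (hρ : 0 ≤ ρ) (hT : ∀ z, ‖z‖ = ρ → z ∈ T.resolventSet)
    (B : H →L[ℂ] H) :
    B * T.rieszProj ρ = -(2 * Real.pi * I : ℂ)⁻¹ • ∮ z in C(0, ρ), B * T.res z := by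
  have h1 := (ContinuousLinearMap.mul ℂ (H →L[ℂ] H) B).circleIntegral_comp_comm
    (circleIntegrable_res hρ hT)
  simp only [ContinuousLinearMap.mul_apply'] at h1
  rw [h1, rieszProj, mul_smul_comm]

lemma rieszProj_mul {ρ : ℝ} (hρ : 0 ≤ ρ) (hT : ∀ z, ‖z‖ = ρ → z ∈ T.resolventSet)
    (B : H →L[ℂ] H) :
    T.rieszProj ρ * B = -(2 * Real.pi * I : ℂ)⁻¹ • ∮ z in C(0, ρ), T.res z * B := by
  have h1 := ((ContinuousLinearMap.mul ℂ (H →L[ℂ] H)).flip B).circleIntegral_comp_comm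
    (circleIntegrable_res hρ hT)
  simp only [ContinuousLinearMap.flip_apply, ContinuousLinearMap.mul_apply'] at h1
  rw [h1, rieszProj, smul_mul_assoc]

lemma commute_rieszProj {ρ : ℝ} (hρ : 0 ≤ ρ) (hT : ∀ z, ‖z‖ = ρ → z ∈ T.resolventSet)
    (hR : T.IsResolventAt z R) : Commute R (T.rieszProj ρ) := by
  rw [Commute, SemiconjBy, mul_rieszProj hρ hT, rieszProj_mul hρ hT]
  congr 1
  exact circleIntegral.integral_congr hρ fun w hw =>
    hR.commute (isResolventAt_res (hT w (mem_sphere_zero_iff_norm.mp hw)))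

lemma resolvent_mul_rieszProj {s : ℝ} (hs : 0 < s) (hT : ∀ z, ‖z‖ = s → z ∈ T.resolventSet)
    (hz : ‖z‖ < s) (hR : T.IsResolventAt z R) :
    R * T.rieszProj s
      = R - (2 * Real.pi * I : ℂ)⁻¹ • ∮ w in C(0, s), (w - z)⁻¹ • T.res w := by
  have hne : ∀ w ∈ sphere (0 : ℂ) s, w - z ≠ 0 := fun w hw h0 => by
    rw [mem_sphere_zero_iff_norm, sub_eq_zero.mp h0] at hw
    linarith
  have hinv : ContinuousOn (fun w : ℂ => (w - z)⁻¹) (sphere 0 s) :=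
    (by fun_prop : ContinuousOn (fun w : ℂ => w - z) _).inv₀ hne
  have hres : ContinuousOn T.res (sphere 0 s) := fun w hw =>
    (differentiableAt_res (hT w (mem_sphere_zero_iff_norm.mp hw))).continuousAt.continuousWithinAt
  have h1 : ∮ w in C(0, s), R * T.res w
      = ∮ w in C(0, s), ((w - z)⁻¹ • T.res w - (w - z)⁻¹ • R) := by
    refine circleIntegral.integral_congr hs.le fun w hw => ?_
    have h2 := (isResolventAt_res (hT w (mem_sphere_zero_iff_norm.mp hw))).sub_eq hR
    rw [← smul_sub, h2, inv_smul_smul₀ (hne w hw)]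
  have h3 : ∮ w in C(0, s), (w - z)⁻¹ • R = (2 * Real.pi * I : ℂ) • R := by
    rw [circleIntegral.integral_smul_const,
      circleIntegral.integral_sub_inv_of_mem_ball (mem_ball_zero_iff.mpr hz)]
  have h4 : CircleIntegrable (fun w => (w - z)⁻¹ • T.res w) 0 s :=
    (hinv.smul hres).circleIntegrable hs.le
  have h5 : CircleIntegrable (fun w => (w - z)⁻¹ • R) 0 s :=
    (hinv.smul continuousOn_const).circleIntegrable hs.le
  rw [mul_rieszProj hs.le hT, h1, circleIntegral.integral_sub h4 h5, h3, smul_sub, neg_smul, neg_smul,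
    inv_smul_smul₀ two_pi_I_ne_zero]
  abel

lemma circleIntegral_cauchy_eq_zero {E : Type*} [NormedAddCommGroup E] [NormedSpace ℂ E]
    [CompleteSpace E] {f : ℂ → E} {r s : ℝ} (hr : 0 ≤ r) (hrs : r < s)
    (hf : CircleIntegrable f 0 s) :
    ∮ z in C(0, r), ((2 * Real.pi * I : ℂ)⁻¹ • ∮ w in C(0, s), (w - z)⁻¹ • f w) = 0 := by
  lift s to NNReal using hr.trans hrs.le
  have h1 := (hasFPowerSeriesOn_cauchy_integral hf (by exact_mod_cast hr.trans_lt hrs)).differentiableOn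
  have hsub : closedBall (0 : ℂ) r ⊆ Metric.eball 0 s := by
    rw [Metric.eball_coe]
    exact closedBall_subset_ball hrs
  refine circleIntegral_eq_zero_of_differentiable_on_off_countable hr Set.countable_empty
    (h1.continuousOn.mono hsub) fun z hz => ?_
  exact h1.differentiableAt (Metric.isOpen_eball.mem_nhds (hsub (ball_subset_closedBall hz.1)))

lemma rieszProj_mul_rieszProj_of_lt {r s : ℝ} (hr : 0 ≤ r) (hrs : r < s)
    (hTr : ∀ z, ‖z‖ = r → z ∈ T.resolventSet) (hTs : ∀ z, ‖z‖ = s → z ∈ T.resolventSet) :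
    T.rieszProj r * T.rieszProj s = T.rieszProj r := by
  have hs : 0 < s := hr.trans_lt hrs
  have hinteg := circleIntegrable_res hs.le hTs
  have hF : ∮ z in C(0, r), T.res z * T.rieszProj s = ∮ z in C(0, r), T.res z := by
    rw [← sub_eq_zero, ← circleIntegral.integral_sub _ (circleIntegrable_res hr hTr)]
    · rw [← neg_eq_zero, ← circleIntegral_cauchy_eq_zero hr hrs hinteg, ← neg_one_smul ℂ,
        ← circleIntegral.integral_smul]
      refine circleIntegral.integral_congr hr fun z hz => ?_
      rw [mem_sphere_zero_iff_norm] at hz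
      rw [resolvent_mul_rieszProj hs hTs (by rwa [hz]) (isResolventAt_res (hTr z hz)), neg_one_smul]
      abel
    · refine ContinuousOn.circleIntegrable hr (ContinuousOn.mul (fun w hw => ?_) continuousOn_const)
      exact (differentiableAt_res
        (hTr w (mem_sphere_zero_iff_norm.mp hw))).continuousAt.continuousWithinAt
  rw [rieszProj_mul hr hTr, hF, rieszProj]

lemma commute_rieszProj_rieszProj {r s : ℝ} (hr : 0 ≤ r) (hs : 0 ≤ s)
    (hTr : ∀ z, ‖z‖ = r → z ∈ T.resolventSet) (hTs : ∀ z, ‖z‖ = s → z ∈ T.resolventSet) :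
    Commute (T.rieszProj r) (T.rieszProj s) := by
  rw [Commute, SemiconjBy, mul_rieszProj hs hTs, rieszProj_mul hs hTs]
  congr 1
  exact circleIntegral.integral_congr hs fun w hw =>
    (commute_rieszProj hr hTr
      (isResolventAt_res (hTs w (mem_sphere_zero_iff_norm.mp hw)))).symm

lemma exists_rieszProj_eq {r : ℝ} (hr : 0 < r) (hTr : ∀ z, ‖z‖ = r → z ∈ T.resolventSet) :
    ∃ s, r < s ∧ (∀ z, ‖z‖ = s → z ∈ T.resolventSet) ∧ T.rieszProj s = T.rieszProj r := by
  obtain ⟨δ, hδ, hsub⟩ := (isCompact_sphere (0 : ℂ) r).exists_thickening_subset_open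
    (isOpen_resolventSet T) fun z hz => hTr z (mem_sphere_zero_iff_norm.mp hz)
  have hann : ∀ z : ℂ, r ≤ ‖z‖ → ‖z‖ ≤ r + δ / 2 → z ∈ T.resolventSet := by
    intro z h1 h2
    have hz : 0 < ‖z‖ := hr.trans_le h1
    refine hsub (mem_thickening_iff.mpr ⟨((r / ‖z‖ : ℝ) : ℂ) * z, ?_, ?_⟩)
    · rw [mem_sphere_zero_iff_norm, norm_mul, norm_real, Real.norm_of_nonneg (by positivity),
        div_mul_cancel₀ _ hz.ne']
    · have h3 : z - ((r / ‖z‖ : ℝ) : ℂ) * z = ((1 - r / ‖z‖ : ℝ) : ℂ) * z := by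
        push_cast
        ring
      have h4 : 0 ≤ 1 - r / ‖z‖ := by
        rw [sub_nonneg, div_le_one hz]
        exact h1
      rw [dist_eq_norm, h3, norm_mul, norm_real, Real.norm_of_nonneg h4, sub_mul, one_mul,
        div_mul_cancel₀ _ hz.ne']
      linarith
  refine ⟨r + δ / 2, by linarith, fun z hz => hann z (by linarith) hz.le, ?_⟩
  rw [rieszProj, rieszProj, circleIntegral_eq_of_differentiable_on_annulus_off_countable hr
    (by linarith) Set.countable_empty]
  · intro z hz
    refine (differentiableAt_res (hann z ?_ ?_)).continuousAt.continuousWithinAt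
    · simpa using hz.2
    · simpa using hz.1
  · intro z hz
    refine differentiableAt_res (hann z ?_ ?_)
    · have := hz.1.2
      rw [mem_closedBall_zero_iff, not_le] at this
      exact this.le
    · have := hz.1.1
      rw [mem_ball_zero_iff] at this
      exact this.le

lemma rieszProj_mul_rieszProj {r s : ℝ} (hr : 0 < r) (hrs : r ≤ s)
    (hTr : ∀ z, ‖z‖ = r → z ∈ T.resolventSet) (hTs : ∀ z, ‖z‖ = s → z ∈ T.resolventSet) :
    T.rieszProj r * T.rieszProj s = T.rieszProj r := by
  rcases hrs.eq_or_lt with rfl | hrs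
  · obtain ⟨s, hs, hTs, heq⟩ := exists_rieszProj_eq hr hTr
    nth_rewrite 2 [← heq]
    exact rieszProj_mul_rieszProj_of_lt hr.le hs hTr hTs
  · exact rieszProj_mul_rieszProj_of_lt hr.le hrs hTr hTs

end Op

section AbstractRieszBasis

variable {H : Type*} [NormedAddCommGroup H] [InnerProductSpace ℂ H] [CompleteSpace H]

/-- Mutually orthogonal idempotents with square summable bounds for themselves and their adjoints
give Riesz basis estimates for their ranges. -/
lemma rieszBasis_bounds_of_bessel {Λ : Type*} {P : Λ → H →L[ℂ] H}
    (hidem : ∀ k, P k * P k = P k) (hortho : ∀ k l, k ≠ l → P k * P l = 0) {C : ℝ} (hC : 1 ≤ C)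
    (hbes : ∀ (F : Finset Λ) x, ∑ k ∈ F, ‖P k x‖ ^ 2 ≤ C * ‖x‖ ^ 2)
    (hbes' : ∀ (F : Finset Λ) x, ∑ k ∈ F, ‖(P k).adjoint x‖ ^ 2 ≤ C * ‖x‖ ^ 2)
    (F : Finset Λ) (x : Λ → H) (hx : ∀ k ∈ F, x k ∈ LinearMap.range (P k : H →ₗ[ℂ] H)) :
    C⁻¹ * ∑ k ∈ F, ‖x k‖ ^ 2 ≤ ‖∑ k ∈ F, x k‖ ^ 2 ∧
      ‖∑ k ∈ F, x k‖ ^ 2 ≤ C * ∑ k ∈ F, ‖x k‖ ^ 2 := by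
  classical
  have hC0 : 0 < C := by linarith
  have hfix : ∀ k ∈ F, P k (x k) = x k := by
    intro k hk
    obtain ⟨y, hy⟩ := hx k hk
    rw [← hy]
    exact congrArg (fun B : H →L[ℂ] H => B y) (hidem k)
  have hkill : ∀ k, ∀ l ∈ F, k ≠ l → P k (x l) = 0 := by
    intro k l hl hkl
    obtain ⟨y, hy⟩ := hx l hl
    rw [← hy]
    exact congrArg (fun B : H →L[ℂ] H => B y) (hortho k l hkl)
  set s := ∑ k ∈ F, x k with hs
  have hPs : ∀ k ∈ F, P k s = x k := by
    intro k hk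
    rw [hs, map_sum, Finset.sum_eq_single_of_mem k hk, hfix k hk]
    exact fun l hl hlk => hkill k l hl hlk.symm
  constructor
  · rw [inv_mul_le_iff₀ hC0]
    calc ∑ k ∈ F, ‖x k‖ ^ 2 = ∑ k ∈ F, ‖P k s‖ ^ 2 :=
          Finset.sum_congr rfl fun k hk => by rw [hPs k hk]
      _ ≤ _ := hbes F s
  · have h1 : ‖s‖ ^ 2 = ∑ k ∈ F, (⟪x k, (P k).adjoint s⟫_ℂ).re := by
      have h2 : ∑ k ∈ F, ⟪x k, (P k).adjoint s⟫_ℂ = ⟪s, s⟫_ℂ := by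
        nth_rewrite 2 [hs]
        rw [sum_inner]
        refine Finset.sum_congr rfl fun k hk => ?_
        rw [ContinuousLinearMap.adjoint_inner_right, hfix k hk]
      rw [← re_sum, h2]
      exact (inner_self_eq_norm_sq (𝕜 := ℂ) s).symm
    have h3 : ∀ k ∈ F, (⟪x k, (P k).adjoint s⟫_ℂ).re
        ≤ C / 2 * ‖x k‖ ^ 2 + (2 * C)⁻¹ * ‖(P k).adjoint s‖ ^ 2 := by
      intro k _
      refine ((re_le_norm _).trans (norm_inner_le_norm _ _)).trans ?_
      have h4 : C / 2 * ‖x k‖ ^ 2 + (2 * C)⁻¹ * ‖(P k).adjoint s‖ ^ 2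
          - ‖x k‖ * ‖(P k).adjoint s‖ = (2 * C)⁻¹ * (C * ‖x k‖ - ‖(P k).adjoint s‖) ^ 2 := by
        field_simp
        ring
      have h5 : 0 ≤ (2 * C)⁻¹ * (C * ‖x k‖ - ‖(P k).adjoint s‖) ^ 2 := by positivity
      linarith
    have h6 : ‖s‖ ^ 2 ≤ C / 2 * ∑ k ∈ F, ‖x k‖ ^ 2 + (2 * C)⁻¹ * (C * ‖s‖ ^ 2) := by
      calc ‖s‖ ^ 2 ≤ ∑ k ∈ F, (C / 2 * ‖x k‖ ^ 2 + (2 * C)⁻¹ * ‖(P k).adjoint s‖ ^ 2) :=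
            h1.le.trans (Finset.sum_le_sum h3)
        _ = C / 2 * ∑ k ∈ F, ‖x k‖ ^ 2 + (2 * C)⁻¹ * ∑ k ∈ F, ‖(P k).adjoint s‖ ^ 2 := by
            rw [Finset.sum_add_distrib, Finset.mul_sum, Finset.mul_sum]
        _ ≤ _ := by
            gcongr
            exact hbes' F s
    have h7 : (2 * C)⁻¹ * (C * ‖s‖ ^ 2) = ‖s‖ ^ 2 / 2 := by field_simp
    linarith

end AbstractRieszBasis

namespace HilbertBasis

variable {ι H : Type*} [NormedAddCommGroup H] [InnerProductSpace ℂ H]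

lemma sum_norm_coordProj_sq_le (e : HilbertBasis ι ℂ H) {κ : Type*} {s : κ → Set ι}
    (hs : Pairwise fun k l => Disjoint (s k) (s l)) (F : Finset κ) (x : H) :
    ∑ k ∈ F, ‖e.coordProj (s k) x‖ ^ 2 ≤ ‖x‖ ^ 2 := by
  classical
  refine e.sum_norm_diag_sq_le F _ (fun i => ?_) x
  by_cases hi : ∃ k ∈ F, i ∈ s k
  · obtain ⟨k, hk, hik⟩ := hi
    rw [Finset.sum_eq_single_of_mem k hk, Set.indicator_of_mem hik]
    · simp
    · intro l _ hl
      rw [Set.indicator_of_notMem fun hil => Set.disjoint_left.mp (hs hl) hil hik]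
      simp
  · push Not at hi
    refine (Finset.sum_eq_zero fun k hk => ?_).le.trans zero_le_one
    rw [Set.indicator_of_notMem (hi k hk)]
    simp

lemma adjoint_coordProj [CompleteSpace H] (e : HilbertBasis ι ℂ H) (s : Set ι) :
    (e.coordProj s).adjoint = e.coordProj s := by
  refine ((ContinuousLinearMap.eq_adjoint_iff _ _).mpr fun x y => ?_).symm
  rw [coordProj, e.inner_diag_left (norm_indicator_one_le s)]
  congr 2
  refine congrArg e.diag (funext fun i => ?_)
  by_cases hi : i ∈ s <;> simp [hi]

end HilbertBasis

namespace Op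

variable {ι H : Type*} [NormedAddCommGroup H] [InnerProductSpace ℂ H]
  {e : HilbertBasis ι ℂ H} {lam : ι → ℂ} {ρ : ℕ → ℝ}

lemma four_mul_le_of_lt (hmono : Monotone ρ) (h4 : ∀ k, 4 * ρ k ≤ ρ (k + 1)) {j k : ℕ}
    (hjk : j < k) : 4 * ρ j ≤ ρ k := (h4 j).trans (hmono hjk)

lemma pairwise_disjoint_compl_farFrom (hmono : Monotone ρ) (h4 : ∀ k, 4 * ρ k ≤ ρ (k + 1)) :
    Pairwise fun j k => Disjoint (farFrom lam (ρ j))ᶜ (farFrom lam (ρ k))ᶜ := by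
  have key : ∀ j k, j < k → Disjoint (farFrom lam (ρ j))ᶜ (farFrom lam (ρ k))ᶜ := by
    intro j k hjk
    refine Set.disjoint_left.mpr fun i hi hi' => ?_
    have h1 := four_mul_le_of_lt hmono h4 hjk
    simp only [farFrom, Set.mem_compl_iff, Set.mem_ofPred_eq, not_or, not_le] at hi hi'
    linarith [hi.2, hi'.1]
  intro j k hjk
  rcases lt_or_gt_of_ne hjk with h | h
  · exact key j k h
  · exact (key k j h).symm

lemma pairwise_disjoint_band (hmono : Monotone ρ) :
    Pairwise fun j k => Disjoint {i | ρ j ≤ ‖lam i‖ ∧ ‖lam i‖ < ρ (j + 1)}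
      {i | ρ k ≤ ‖lam i‖ ∧ ‖lam i‖ < ρ (k + 1)} := by
  have key : ∀ j k, j < k → Disjoint {i | ρ j ≤ ‖lam i‖ ∧ ‖lam i‖ < ρ (j + 1)}
      {i | ρ k ≤ ‖lam i‖ ∧ ‖lam i‖ < ρ (k + 1)} := by
    intro j k hjk
    refine Set.disjoint_left.mpr fun i hi hi' => ?_
    have h1 : ρ (j + 1) ≤ ρ k := hmono hjk
    linarith [hi.2, hi'.1]
  intro j k hjk
  rcases lt_or_gt_of_ne hjk with h | h
  · exact key j k h
  · exact (key k j h).symm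

lemma coordProj_sub_eq_band (hmono : Monotone ρ) (k : ℕ) :
    e.coordProj {i | ‖lam i‖ < ρ (k + 1)} - e.coordProj {i | ‖lam i‖ < ρ k}
      = e.coordProj {i | ρ k ≤ ‖lam i‖ ∧ ‖lam i‖ < ρ (k + 1)} := by
  refine ContinuousLinearMap.ext fun x => e.ext_inner fun i => ?_
  have hk := hmono (Nat.le_succ k)
  rw [sub_apply, inner_sub_right, e.inner_coordProj, e.inner_coordProj, e.inner_coordProj]
  by_cases h1 : ‖lam i‖ < ρ k
  · have h2 : ‖lam i‖ < ρ (k + 1) := h1.trans_le hk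
    simp [h1, h2]
  · by_cases h2 : ‖lam i‖ < ρ (k + 1) <;> simp [h1, h2, not_lt.mp h1]

/-- Bessel's inequality for operators which are concentrated near disjoint sets of coordinates up to
small errors. -/
lemma sum_norm_sq_le_of_concentrated (hmono : Monotone ρ) (h4 : ∀ k, 4 * ρ k ≤ ρ (k + 1))
    {A : ℕ → H →L[ℂ] H} {K : ℝ} (hA : ∀ k, ‖A k‖ ≤ K)
    (hfar : ∀ k, ‖A k * e.coordProj (farFrom lam (ρ k))‖ ≤ (1 / 2) ^ k) (F : Finset ℕ) (x : H) :
    ∑ k ∈ F, ‖A k x‖ ^ 2 ≤ (2 * K ^ 2 + 4) * ‖x‖ ^ 2 := by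
  have hK : 0 ≤ K := (norm_nonneg _).trans (hA 0)
  have h1 : ∀ k, ‖A k x‖ ≤ K * ‖e.coordProj (farFrom lam (ρ k))ᶜ x‖ + (1 / 2) ^ k * ‖x‖ := by
    intro k
    have h2 : A k x = A k (e.coordProj (farFrom lam (ρ k))ᶜ x)
        + (A k * e.coordProj (farFrom lam (ρ k))) x := by
      rw [e.coordProj_compl, sub_apply, map_sub, mul_apply_eq_comp]
      exact (sub_add_cancel _ _).symm
    rw [h2]
    refine (norm_add_le _ _).trans (add_le_add ((A k).le_of_opNorm_le (hA k) _)
      (ContinuousLinearMap.le_of_opNorm_le _ (hfar k) _))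
  have h3 : ∀ k, ‖A k x‖ ^ 2
      ≤ 2 * K ^ 2 * ‖e.coordProj (farFrom lam (ρ k))ᶜ x‖ ^ 2 + 2 * ‖x‖ ^ 2 * (1 / 2) ^ k := by
    intro k
    have h5 : ((1 / 2 : ℝ) ^ k) ^ 2 ≤ (1 / 2) ^ k :=
      pow_le_of_le_one (by positivity) (pow_le_one₀ (by norm_num) (by norm_num)) two_ne_zero
    calc ‖A k x‖ ^ 2
        ≤ (K * ‖e.coordProj (farFrom lam (ρ k))ᶜ x‖ + (1 / 2) ^ k * ‖x‖) ^ 2 := by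
          gcongr
          exact h1 k
      _ ≤ 2 * ((K * ‖e.coordProj (farFrom lam (ρ k))ᶜ x‖) ^ 2 + ((1 / 2) ^ k * ‖x‖) ^ 2) :=
          add_sq_le
      _ = 2 * K ^ 2 * ‖e.coordProj (farFrom lam (ρ k))ᶜ x‖ ^ 2
          + 2 * ‖x‖ ^ 2 * ((1 / 2) ^ k) ^ 2 := by ring
      _ ≤ _ := by gcongr
  have h6 : ∑ k ∈ F, (1 / 2 : ℝ) ^ k ≤ 2 :=
    (summable_geometric_two.sum_le_tsum F fun k _ => by positivity).trans_eq tsum_geometric_two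
  calc ∑ k ∈ F, ‖A k x‖ ^ 2
      ≤ ∑ k ∈ F, (2 * K ^ 2 * ‖e.coordProj (farFrom lam (ρ k))ᶜ x‖ ^ 2
          + 2 * ‖x‖ ^ 2 * (1 / 2) ^ k) := Finset.sum_le_sum fun k _ => h3 k
    _ = 2 * K ^ 2 * ∑ k ∈ F, ‖e.coordProj (farFrom lam (ρ k))ᶜ x‖ ^ 2
          + 2 * ‖x‖ ^ 2 * ∑ k ∈ F, (1 / 2) ^ k := by
        rw [Finset.sum_add_distrib, Finset.mul_sum, Finset.mul_sum]
    _ ≤ 2 * K ^ 2 * ‖x‖ ^ 2 + 2 * ‖x‖ ^ 2 * 2 := by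
        gcongr
        exact e.sum_norm_coordProj_sq_le (pairwise_disjoint_compl_farFrom hmono h4) F x
    _ = _ := by ring

lemma sum_norm_band_add_sub_sq_le (hmono : Monotone ρ) (h4 : ∀ k, 4 * ρ k ≤ ρ (k + 1))
    {A : ℕ → H →L[ℂ] H} {K : ℝ} (hA : ∀ k, ‖A k‖ ≤ K)
    (hfar : ∀ k, ‖A k * e.coordProj (farFrom lam (ρ k))‖ ≤ (1 / 2) ^ k) (F : Finset ℕ) (x : H) :
    ∑ k ∈ F, ‖e.coordProj {i | ρ k ≤ ‖lam i‖ ∧ ‖lam i‖ < ρ (k + 1)} x + A (k + 1) x - A k x‖ ^ 2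
      ≤ (12 * K ^ 2 + 27) * ‖x‖ ^ 2 := by
  have h1 := e.sum_norm_coordProj_sq_le (pairwise_disjoint_band (lam := lam) hmono) F x
  have h2 := sum_norm_sq_le_of_concentrated hmono h4 hA hfar F x
  have h3 := sum_norm_sq_le_of_concentrated hmono h4 hA hfar (F.map ⟨_, Nat.succ_injective⟩) x
  rw [Finset.sum_map] at h3
  simp only [Function.Embedding.coeFn_mk, Nat.succ_eq_add_one] at h3
  have h5 : ∀ a b c : H, ‖a + b - c‖ ^ 2 ≤ 3 * (‖a‖ ^ 2 + ‖b‖ ^ 2 + ‖c‖ ^ 2) := by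
    intro a b c
    have h6 : ‖a + b - c‖ ≤ ‖a‖ + ‖b‖ + ‖c‖ := norm_sub_le_of_le (norm_add_le a b) le_rfl
    have h7 := norm_nonneg (a + b - c)
    nlinarith [sq_nonneg (‖a‖ - ‖b‖), sq_nonneg (‖b‖ - ‖c‖), sq_nonneg (‖a‖ - ‖c‖)]
  calc _ ≤ ∑ k ∈ F, 3 * (‖e.coordProj {i | ρ k ≤ ‖lam i‖ ∧ ‖lam i‖ < ρ (k + 1)} x‖ ^ 2
          + ‖A (k + 1) x‖ ^ 2 + ‖A k x‖ ^ 2) := Finset.sum_le_sum fun k _ => h5 _ _ _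
    _ = 3 * (∑ k ∈ F, ‖e.coordProj {i | ρ k ≤ ‖lam i‖ ∧ ‖lam i‖ < ρ (k + 1)} x‖ ^ 2
          + ∑ k ∈ F, ‖A (k + 1) x‖ ^ 2 + ∑ k ∈ F, ‖A k x‖ ^ 2) := by
        rw [← Finset.mul_sum, Finset.sum_add_distrib, Finset.sum_add_distrib]
    _ ≤ 3 * (‖x‖ ^ 2 + (2 * K ^ 2 + 4) * ‖x‖ ^ 2 + (2 * K ^ 2 + 4) * ‖x‖ ^ 2) := by gcongr
    _ = _ := by ring

/-- Increasing projections which are close to the spectral projections of a diagonal operator for a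
lacunary sequence of discs produce a Riesz basis of subspaces. -/
theorem isRieszBasisOfSubspaces_of_close [CompleteSpace H] (hmono : Monotone ρ)
    (h4 : ∀ k, 4 * ρ k ≤ ρ (k + 1)) (htop : Tendsto ρ atTop atTop) {P : ℕ → H →L[ℂ] H}
    (hP0 : P 0 = 0) (hP : ∀ k l, k ≤ l → P k * P l = P k ∧ P l * P k = P k) {K : ℝ}
    (hK : ∀ k, ‖P k - e.coordProj {i | ‖lam i‖ < ρ k}‖ ≤ K)
    (hr : ∀ k, ‖(P k - e.coordProj {i | ‖lam i‖ < ρ k}) * e.coordProj (farFrom lam (ρ k))‖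
      ≤ (1 / 2) ^ k)
    (hl : ∀ k, ‖e.coordProj (farFrom lam (ρ k)) * (P k - e.coordProj {i | ‖lam i‖ < ρ k})‖
      ≤ (1 / 2) ^ k) :
    IsRieszBasisOfSubspaces fun k => LinearMap.range ((P (k + 1) - P k : H →L[ℂ] H) : H →ₗ[ℂ] H) := by
  set A : ℕ → H →L[ℂ] H := fun k => P k - e.coordProj {i | ‖lam i‖ < ρ k} with hA
  have hdec : ∀ k, P (k + 1) - P k
      = e.coordProj {i | ρ k ≤ ‖lam i‖ ∧ ‖lam i‖ < ρ (k + 1)} + A (k + 1) - A k := by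
    intro k
    rw [← coordProj_sub_eq_band hmono]
    simp only [hA]
    abel
  have hidem : ∀ k, (P (k + 1) - P k) * (P (k + 1) - P k) = P (k + 1) - P k := by
    intro k
    rw [mul_sub, sub_mul, sub_mul, (hP _ _ le_rfl).1, (hP k k le_rfl).1,
      (hP k (k + 1) (Nat.le_succ k)).1, (hP k (k + 1) (Nat.le_succ k)).2]
    abel
  have hortho : ∀ k l, k ≠ l → (P (k + 1) - P k) * (P (l + 1) - P l) = 0 := by
    intro k l hkl
    rw [mul_sub, sub_mul, sub_mul]
    rcases lt_or_gt_of_ne hkl with h | h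
    · rw [(hP (k + 1) (l + 1) (by omega)).1, (hP k (l + 1) (by omega)).1, (hP (k + 1) l h).1,
        (hP k l h.le).1, sub_self]
    · rw [(hP (l + 1) (k + 1) (by omega)).2, (hP (l + 1) k h).2, (hP l (k + 1) (by omega)).2,
        (hP l k h.le).2, sub_self, sub_self, sub_zero]
  refine ⟨12 * K ^ 2 + 27, by nlinarith [sq_nonneg K], ?_,
    rieszBasis_bounds_of_bessel hidem hortho (by nlinarith [sq_nonneg K]) ?_ ?_⟩
  · set V := ⨆ k, LinearMap.range ((P (k + 1) - P k : H →L[ℂ] H) : H →ₗ[ℂ] H) with hV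
    have hmem : ∀ k x, P k x ∈ V := by
      intro k x
      induction k with
      | zero =>
        rw [hP0]
        exact V.zero_mem
      | succ k ih =>
        have h1 : P (k + 1) x = (P (k + 1) - P k) x + P k x := by
          rw [sub_apply, sub_add_cancel]
        rw [h1]
        exact V.add_mem (Submodule.mem_iSup_of_mem k ⟨x, rfl⟩) ih
    have hbasis : ∀ i, e i ∈ V.topologicalClosure := by
      intro i
      have hlim : Tendsto (fun k => P k (e i)) atTop (nhds (e i)) := by
        rw [tendsto_iff_norm_sub_tendsto_zero]
        refine squeeze_zero' (Eventually.of_forall fun k => norm_nonneg _) ?_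
          (tendsto_pow_atTop_nhds_zero_of_lt_one (by norm_num : (0 : ℝ) ≤ 1 / 2) (by norm_num))
        filter_upwards [htop.eventually_ge_atTop (2 * ‖lam i‖ + 1)] with k hk
        have hn := norm_nonneg (lam i)
        have h1 : i ∈ farFrom lam (ρ k) := Or.inl (by linarith)
        have h2 : i ∈ {i | ‖lam i‖ < ρ k} := by
          change ‖lam i‖ < ρ k
          linarith
        have h3 : ∀ s : Set ι, i ∈ s → e.coordProj s (e i) = e i := by
          intro s hs
          rw [HilbertBasis.coordProj, e.diag_apply_basis (HilbertBasis.norm_indicator_one_le s),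
            Set.indicator_of_mem hs, Pi.one_apply, one_smul]
        have h5 : P k (e i) - e i = (A k * e.coordProj (farFrom lam (ρ k))) (e i) := by
          rw [mul_apply_eq_comp, h3 _ h1, hA]
          simp only
          rw [sub_apply, h3 _ h2]
        rw [h5]
        refine (ContinuousLinearMap.le_of_opNorm_le _ (hr k) _).trans ?_
        rw [e.norm_apply, mul_one]
      exact mem_closure_of_tendsto hlim (Eventually.of_forall fun k => hmem k _)
    have hspan : Submodule.span ℂ (Set.range e) ≤ V.topologicalClosure :=
      Submodule.span_le.mpr (Set.range_subset_iff.mpr hbasis)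
    have htop' := Submodule.topologicalClosure_minimal _ hspan V.isClosed_topologicalClosure
    rw [e.dense_span, top_le_iff] at htop'
    exact Submodule.dense_iff_topologicalClosure_eq_top.mpr htop'
  · intro F x
    simp only [hdec]
    exact sum_norm_band_add_sub_sq_le hmono h4 hK hr F x
  · intro F x
    simp only [hdec, map_sub, map_add, e.adjoint_coordProj]
    refine sum_norm_band_add_sub_sq_le (A := fun k => (A k).adjoint) hmono h4 (fun k => ?_)
      (fun k => ?_) F x
    · rw [LinearIsometryEquiv.norm_map]
      exact hK k
    · have h1 : (A k).adjoint * e.coordProj (farFrom lam (ρ k))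
          = (e.coordProj (farFrom lam (ρ k)) * A k).adjoint := by
        rw [ContinuousLinearMap.mul_def, ContinuousLinearMap.mul_def,
          ContinuousLinearMap.adjoint_comp, e.adjoint_coordProj]
      rw [h1, LinearIsometryEquiv.norm_map]
      exact hl k

end Op

lemma exists_lacunary_sequence {good : ℝ → Prop} (h : ∀ R, ∃ r > R, good r) {K q : ℝ}
    (hq : q < 0) :
    ∃ ρ : ℕ → ℝ, ρ 0 = 0 ∧ Monotone ρ ∧ (∀ k, 4 * ρ k ≤ ρ (k + 1)) ∧ Tendsto ρ atTop atTop ∧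
      ∀ k, 1 ≤ ρ (k + 1) ∧ good (ρ (k + 1)) ∧ K * ρ (k + 1) ^ q ≤ (1 / 2) ^ (k + 1) := by
  have hstep : ∀ (k : ℕ) (s : ℝ), ∃ r, 4 * s ≤ r ∧ k + 1 ≤ r ∧ good r ∧
      K * r ^ q ≤ (1 / 2) ^ (k + 1) := by
    intro k s
    have h1 : Tendsto (fun r : ℝ => K * r ^ q) atTop (nhds 0) := by
      simpa using (tendsto_rpow_neg_atTop (neg_pos.mpr hq)).const_mul K
    obtain ⟨B, hB⟩ := eventually_atTop.mp
      (h1.eventually_le_const (show (0 : ℝ) < (1 / 2) ^ (k + 1) by positivity))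
    obtain ⟨r, hr, hgood⟩ := h (max B (max (4 * s) (k + 1)))
    rw [gt_iff_lt, max_lt_iff, max_lt_iff] at hr
    exact ⟨r, hr.2.1.le, hr.2.2.le, hgood, hB r hr.1.le⟩
  choose f hf4 hfk hfgood hfK using hstep
  let ρ : ℕ → ℝ := fun k => Nat.rec 0 (fun k s => f k s) k
  have hsucc : ∀ k, ρ (k + 1) = f k (ρ k) := fun k => rfl
  have hge : ∀ k : ℕ, (k : ℝ) ≤ ρ k := by
    rintro (_ | k)
    · exact Nat.cast_zero.le
    · rw [hsucc, Nat.cast_succ]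
      exact hfk k _
  have h4 : ∀ k, 4 * ρ k ≤ ρ (k + 1) := fun k => hf4 k _
  refine ⟨ρ, rfl, monotone_nat_of_le_succ fun k => ?_, h4,
    tendsto_atTop_mono hge tendsto_natCast_atTop_atTop, fun k => ⟨?_, hfgood k _, hfK k _⟩⟩
  · linarith [h4 k, hge k, (k.cast_nonneg : (0 : ℝ) ≤ k)]
  · have := hge (k + 1)
    rw [Nat.cast_succ] at this
    linarith [(k.cast_nonneg : (0 : ℝ) ≤ k)]

namespace Op

variable {ι H : Type*} [NormedAddCommGroup H] [InnerProductSpace ℂ H]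
  {e : HilbertBasis ι ℂ H} {lam : ι → ℂ} {G S T : Op H}

lemma subordinate_zero {p b : ℝ} (hb : 0 ≤ b) : (⟨⊤, 0⟩ : Op H).Subordinate G p b := by
  refine ⟨fun _ _ => trivial, fun u _ => ?_⟩
  rw [LinearMap.zero_apply, norm_zero]
  positivity

lemma addOp_zero : G.addOp ⟨⊤, 0⟩ = G := by
  rw [addOp, add_zero]

lemma rieszProj_zero [CompleteSpace H] : T.rieszProj 0 = 0 := by
  rw [rieszProj, circleIntegral.integral_radius_zero, smul_zero]

/-- Both `G` and `G + S` satisfy the resolvent bound on arbitrarily large circles. -/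
lemma exists_hasRayBound [CompleteSpace H] {J : Type*} [Fintype J] [Nonempty J] {ω : J → ℂ}
    {p b : ℝ} (hS : S.Subordinate G p b) (h : G.IsDiagonalIn e lam) (hp0 : 0 ≤ p) (hp1 : p < 1)
    (hb : 0 ≤ b) (hω : ∀ j, ‖ω j‖ = 1) (hray : ∀ i, ∃ j, lam i = ‖lam i‖ * ω j)
    (hfin : ∀ r : ℝ, {i | ‖lam i‖ ≤ r}.Finite) {c : ℝ}
    (hc : ∃ᶠ r : ℝ in atTop, ((hfin r).toFinset.card : ℝ) ≤ c * r ^ (1 - p)) :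
    ∃ C > 0, ∀ R, ∃ r > R, G.HasRayBound ω p C r ∧ (G.addOp S).HasRayBound ω p C r := by
  obtain ⟨C, hC, hgood⟩ := exists_good_circles (S := fun k : Bool => cond k S ⟨⊤, 0⟩)
    (Bool.forall_bool.mpr ⟨subordinate_zero hb, hS⟩) h hp0 hp1 hb hω hray hfin hc
  refine ⟨C, hC, fun R => ?_⟩
  obtain ⟨r, hr, hres⟩ := hgood R
  have key : ∀ k : Bool, (G.addOp (cond k S ⟨⊤, 0⟩)).HasRayBound ω p C r := by
    intro k z hz
    obtain ⟨R, hR, hRC⟩ := hres k z hz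
    exact ⟨⟨R, hR⟩, hR.res_eq ▸ hRC⟩
  exact ⟨r, hr, addOp_zero (G := G) ▸ key false, key true⟩

/-- The Riesz projections of `T` for a lacunary sequence of circles, if they are close to the
spectral projections of a diagonal operator, produce a Riesz basis of finite-dimensional invariant
subspaces. -/
lemma exists_rieszBasis_of_rieszProj [CompleteSpace H] {ρ : ℕ → ℝ} (h0 : ρ 0 = 0)
    (hmono : Monotone ρ) (h4 : ∀ k, 4 * ρ k ≤ ρ (k + 1)) (htop : Tendsto ρ atTop atTop)
    (hpos : ∀ k, 0 < ρ (k + 1)) (hT : ∀ k z, ‖z‖ = ρ (k + 1) → z ∈ T.resolventSet)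
    (hfin : ∀ r : ℝ, {i | ‖lam i‖ ≤ r}.Finite) {K : ℝ} (hK0 : 0 ≤ K)
    (hK : ∀ k, ‖T.rieszProj (ρ (k + 1)) - e.coordProj {i | ‖lam i‖ < ρ (k + 1)}‖ ≤ K)
    (hr : ∀ k, ‖(T.rieszProj (ρ (k + 1)) - e.coordProj {i | ‖lam i‖ < ρ (k + 1)})
      * e.coordProj (farFrom lam (ρ (k + 1)))‖ ≤ (1 / 2) ^ (k + 1))
    (hl : ∀ k, ‖e.coordProj (farFrom lam (ρ (k + 1)))
      * (T.rieszProj (ρ (k + 1)) - e.coordProj {i | ‖lam i‖ < ρ (k + 1)})‖ ≤ (1 / 2) ^ (k + 1)) :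
    ∃ V : ℕ → Submodule ℂ H, (∀ k, FiniteDimensional ℂ (V k)) ∧
      (∀ k, (V k : Set H) ⊆ (T.dom : Set H)) ∧ (∀ k, ∀ x ∈ V k, T.app x ∈ V k) ∧
      IsRieszBasisOfSubspaces V := by
  have hP0 : T.rieszProj (ρ 0) = 0 := by rw [h0, rieszProj_zero]
  have hA0 : T.rieszProj (ρ 0) - e.coordProj {i | ‖lam i‖ < ρ 0} = 0 := by
    refine ContinuousLinearMap.ext fun x => e.ext_inner fun i => ?_
    rw [hP0, sub_apply, inner_sub_right, e.inner_coordProj, h0]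
    simp [(norm_nonneg (lam i)).not_gt]
  have hP : ∀ k l, k ≤ l → T.rieszProj (ρ k) * T.rieszProj (ρ l) = T.rieszProj (ρ k) ∧
      T.rieszProj (ρ l) * T.rieszProj (ρ k) = T.rieszProj (ρ k) := by
    rintro (_ | k) l hkl
    · rw [hP0, zero_mul, mul_zero]
      exact ⟨rfl, rfl⟩
    · obtain ⟨l, rfl⟩ := Nat.exists_eq_add_of_le' (k.succ_pos.trans_le hkl)
      have h1 := rieszProj_mul_rieszProj (hpos k) (hmono hkl) (hT k) (hT l)
      exact ⟨h1, (commute_rieszProj_rieszProj (hpos l).le (hpos k).le (hT l) (hT k)).eq.trans h1⟩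
  have hfd : ∀ k, FiniteDimensional ℂ (LinearMap.range
      ((T.rieszProj (ρ (k + 1)) - T.rieszProj (ρ k) : H →L[ℂ] H) : H →ₗ[ℂ] H)) := by
    intro k
    have := finiteDimensional_range_of_close (hfin _) (hpos k) (hP _ _ le_rfl).1
      ((hl k).trans_lt (pow_lt_one₀ (by norm_num) (by norm_num) k.succ_ne_zero))
    refine Submodule.finiteDimensional_of_le
      (S₂ := LinearMap.range (T.rieszProj (ρ (k + 1)) : H →ₗ[ℂ] H)) ?_
    rintro - ⟨x, rfl⟩
    refine ⟨(T.rieszProj (ρ (k + 1)) - T.rieszProj (ρ k)) x, ?_⟩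
    have h1 : T.rieszProj (ρ (k + 1)) * (T.rieszProj (ρ (k + 1)) - T.rieszProj (ρ k))
        = T.rieszProj (ρ (k + 1)) - T.rieszProj (ρ k) := by
      rw [mul_sub, (hP _ _ le_rfl).1, (hP _ _ k.le_succ).2]
    exact DFunLike.congr_fun h1 x
  obtain ⟨R, hR⟩ := hT 0 (ρ 1) (by rw [norm_real, Real.norm_of_nonneg (hpos 0).le])
  have hcomm : ∀ k, Commute R (T.rieszProj (ρ k)) := by
    rintro (_ | k)
    · rw [hP0]
      exact Commute.zero_right R
    · exact commute_rieszProj (hpos k).le (hT k) hR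
  have hinv : ∀ k, _ := fun k => by
    have := hfd k
    refine hR.invariant_of_finiteDimensional (LinearMap.range
      ((T.rieszProj (ρ (k + 1)) - T.rieszProj (ρ k) : H →L[ℂ] H) : H →ₗ[ℂ] H)) ?_
    rintro - ⟨x, rfl⟩
    exact ⟨R x, (DFunLike.congr_fun ((hcomm (k + 1)).sub_right (hcomm k)).eq x).symm⟩
  refine ⟨_, hfd, fun k => (hinv k).1, fun k => (hinv k).2,
    isRieszBasisOfSubspaces_of_close (P := fun k => T.rieszProj (ρ k)) hmono h4 htop hP0 hP
      (e := e) (lam := lam) (K := K) ?_ ?_ ?_⟩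
  · rintro (_ | k)
    · rw [hA0, norm_zero]
      exact hK0
    · exact hK k
  · rintro (_ | k)
    · rw [hA0, zero_mul, norm_zero]
      positivity
    · exact hr k
  · rintro (_ | k)
    · rw [hA0, mul_zero, norm_zero]
      positivity
    · exact hl k

end Op

end

/-- if `G` is normal with compact resolvent, its spectrum lies on finitely
many rays from the origin, `S` is `p`-subordinate to `G` and
`liminf_{r→∞} N(r,G)/r^{1-p} < ∞` (i.e. `N(r,G) ≤ c r^{1-p}` frequently), then
`T = G + S` admits a Riesz basis of finite-dimensional `T`-invariant subspaces. -/
theorem statement14 {H : Type*} [NormedAddCommGroup H] [InnerProductSpace ℂ H]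
    [CompleteSpace H] [TopologicalSpace.SeparableSpace H] (G S T : Op H)
    (hG : G.IsNormalOp) (hGres : G.HasCompactResolvent)
    (n : ℕ) (θ : Fin n → ℝ)
    (hspec : G.spec ⊆ ⋃ j, rayFrom (θ j))
    (p b : ℝ) (hp0 : 0 ≤ p) (hp1 : p < 1) (hb : 0 ≤ b)
    (hsub : S.Subordinate G p b)
    (hT : T = G.addOp S)
    (hliminf : ∃ c : ℝ, ∃ᶠ r : ℝ in atTop,
      (G.dimIn (Metric.closedBall (0 : ℂ) r) : ℝ) ≤ c * r ^ (1 - p)) :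
    ∃ V : ℕ → Submodule ℂ H,
      (∀ k, FiniteDimensional ℂ (V k)) ∧
      (∀ k, (V k : Set H) ⊆ (T.dom : Set H)) ∧
      (∀ k, ∀ x ∈ V k, T.app x ∈ V k) ∧
      IsRieszBasisOfSubspaces V := by
  subst hT
  obtain ⟨ι, e, lam, h, hfin⟩ := hG.exists_isDiagonalIn hGres
  obtain ⟨c, hc⟩ := hliminf
  have hc' : ∃ᶠ r : ℝ in atTop, ((hfin r).toFinset.card : ℝ) ≤ c * r ^ (1 - p) := by
    refine hc.mono fun r hr => ?_
    have hK : {i | lam i ∈ Metric.closedBall (0 : ℂ) r} = {i | ‖lam i‖ ≤ r} :=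
      Set.ext fun i => mem_closedBall_zero_iff
    rw [h.dimIn_eq_card (hK ▸ hfin r)] at hr
    convert hr using 5
    exact hK.symm
  let ω : Option (Fin n) → ℂ := fun j => j.elim 1 fun j => Complex.exp (θ j * Complex.I)
  have hω : ∀ j, ‖ω j‖ = 1 := by
    rintro (_ | j)
    · exact norm_one
    · exact Complex.norm_exp_ofReal_mul_I (θ j)
  have hray : ∀ i, ∃ j, lam i = ‖lam i‖ * ω j := by
    intro i
    obtain ⟨j, x, hx, hlam⟩ := Set.mem_iUnion.mp (hspec (h.mem_spec i))
    refine ⟨some j, ?_⟩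
    have hnorm : ‖lam i‖ = x := by
      rw [hlam, norm_mul, Complex.norm_exp_ofReal_mul_I, mul_one, Complex.norm_of_nonneg hx]
    rw [hnorm]
    exact hlam
  obtain ⟨C, hC, hcircles⟩ := Op.exists_hasRayBound hsub h hp0 hp1 hb hω hray hfin hc'
  obtain ⟨K, hK0, hK⟩ := Op.exists_norm_rieszProj_sub_le hsub h hp0 hp1 hb hω hC.le
  obtain ⟨ρ, h0, hmono, h4, htop, hρ⟩ :=
    exists_lacunary_sequence hcircles (K := K) (q := -(1 - p) / 2) (by linarith)
  have hpos : ∀ k, 0 < ρ (k + 1) := fun k => one_pos.trans_le (hρ k).1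
  have hQ : ∀ k, G.rieszProj (ρ (k + 1)) = e.coordProj {i | ‖lam i‖ < ρ (k + 1)} := fun k =>
    h.rieszProj_eq (hpos k) fun z hz => ((hρ k).2.1.1 z hz).1
  have hclose := fun k => hQ k ▸ hK _ (hρ k).1 (hρ k).2.1.1 (hρ k).2.1.2
  exact Op.exists_rieszBasis_of_rieszProj h0 hmono h4 htop hpos
    (fun k z hz => ((hρ k).2.1.2 z hz).1) hfin hK0 (fun k => (hclose k).1)
    (fun k => (hclose k).2.1.trans (hρ k).2.2) (fun k => (hclose k).2.2.trans (hρ k).2.2)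
end

section
/- Let (r_k)_{k∈ℕ} be a sequence of nonnegative real numbers given by r_k = c·k^q + d_k·k^{q−1}, where c > 0, q ≥ 1, and (d_k)_{k∈ℕ} is a convergent sequence of reals. Let l, p ≥ 0. If either (i) p < 1 − 1/q, or (ii) p = 1 − 1/q and l < q·c^{1/q}/2, then the inequality r_k + l·r_k^p ≤ r_{k+1} − l·r_{k+1}^p holds for all but finitely many k ∈ ℕ. -/
open Filter

theorem tendsto_natCast_inv_nhdsGT_zero :
    Tendsto (fun k : ℕ => ((k : ℝ))⁻¹) atTop (nhdsWithin 0 (Set.Ioi 0)) :=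
  tendsto_inv_atTop_nhdsGT_zero.comp tendsto_natCast_atTop_atTop

theorem tendsto_one_add_inv_rpow (s : ℝ) :
    Tendsto (fun k : ℕ => (1 + (k : ℝ)⁻¹) ^ s) atTop (nhds 1) := by
  have h : Tendsto (fun k : ℕ => 1 + (k : ℝ)⁻¹) atTop (nhds (1 + 0)) :=
    tendsto_const_nhds.add (tendsto_natCast_inv_nhdsGT_zero.mono_right nhdsWithin_le_nhds)
  simpa using h.rpow_const (p := s) (Or.inl (by norm_num))

theorem tendsto_mul_one_add_inv_rpow_sub_one (q : ℝ) :
    Tendsto (fun k : ℕ => (k : ℝ) * ((1 + (k : ℝ)⁻¹) ^ q - 1)) atTop (nhds q) := by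
  have h : HasDerivAt (fun x : ℝ => x ^ q) (q * 1 ^ (q - 1)) 1 :=
    Real.hasDerivAt_rpow_const (Or.inl one_ne_zero)
  simpa [Function.comp_def] using
    h.tendsto_slope_zero_right.comp tendsto_natCast_inv_nhdsGT_zero

theorem add_one_rpow_eq_rpow_mul {x : ℝ} (hx : 0 < x) (s : ℝ) :
    (x + 1) ^ s = x ^ s * (1 + x⁻¹) ^ s := by
  rw [← Real.mul_rpow hx.le (by positivity)]
  congr 1
  field_simp

section PerturbedPower

variable {c q L : ℝ} {d r : ℕ → ℝ}

theorem tendsto_perturbed_div_rpow (hd : Tendsto d atTop (nhds L))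
    (hr : ∀ k : ℕ, r k = c * (k : ℝ) ^ q + d k * (k : ℝ) ^ (q - 1)) :
    Tendsto (fun k : ℕ => r k / (k : ℝ) ^ q) atTop (nhds c) := by
  have h : Tendsto (fun k : ℕ => c + d k * (k : ℝ)⁻¹) atTop (nhds (c + L * 0)) :=
    tendsto_const_nhds.add
      (hd.mul (tendsto_natCast_inv_nhdsGT_zero.mono_right nhdsWithin_le_nhds))
  rw [mul_zero, add_zero] at h
  refine h.congr' ?_
  filter_upwards [eventually_gt_atTop 0] with k hk
  have hk' : (0 : ℝ) < k := by exact_mod_cast hk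
  have hkq : (0 : ℝ) < (k : ℝ) ^ q := by positivity
  rw [hr, Real.rpow_sub_one hk'.ne']
  field_simp

theorem tendsto_perturbed_gap_div_rpow (hd : Tendsto d atTop (nhds L))
    (hr : ∀ k : ℕ, r k = c * (k : ℝ) ^ q + d k * (k : ℝ) ^ (q - 1)) :
    Tendsto (fun k : ℕ => (r (k + 1) - r k) / (k : ℝ) ^ (q - 1)) atTop (nhds (c * q)) := by
  have h := ((tendsto_mul_one_add_inv_rpow_sub_one q).const_mul c).add
    ((((tendsto_add_atTop_iff_nat 1).2 hd).mul (tendsto_one_add_inv_rpow (q - 1))).sub hd)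
  rw [mul_one, sub_self, add_zero] at h
  refine h.congr' ?_
  filter_upwards [eventually_gt_atTop 0] with k hk
  have hk' : (0 : ℝ) < k := by exact_mod_cast hk
  have hkq : (0 : ℝ) < (k : ℝ) ^ (q - 1) := by positivity
  have hkk : (k : ℝ) ^ q = (k : ℝ) ^ (q - 1) * k := by
    rw [← Real.rpow_add_one hk'.ne', sub_add_cancel]
  rw [hr, hr, Nat.cast_add_one, add_one_rpow_eq_rpow_mul hk', add_one_rpow_eq_rpow_mul hk', hkk]
  field_simp
  ring

theorem tendsto_perturbed_rpow_div_rpow (hc : 0 < c) (hd : Tendsto d atTop (nhds L))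
    (hr : ∀ k : ℕ, r k = c * (k : ℝ) ^ q + d k * (k : ℝ) ^ (q - 1)) (hrpos : ∀ k, 0 ≤ r k)
    {p B : ℝ} (hB : Tendsto (fun k : ℕ => (k : ℝ) ^ (q * p - (q - 1))) atTop (nhds B)) :
    Tendsto (fun k : ℕ => r k ^ p / (k : ℝ) ^ (q - 1)) atTop (nhds (c ^ p * B)) := by
  refine (((tendsto_perturbed_div_rpow hd hr).rpow_const (p := p) (Or.inl hc.ne')).mul
    hB).congr' ?_
  filter_upwards [eventually_gt_atTop 0] with k hk
  have hk' : (0 : ℝ) < k := by exact_mod_cast hk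
  have hkq : (0 : ℝ) < (k : ℝ) ^ (q * p) := by positivity
  rw [Real.div_rpow (hrpos k) (by positivity), ← Real.rpow_mul hk'.le, Real.rpow_sub hk']
  field_simp

theorem eventually_perturbed_gap (hc : 0 < c) (hd : Tendsto d atTop (nhds L))
    (hr : ∀ k : ℕ, r k = c * (k : ℝ) ^ q + d k * (k : ℝ) ^ (q - 1)) (hrpos : ∀ k, 0 ≤ r k)
    {l p B : ℝ} (hB : Tendsto (fun k : ℕ => (k : ℝ) ^ (q * p - (q - 1))) atTop (nhds B))
    (hlt : 2 * l * (c ^ p * B) < c * q) :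
    ∀ᶠ k in atTop, r k + l * r k ^ p ≤ r (k + 1) - l * r (k + 1) ^ p := by
  have hpow := tendsto_perturbed_rpow_div_rpow hc hd hr hrpos hB
  have hsum := (hpow.add (((tendsto_add_atTop_iff_nat 1).2 hpow).mul
    (tendsto_one_add_inv_rpow (q - 1)))).const_mul l
  have hlim : l * (c ^ p * B + c ^ p * B * 1) < c * q := by linarith
  filter_upwards [hsum.eventually_lt (tendsto_perturbed_gap_div_rpow hd hr) hlim,
    eventually_gt_atTop 0] with k hlt hk
  have hk' : (0 : ℝ) < k := by exact_mod_cast hk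
  have hkq : (0 : ℝ) < (k : ℝ) ^ (q - 1) := by positivity
  have hxq : (0 : ℝ) < (1 + (k : ℝ)⁻¹) ^ (q - 1) := by positivity
  rw [Nat.cast_add_one, add_one_rpow_eq_rpow_mul hk', lt_div_iff₀ hkq] at hlt
  field_simp at hlt
  linarith

end PerturbedPower

/-- for `r_k = c k^q + d_k k^{q-1}` with `c > 0`, `q ≥ 1`, `(d_k)`
convergent and `r_k ≥ 0`, and `l, p ≥ 0`, the gap condition
`r_k + l r_kᵖ ≤ r_{k+1} - l r_{k+1}ᵖ` holds for all but finitely many `k` provided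
(i) `p < 1 - 1/q`, or (ii) `p = 1 - 1/q` and `l < q c^{1/q} / 2`. -/
theorem statement17 (c q l p : ℝ) (hc : 0 < c) (hq : 1 ≤ q) (hl : 0 ≤ l) (hp : 0 ≤ p)
    (d : ℕ → ℝ) (hd : ∃ L : ℝ, Tendsto d atTop (nhds L))
    (r : ℕ → ℝ)
    (hr : ∀ k : ℕ, r k = c * (k : ℝ) ^ q + d k * (k : ℝ) ^ (q - 1))
    (hrpos : ∀ k, 0 ≤ r k)
    (hcase : p < 1 - 1 / q ∨ (p = 1 - 1 / q ∧ l < q * c ^ (1 / q) / 2)) :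
    ∃ k0 : ℕ, ∀ k ≥ k0, r k + l * r k ^ p ≤ r (k + 1) - l * r (k + 1) ^ p := by
  obtain ⟨L, hL⟩ := hd
  have hq0 : 0 < q := by linarith
  have hexp : q * (1 - 1 / q) = q - 1 := by field_simp
  rw [← eventually_atTop]
  rcases hcase with hlt | ⟨rfl, hlt⟩
  · have hneg : 0 < -(q * p - (q - 1)) := by
      rw [← hexp]
      nlinarith
    have hB : Tendsto (fun k : ℕ => (k : ℝ) ^ (q * p - (q - 1))) atTop (nhds 0) := by
      simpa only [neg_neg, Function.comp_def] using
        (tendsto_rpow_neg_atTop hneg).comp tendsto_natCast_atTop_atTop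
    refine eventually_perturbed_gap hc hL hr hrpos hB ?_
    rw [mul_zero, mul_zero]
    positivity
  · have hB : Tendsto (fun k : ℕ => (k : ℝ) ^ (q * (1 - 1 / q) - (q - 1))) atTop (nhds 1) := by
      simp only [hexp, sub_self, Real.rpow_zero]
      exact tendsto_const_nhds
    refine eventually_perturbed_gap hc hL hr hrpos hB ?_
    have hcp : 0 < c ^ (1 - 1 / q) := by positivity
    have hmul : c ^ (1 - 1 / q) * c ^ (1 / q) = c := by
      rw [← Real.rpow_add hc, sub_add_cancel, Real.rpow_one]
    calc 2 * l * (c ^ (1 - 1 / q) * 1) < q * c ^ (1 / q) * c ^ (1 - 1 / q) := by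
          nlinarith
      _ = c ^ (1 - 1 / q) * c ^ (1 / q) * q := by ring
      _ = c * q := by rw [hmul]
end
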